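/- Let f be an integer-valued multiplicative function such that f(p) = Rp + S for all primes p, where R, S are integers with R ≠ 0. Fix a real number K > 0. Then for every ε > 0 there exists x₀ such that for all x ≥ x₀, all positive integers q ≤ (log x)^K with gcd(q, 6R) = 1, and all integers a with gcd(a, q) = 1, one has |#{n ≤ x : f(n) ≡ a (mod q)} − (1/φ(q))·#{n ≤ x : gcd(f(n), q) = 1}| ≤ (ε/φ(q))·#{n ≤ x : gcd(f(n), q) = 1}. (That is, the values f(n), for n ≤ x, are asymptotically weakly uniformly distributed modulo q, uniformly for q ≤ (log x)^K coprime to 6R.) -/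

import Mathlib

/-- The number of positive integers `n ≤ x` satisfying the predicate `P`. -/
noncomputable def cnt (x : ℝ) (P : ℕ → Prop) : ℕ :=
  Set.ncard {n : ℕ | 0 < n ∧ (n : ℝ) ≤ x ∧ P n}

section
open DirichletCharacter Finset

namespace SW

lemma sum_block {q : ℕ} [NeZero q] (χ : DirichletCharacter ℂ q) (hχ : χ ≠ 1) (m : ℕ) :
    ∑ i ∈ range q, χ ((m + i : ℕ) : ZMod q) = 0 := by
  have h1 : ∑ a : ZMod q, χ ((m : ZMod q) + a) = 0 := by
    rw [← MulChar.sum_eq_zero_of_ne_one hχ]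
    exact Equiv.sum_comp (Equiv.addLeft (m : ZMod q)) (fun a => χ a)
  rw [← h1]
  refine Finset.sum_bij' (fun i _ => (i : ZMod q)) (fun a _ => a.val) ?_ ?_ ?_ ?_ ?_
  · intros; simp
  · intro a _; simpa using ZMod.val_lt a
  · intro i hi; simp at hi; exact ZMod.val_cast_of_lt hi
  · intro a _; simp
  · intro i _; simp

lemma norm_sum_range_le {q : ℕ} [NeZero q] (χ : DirichletCharacter ℂ q) (hχ : χ ≠ 1) (n : ℕ) :
    ‖∑ i ∈ range n, χ (i : ZMod q)‖ ≤ q := by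
  induction n using Nat.strong_induction_on with
  | _ n ih =>
    by_cases hn : n < q
    · refine (norm_sum_le _ _).trans ?_
      refine (Finset.sum_le_card_nsmul _ _ 1 (fun i _ => χ.norm_le_one _)).trans ?_
      simp only [card_range, nsmul_eq_mul, mul_one]
      exact_mod_cast hn.le
    · push Not at hn
      have hq : 0 < q := NeZero.pos q
      obtain ⟨m, rfl⟩ := Nat.exists_eq_add_of_le' hn
      rw [Finset.sum_range_add, sum_block χ hχ, add_zero]
      exact ih m (by omega)

lemma norm_sum_Icc_le {q : ℕ} [NeZero q] (χ : DirichletCharacter ℂ q) (hχ : χ ≠ 1) (n : ℕ) :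
    ‖∑ i ∈ Icc 1 n, χ (i : ZMod q)‖ ≤ 2 * q := by
  have h : ∑ i ∈ range (n+1), χ (i : ZMod q) = χ 0 + ∑ i ∈ Icc 1 n, χ (i : ZMod q) := by
    rw [Finset.range_eq_Ico, Finset.sum_eq_sum_Ico_succ_bot (by omega)]
    simp; rfl
  have h0 : ‖χ 0‖ ≤ 1 := χ.norm_le_one _
  have h2 : (1:ℝ) ≤ q := by exact_mod_cast NeZero.pos q
  have h3 := norm_sum_range_le χ hχ (n+1)
  have : ∑ i ∈ Icc 1 n, χ (i : ZMod q) = ∑ i ∈ range (n+1), χ (i : ZMod q) - χ 0 := by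
    rw [h]; ring
  rw [this]
  exact (norm_sub_le _ _).trans (by linarith)

/-- summatory integral -/
noncomputable def sumInt (f : ℕ → ℂ) (s : ℂ) : ℂ :=
  ∫ t in Set.Ioi (1 : ℝ), (∑ k ∈ Icc 1 ⌊t⌋₊, f k) * (t : ℂ) ^ (-(s + 1))

lemma measurable_part (f : ℕ → ℂ) : Measurable (fun t : ℝ => ∑ k ∈ Icc 1 ⌊t⌋₊, f k) :=
  (measurable_from_nat (f := fun n => ∑ k ∈ Icc 1 n, f k)).comp Nat.measurable_floor

lemma sumInt_differentiableAt (f : ℕ → ℂ) {M : ℝ} (hM : ∀ n, ‖∑ k ∈ Icc 1 n, f k‖ ≤ M) {s : ℂ}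
    (hs : 0 < s.re) : DifferentiableAt ℂ (sumInt f) s := by
  set P : ℝ → ℂ := (Set.Ioi (1:ℝ)).indicator (fun t : ℝ => ∑ k ∈ Icc 1 ⌊t⌋₊, f k) with hP
  have hM0 : 0 ≤ M := (norm_nonneg _).trans (hM 0)
  have hPb : ∀ t, ‖P t‖ ≤ M := by
    intro t
    rw [hP, Set.indicator_apply]
    split_ifs
    · exact hM _
    · simpa using hM0
  have hmeas : Measurable P := (measurable_part f).indicator measurableSet_Ioi
  have heq : sumInt f = fun s => mellin P (-s) := by
    funext s
    rw [sumInt, mellin]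
    rw [← MeasureTheory.integral_indicator measurableSet_Ioi,
      ← MeasureTheory.integral_indicator measurableSet_Ioi]
    congr 1
    funext t
    by_cases h : 1 < t
    · have h0 : 0 < t := by linarith
      simp only [hP, Set.indicator_apply, Set.mem_Ioi, h, h0, if_true, smul_eq_mul]
      rw [mul_comm]; congr 2; ring
    · simp [hP, Set.indicator_apply, h]
  rw [heq]
  have : DifferentiableAt ℂ (mellin P) (-s) := by
    refine mellin_differentiableAt_of_isBigO_rpow (a := 0) (b := -s.re - 1) ?_ ?_ (by simpa using hs) ?_ ?_
    · refine MeasureTheory.LocallyIntegrable.locallyIntegrableOn ?_ _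
      refine (MeasureTheory.locallyIntegrable_const (M : ℝ)).mono hmeas.aestronglyMeasurable ?_
      exact Filter.Eventually.of_forall fun t => (hPb t).trans (le_abs_self _)
    · refine Asymptotics.IsBigO.of_bound M (Filter.Eventually.of_forall fun t => ?_)
      simpa using hPb t
    · have : P =ᶠ[nhdsWithin 0 (Set.Ioi 0)] fun _ => 0 := by
        filter_upwards [nhdsWithin_le_nhds (Iio_mem_nhds (show (0:ℝ) < 1 by norm_num))] with t ht
        simp only [Set.mem_Iio] at ht
        simp [hP, ht.le]
      exact this.trans_isBigO (Asymptotics.isBigO_zero _ _)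
    · simp
  exact this.comp s differentiableAt_id.neg

lemma norm_sumInt_le (f : ℕ → ℂ) {M : ℝ} (hM : ∀ n, ‖∑ k ∈ Icc 1 n, f k‖ ≤ M) {N : ℕ} (hN : 1 ≤ N)
    (hf : ∀ n ≤ N, f n = 0) {s : ℂ} (hs : 0 < s.re) :
    ‖sumInt f s‖ ≤ M * ((N:ℝ) ^ (-s.re) / s.re) := by
  have hN0 : (0:ℝ) < N := by exact_mod_cast hN
  have hM0 : 0 ≤ M := (norm_nonneg _).trans (hM 0)
  have h1 : sumInt f s = ∫ t in Set.Ioi (N : ℝ), (∑ k ∈ Icc 1 ⌊t⌋₊, f k) * (t : ℂ) ^ (-(s + 1)) := by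
    rw [sumInt]
    refine MeasureTheory.setIntegral_eq_of_subset_of_forall_sdiff_eq_zero measurableSet_Ioi ?_ ?_
    · intro t ht
      simp only [Set.mem_Ioi] at ht ⊢
      have : (1:ℝ) ≤ N := by exact_mod_cast hN
      linarith
    · intro t ht
      simp only [Set.mem_sdiff, Set.mem_Ioi, not_lt] at ht
      rw [Finset.sum_eq_zero, zero_mul]
      intro k hk
      apply hf
      have h2 : ⌊t⌋₊ ≤ N := by
        have := Nat.floor_le_floor ht.2
        simpa using this
      exact (Finset.mem_Icc.1 hk).2.trans h2
  rw [h1]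
  have h2 : ∫ t in Set.Ioi (N:ℝ), M * t ^ (-(s.re + 1)) = M * ((N:ℝ) ^ (-s.re) / s.re) := by
    rw [MeasureTheory.integral_const_mul, integral_Ioi_rpow_of_lt (by linarith) hN0]
    congr 1
    have : -(s.re + 1) + 1 = - s.re := by ring
    rw [this, neg_div_neg_eq]
  rw [← h2]
  refine MeasureTheory.norm_integral_le_of_norm_le ?_ ?_
  · exact (integrableOn_Ioi_rpow_of_lt (by linarith) hN0).const_mul M
  · filter_upwards [MeasureTheory.ae_restrict_mem measurableSet_Ioi] with t ht
    have ht0 : 0 < t := hN0.trans ht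
    rw [norm_mul, Complex.norm_cpow_eq_rpow_re_of_pos ht0]
    simp only [Complex.neg_re, Complex.add_re, Complex.one_re]
    gcongr
    exact hM _

/-- tail coefficients -/
noncomputable def tl {q : ℕ} (χ : DirichletCharacter ℂ q) (N : ℕ) (n : ℕ) : ℂ :=
  if n ≤ N then 0 else χ (n : ZMod q)

lemma norm_sum_tl_le {q : ℕ} [NeZero q] (χ : DirichletCharacter ℂ q) (hχ : χ ≠ 1) (N n : ℕ) :
    ‖∑ i ∈ Icc 1 n, tl χ N i‖ ≤ 4 * q := by
  have h : ∑ i ∈ Icc 1 n, tl χ N i = ∑ i ∈ Icc 1 n, χ (i : ZMod q)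
      - ∑ i ∈ Icc 1 (min n N), χ (i : ZMod q) := by
    have : ∑ i ∈ Icc 1 (min n N), χ (i : ZMod q) =
        ∑ i ∈ Icc 1 n, if i ≤ N then χ (i : ZMod q) else 0 := by
      rw [← Finset.sum_filter]
      congr 1
      ext i; simp; omega
    rw [this, ← Finset.sum_sub_distrib]
    refine Finset.sum_congr rfl fun i _ => ?_
    unfold tl; split_ifs <;> simp
  rw [h]
  have h1 := norm_sum_Icc_le χ hχ n
  have h2 := norm_sum_Icc_le χ hχ (min n N)
  exact (norm_sub_le _ _).trans (by linarith)

theorem LFunction_eq {q : ℕ} [NeZero q] (χ : DirichletCharacter ℂ q) (hχ : χ ≠ 1) (N : ℕ)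
    {s : ℂ} (hs : 0 < s.re) :
    LFunction χ s = ∑ n ∈ Icc 1 N, χ (n : ZMod q) * (n:ℂ) ^ (-s) + s * sumInt (tl χ N) s := by
  set U : Set ℂ := {s | 0 < s.re} with hU
  have hUo : IsOpen U := isOpen_lt continuous_const Complex.continuous_re
  have hUc : IsPreconnected U := (convex_halfSpace_re_gt 0).isPreconnected
  have hg : DifferentiableOn ℂ (fun s : ℂ => ∑ n ∈ Icc 1 N, χ (n : ZMod q) * (n:ℂ) ^ (-s) + s * sumInt (tl χ N) s) U := by
    intro s hs
    refine DifferentiableAt.differentiableWithinAt ?_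
    refine DifferentiableAt.add ?_ (differentiableAt_id.mul (sumInt_differentiableAt _ (norm_sum_tl_le χ hχ N) hs))
    refine DifferentiableAt.fun_sum fun n hn => ?_
    have : n ≠ 0 := by have := (Finset.mem_Icc.1 hn).1; omega
    refine DifferentiableAt.const_mul ?_ _
    exact (differentiableAt_id.neg).const_cpow (Or.inl (by exact_mod_cast this))
  have hL : DifferentiableOn ℂ (LFunction χ) U := (differentiable_LFunction hχ).differentiableOn
  refine (hL.analyticOnNhd hUo).eqOn_of_preconnected_of_eventuallyEq (hg.analyticOnNhd hUo) hUc
    (z₀ := 2) (by simp [hU]) ?_ hs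
  have : {s : ℂ | 1 < s.re} ∈ nhds (2:ℂ) :=
    (isOpen_lt continuous_const Complex.continuous_re).mem_nhds (by simp)
  filter_upwards [this] with s hs
  replace hs : 1 < s.re := hs
  have hsum : LSeriesSummable (tl χ N) s := by
    refine (LSeriesSummable_of_bounded_of_one_lt_re (m := 1) (fun n _ => ?_) hs)
    unfold tl; split_ifs
    · simp
    · exact χ.norm_le_one _
  rw [LFunction_eq_LSeries χ hs, sumInt, ← LSeries_eq_mul_integral _ (le_refl 0) (by linarith) hsum]
  · have hd : (fun n : ℕ => χ (n : ZMod q)) = (fun n : ℕ => if n ∈ Icc 1 N ∨ n = 0 then χ (n : ZMod q) else 0) + tl χ N := by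
      funext n
      simp only [Pi.add_apply, tl, Finset.mem_Icc]
      by_cases h : n ≤ N
      · have : (1 ≤ n ∧ n ≤ N) ∨ n = 0 := by omega
        rw [if_pos this, if_pos h, add_zero]
      · have : ¬ ((1 ≤ n ∧ n ≤ N) ∨ n = 0) := by omega
        rw [if_neg this, if_neg h, zero_add]
    have hfin : ∀ n ∉ Icc 1 N, LSeries.term (fun n : ℕ => if n ∈ Icc 1 N ∨ n = 0 then χ (n : ZMod q) else 0) s n = 0 := by
      intro n hn
      rw [LSeries.term_def]
      split_ifs with h0 h1
      · rfl
      · exact absurd h1 (by simp [hn, h0])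
      · simp
    have hs1 : LSeriesSummable (fun n : ℕ => if n ∈ Icc 1 N ∨ n = 0 then χ (n : ZMod q) else 0) s :=
      summable_of_ne_finset_zero (s := Icc 1 N) hfin
    rw [show (LSeries (fun n : ℕ => χ (n : ZMod q)) s) = LSeries ((fun n : ℕ => if n ∈ Icc 1 N ∨ n = 0 then χ (n : ZMod q) else 0) + tl χ N) s by rw [← hd], LSeries_add hs1 hsum]
    congr 1
    rw [LSeries, tsum_eq_sum hfin]
    refine Finset.sum_congr rfl fun n hn => ?_
    have : n ≠ 0 := by have := (Finset.mem_Icc.1 hn).1; omega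
    rw [LSeries.term_of_ne_zero this, if_pos (Or.inl hn), Complex.cpow_neg, div_eq_mul_inv]
  · refine Asymptotics.IsBigO.of_bound (4*q) (Filter.Eventually.of_forall fun n => ?_)
    simpa using norm_sum_tl_le χ hχ N n

theorem norm_LFunction_le {q : ℕ} [NeZero q] (χ : DirichletCharacter ℂ q) (hχ : χ ≠ 1) {N : ℕ}
    (hN : 1 ≤ N) {s : ℂ} (hs : 0 < s.re) :
    ‖LFunction χ s‖ ≤ ∑ n ∈ Icc 1 N, (n:ℝ) ^ (-s.re) + ‖s‖ * (4 * q * ((N:ℝ) ^ (-s.re) / s.re)) := by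
  rw [LFunction_eq χ hχ N hs]
  refine (norm_add_le _ _).trans (add_le_add ?_ ?_)
  · refine (norm_sum_le _ _).trans (Finset.sum_le_sum fun n hn => ?_)
    have : 0 < n := (Finset.mem_Icc.1 hn).1
    rw [norm_mul, Complex.norm_natCast_cpow_of_pos this, Complex.neg_re]
    exact mul_le_of_le_one_left (by positivity) (χ.norm_le_one _)
  · rw [norm_mul]
    gcongr
    exact norm_sumInt_le _ (norm_sum_tl_le χ hχ N) hN (fun n hn => by simp [tl, hn]) hs

end SW
end

section
open DirichletCharacter Finset

namespace SW

/-- analytic conductor -/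
noncomputable def Qs (q : ℕ) (s : ℂ) : ℝ := q * (|s.im| + 2)

lemma Qs_ge (q : ℕ) [NeZero q] (s : ℂ) : (2:ℝ) ≤ Qs q s := by
  have h2 : (1:ℝ) ≤ q := by exact_mod_cast NeZero.pos q
  unfold Qs
  nlinarith [abs_nonneg s.im]

lemma q_le_Qs (q : ℕ) [NeZero q] (s : ℂ) : (q:ℝ) ≤ Qs q s := by
  have h2 : (1:ℝ) ≤ q := by exact_mod_cast NeZero.pos q
  unfold Qs
  nlinarith [abs_nonneg s.im]

lemma L_growth_aux (δ : ℝ) (hδ : 0 < δ) (hδ2 : δ ≤ 1/2) : ∃ C : ℝ, 0 < C ∧ ∀ (q : ℕ) [NeZero q]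
    (χ : DirichletCharacter ℂ q), χ ≠ 1 → ∀ s : ℂ, 1 - δ ≤ s.re → s.re ≤ 3 →
      ‖LFunction χ s‖ ≤ C * Qs q s ^ (2*δ) := by
  refine ⟨2 * (1 + 1/δ + 16), by positivity, ?_⟩
  intro q _ χ hχ s hs hs3
  have hq : (1:ℝ) ≤ q := by exact_mod_cast NeZero.pos q
  have hqN : 1 ≤ q := NeZero.pos q
  set N : ℕ := q * (⌈|s.im|⌉₊ + 2) with hN
  have hN1 : 1 ≤ N := by
    have : 1 * 1 ≤ q * (⌈|s.im|⌉₊ + 2) := Nat.mul_le_mul hqN (by omega)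
    simpa using this
  have hN0 : (1:ℝ) ≤ N := by exact_mod_cast hN1
  have hNp : (0:ℝ) < N := by linarith
  have hle : (N:ℝ) ≤ 2 * Qs q s := by
    rw [hN, Qs]; push_cast
    have := (Nat.ceil_lt_add_one (abs_nonneg s.im)).le
    nlinarith [abs_nonneg s.im]
  have hge : (q:ℝ) * (|s.im| + 2) ≤ N := by
    rw [hN]; push_cast
    have := Nat.le_ceil (|s.im|)
    gcongr
  have hspos : 0 < s.re := by linarith
  refine (norm_LFunction_le χ hχ hN1 hspos).trans ?_
  have hNδ : (1:ℝ) ≤ (N:ℝ)^δ := Real.one_le_rpow hN0 hδ.le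
  have h1 : ∑ n ∈ Icc 1 N, (n:ℝ) ^ (-s.re) ≤ (1 + 1/δ) * (N:ℝ)^(2*δ) := by
    calc ∑ n ∈ Icc 1 N, (n:ℝ) ^ (-s.re) ≤ ∑ n ∈ Icc 1 N, (N:ℝ)^δ * (n:ℝ)⁻¹ := by
          refine Finset.sum_le_sum fun n hn => ?_
          obtain ⟨hn1, hn2⟩ := Finset.mem_Icc.1 hn
          have hn1' : (1:ℝ) ≤ n := by exact_mod_cast hn1
          have hn2' : (n:ℝ) ≤ N := by exact_mod_cast hn2
          calc (n:ℝ) ^ (-s.re) ≤ (n:ℝ) ^ (δ + (-1)) := Real.rpow_le_rpow_of_exponent_le hn1' (by linarith)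
            _ = (n:ℝ)^δ * (n:ℝ)⁻¹ := by rw [Real.rpow_add (by linarith), Real.rpow_neg_one]
            _ ≤ _ := by gcongr
      _ = (N:ℝ)^δ * (harmonic N : ℝ) := by
          rw [← Finset.mul_sum, harmonic_eq_sum_Icc]; push_cast; rfl
      _ ≤ (N:ℝ)^δ * (1 + Real.log N) := by gcongr; exact harmonic_le_one_add_log N
      _ ≤ (N:ℝ)^δ * ((N:ℝ)^δ + (N:ℝ)^δ/δ) := by
          gcongr
          exact Real.log_le_rpow_div hNp.le hδ
      _ = (1 + 1/δ) * (N:ℝ)^(2*δ) := by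
          rw [show 2*δ = δ + δ by ring, Real.rpow_add hNp]; ring
  have hs_norm : ‖s‖ ≤ |s.im| + 3 := by
    have := Complex.norm_le_abs_re_add_abs_im s
    rw [abs_of_pos hspos] at this
    linarith
  have h2 : ‖s‖ * (4 * q * ((N:ℝ) ^ (-s.re) / s.re)) ≤ 16 * (N:ℝ)^(2*δ) := by
    have ha : (N:ℝ) ^ (-s.re) ≤ (N:ℝ)^(2*δ) * (N:ℝ)⁻¹ := by
      rw [← Real.rpow_neg_one, ← Real.rpow_add hNp]
      exact Real.rpow_le_rpow_of_exponent_le hN0 (by linarith)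
    have hb : (N:ℝ) ^ (-s.re) / s.re ≤ 2 * ((N:ℝ)^(2*δ) * (N:ℝ)⁻¹) := by
      rw [div_le_iff₀ hspos]
      have : 0 ≤ (N:ℝ)^(2*δ) * (N:ℝ)⁻¹ := by positivity
      nlinarith
    have hc : (|s.im| + 3) * q ≤ 2 * N := by nlinarith [abs_nonneg s.im]
    calc ‖s‖ * (4 * q * ((N:ℝ) ^ (-s.re) / s.re)) ≤ (|s.im| + 3) * (4 * q * (2 * ((N:ℝ)^(2*δ) * (N:ℝ)⁻¹))) := by gcongr
      _ = ((|s.im| + 3) * q) * (8 * ((N:ℝ)^(2*δ) * (N:ℝ)⁻¹)) := by ring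
      _ ≤ (2 * N) * (8 * ((N:ℝ)^(2*δ) * (N:ℝ)⁻¹)) := by gcongr
      _ = 16 * (N:ℝ)^(2*δ) := by field_simp; ring
  have h3 : (N:ℝ)^(2*δ) ≤ 2 * Qs q s ^ (2*δ) := by
    have hQ := Qs_ge q s
    calc (N:ℝ)^(2*δ) ≤ (2 * Qs q s)^(2*δ) := by gcongr
      _ = 2^(2*δ) * Qs q s ^ (2*δ) := Real.mul_rpow (by norm_num) (by linarith)
      _ ≤ 2 ^ (1:ℝ) * Qs q s ^ (2*δ) := by
        gcongr
        · norm_num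
        · linarith
      _ = _ := by norm_num
  calc _ ≤ (1 + 1/δ) * (N:ℝ)^(2*δ) + 16 * (N:ℝ)^(2*δ) := add_le_add h1 h2
    _ = (1 + 1/δ + 16) * (N:ℝ)^(2*δ) := by ring
    _ ≤ (1 + 1/δ + 16) * (2 * Qs q s ^ (2*δ)) := by gcongr
    _ = _ := by ring

theorem L_deriv_growth (j : ℕ) (δ : ℝ) (hδ : 0 < δ) : ∃ C : ℝ, 0 < C ∧ ∀ (q : ℕ) [NeZero q]
    (χ : DirichletCharacter ℂ q), χ ≠ 1 → ∀ s : ℂ, 1 ≤ s.re → s.re ≤ 2 →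
      ‖iteratedDeriv j (LFunction χ) s‖ ≤ C * Qs q s ^ δ := by
  set η := min (δ/2) (1/2) with hη
  have hη0 : 0 < η := by rw [hη]; positivity
  have hη1 : η ≤ δ/2 := min_le_left _ _
  have hη2 : η ≤ 1/2 := min_le_right _ _
  obtain ⟨C, hC, h⟩ := L_growth_aux η hη0 hη2
  refine ⟨j.factorial * (C * 2) / η^j, by positivity, ?_⟩
  intro q _ χ hχ s hs1 hs2
  have hQ := Qs_ge q s
  have := Complex.norm_iteratedDeriv_le_of_forall_mem_sphere_norm_le (c := s) (R := η)
    (f := LFunction χ) (C := C * (2 * Qs q s ^ δ)) j hη0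
    (differentiable_LFunction hχ).diffContOnCl ?_
  · refine this.trans (le_of_eq ?_); ring
  · intro z hz
    rw [mem_sphere_iff_norm] at hz
    have hre : |z.re - s.re| ≤ η := by
      rw [← hz, ← Complex.sub_re]; exact Complex.abs_re_le_norm _
    have him : |z.im - s.im| ≤ η := by
      rw [← hz, ← Complex.sub_im]; exact Complex.abs_im_le_norm _
    rw [abs_le] at hre
    refine (h q χ hχ z (by linarith) (by linarith)).trans ?_
    gcongr
    have hQz : Qs q z ≤ 2 * Qs q s := by
      unfold Qs
      have : |z.im| ≤ |s.im| + 1/2 := by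
        have := abs_sub_abs_le_abs_sub z.im s.im
        linarith
      have hq : (0:ℝ) ≤ q := by positivity
      nlinarith [abs_nonneg s.im]
    have hQz2 := Qs_ge q z
    calc Qs q z ^ (2*η) ≤ (2 * Qs q s)^(2*η) := by gcongr
      _ = 2^(2*η) * Qs q s ^ (2*η) := Real.mul_rpow (by norm_num) (by linarith)
      _ ≤ 2^(1:ℝ) * Qs q s ^ δ := by
        gcongr
        · norm_num
        · linarith
        · linarith
        · linarith
      _ = _ := by norm_num

lemma L_crude {q : ℕ} [NeZero q] (χ : DirichletCharacter ℂ q) (hχ : χ ≠ 1) {s : ℂ} (hs : 2/3 ≤ s.re)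
    (hs4 : ‖s‖ ≤ 4) : ‖LFunction χ s‖ ≤ 25 * q := by
  have hq : (1:ℝ) ≤ q := by exact_mod_cast NeZero.pos q
  refine (norm_LFunction_le χ hχ (le_refl 1) (by linarith)).trans ?_
  simp only [Icc_self, sum_singleton, Nat.cast_one, Real.one_rpow]
  have : 1 / s.re ≤ 3/2 := by rw [div_le_iff₀ (by linarith)]; linarith
  have h0 : 0 ≤ 1/s.re := by apply div_nonneg <;> linarith
  calc 1 + ‖s‖ * (4 * q * (1/s.re)) ≤ 1 + 4 * (4 * q * (3/2)) := by gcongr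
    _ ≤ _ := by linarith

end SW
end

section
open DirichletCharacter Finset

namespace SW

noncomputable def Zf : ℂ → ℂ := LFunctionTrivChar₁ 1

lemma Zf_diff : Differentiable ℂ Zf := differentiable_LFunctionTrivChar₁ 1

lemma Zf_one : Zf 1 = 1 := by simp [Zf, LFunctionTrivChar₁]

lemma Zf_ne {s : ℂ} (hs : s ≠ 1) : Zf s = (s - 1) * riemannZeta s := by
  have : LFunctionTrivChar 1 s = riemannZeta s := by
    rw [LFunctionTrivChar, LFunction_modOne_eq]
  simp [Zf, LFunctionTrivChar₁, Function.update_of_ne hs, this]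

noncomputable def Ef (P : ℂ → ℂ) : ℂ → ℂ := dslope (fun s => Zf s * P s) 1

lemma Ef_diff {P : ℂ → ℂ} (hP : Differentiable ℂ P) : Differentiable ℂ (Ef P) := by
  have h : DifferentiableOn ℂ (fun s => Zf s * P s) Set.univ := (Zf_diff.mul hP).differentiableOn
  exact differentiableOn_univ.1 ((Complex.differentiableOn_dslope (Filter.univ_mem)).2 h)

lemma Ef_eq (P : ℂ → ℂ) {s : ℂ} (hs : s ≠ 1) :
    Ef P s = riemannZeta s * P s - P 1 * (s - 1)⁻¹ := by
  rw [Ef, dslope_of_ne _ hs, slope_def_field, Zf_one, Zf_ne hs]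
  have : s - 1 ≠ 0 := sub_ne_zero.2 hs
  field_simp

lemma zeta_sphere : ∃ K0 : ℝ, 0 < K0 ∧ ∀ s ∈ Metric.sphere (2:ℂ) (4/3), ‖riemannZeta s‖ ≤ K0 := by
  have hc : IsCompact (Metric.sphere (2:ℂ) (4/3)) := isCompact_sphere _ _
  have hcont : ContinuousOn riemannZeta (Metric.sphere (2:ℂ) (4/3)) := by
    intro s hs
    have : s ≠ 1 := by
      rintro rfl
      rw [mem_sphere_iff_norm] at hs
      norm_num at hs
    exact (differentiableAt_riemannZeta this).continuousAt.continuousWithinAt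
  obtain ⟨C, hC⟩ := hc.exists_bound_of_continuousOn hcont
  exact ⟨max C 1, by positivity, fun s hs => (hC s hs).trans (le_max_left _ _)⟩

lemma iter_F (P : ℂ → ℂ) (hP : Differentiable ℂ P) (m : ℕ) :
    iteratedDeriv m (fun s => riemannZeta s * P s) 2 =
      iteratedDeriv m (Ef P) 2 + P 1 * ((-1)^m * m.factorial) := by
  have h1 : (fun s => riemannZeta s * P s) =ᶠ[nhds 2] (Ef P + fun s => P 1 * (s - 1)⁻¹) := by
    have : {s : ℂ | s ≠ 1} ∈ nhds (2:ℂ) := isOpen_ne.mem_nhds (by norm_num)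
    filter_upwards [this] with s hs
    replace hs : s ≠ 1 := hs
    rw [Pi.add_apply, Ef_eq P hs]; ring
  have hc : ContDiffAt ℂ m (fun s : ℂ => P 1 * (s - 1)⁻¹) 2 := by
    refine contDiffAt_const.mul (ContDiffAt.inv (contDiffAt_id.sub contDiffAt_const) (by norm_num))
  rw [h1.iteratedDeriv_eq, iteratedDeriv_add ((Ef_diff hP).contDiff.contDiffAt) hc,
    iteratedDeriv_const_mul_field]
  congr 2
  have := congrFun (iteratedDeriv_comp_sub_const m (fun z : ℂ => z⁻¹) 1) 2
  rw [this, iteratedDeriv_eq_iterate]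
  have h2 := iter_deriv_inv m (2 - 1 : ℂ)
  have h3 : (fun z : ℂ => z⁻¹) = Inv.inv := rfl
  rw [h3, h2]
  norm_num

lemma est_core {K0 : ℝ} (hK0 : ∀ s ∈ Metric.sphere (2:ℂ) (4/3), ‖riemannZeta s‖ ≤ K0)
    (P : ℂ → ℂ) (hP : Differentiable ℂ P) {A b0 β : ℝ} (hA : 0 ≤ A)
    (hPA : ∀ s, ‖s - 2‖ ≤ 4/3 → ‖P s‖ ≤ A)
    (hF : ∀ m, 0 ≤ ((-1)^m * iteratedDeriv m (fun s => riemannZeta s * P s) 2).re)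
    (hF2 : b0 ≤ (riemannZeta 2 * P 2).re) (hβ : 9/10 ≤ β) (hβ1 : β < 1)
    (hFβ : (riemannZeta β * P β).re ≤ 0) (M : ℕ) (hM : 1 ≤ M) :
    b0 ≤ (P 1).re * (2-β)^M / (1-β) + (K0 + 3) * A * (33/40)^M * 6 := by
  have hK00 : 0 ≤ K0 := (norm_nonneg _).trans (hK0 (2 + 4/3) (by simp))
  set l := (P 1).re with hl
  set A' := (K0 + 3) * A with hA'
  have hA'0 : 0 ≤ A' := by positivity
  have hEb : ∀ s ∈ Metric.sphere (2:ℂ) (4/3), ‖Ef P s‖ ≤ A' := by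
    intro s hs
    have hs' := mem_sphere_iff_norm.1 hs
    have hd : 1/3 ≤ ‖s - 1‖ := by
      have : s - 2 = (s - 1) - 1 := by ring
      have h2 := norm_sub_le (s-1) 1
      rw [← this, hs'] at h2
      norm_num at h2
      linarith
    have hs1 : s ≠ 1 := by
      rintro rfl; norm_num at hd
    rw [Ef_eq P hs1]
    refine (norm_sub_le _ _).trans ?_
    rw [norm_mul, norm_mul, norm_inv]
    have h1 : ‖s - 1‖⁻¹ ≤ 3 := by
      rw [inv_le_comm₀ (by linarith) (by norm_num)]; linarith
    have h2 := hPA s hs'.le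
    have h3 := hPA 1 (by norm_num)
    calc _ ≤ K0 * A + A * 3 := by gcongr; exact hK0 s hs
      _ = _ := by rw [hA']; ring
  have hcoef : ∀ m, ‖iteratedDeriv m (Ef P) 2‖ ≤ m.factorial * A' / (4/3)^m := fun m =>
    Complex.norm_iteratedDeriv_le_of_forall_mem_sphere_norm_le m (by norm_num)
      (Ef_diff hP).diffContOnCl hEb
  have hT := Complex.hasSum_taylorSeries_of_entire (Ef_diff hP) 2 β
  set t : ℕ → ℝ := fun m => ((m.factorial : ℂ)⁻¹ • ((β:ℂ) - 2)^m • iteratedDeriv m (Ef P) 2).re with ht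
  have hTr : HasSum t (Ef P β).re := Complex.hasSum_re hT
  have hx0 : 0 ≤ 2 - β := by linarith
  have hx1 : 2 - β ≤ 11/10 := by linarith
  have htform : ∀ m, t m = (2-β)^m * ((m.factorial:ℝ)⁻¹ * ((-1)^m * iteratedDeriv m (Ef P) 2).re) := by
    intro m
    rw [ht]
    have : ((m.factorial : ℂ)⁻¹ • ((β:ℂ) - 2)^m • iteratedDeriv m (Ef P) 2) =
      (((2-β)^m * (m.factorial:ℝ)⁻¹ : ℝ) : ℂ) * ((-1)^m * iteratedDeriv m (Ef P) 2) := by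
      simp only [smul_eq_mul]
      rw [show (β:ℂ) - 2 = (-1) * ((2 - β : ℝ) : ℂ) by push_cast; ring, mul_pow]
      push_cast; ring
    simp only [this, Complex.re_ofReal_mul]
    ring
  have htE : ∀ m, ((-1)^m * iteratedDeriv m (Ef P) 2).re =
      ((-1)^m * iteratedDeriv m (fun s => riemannZeta s * P s) 2).re - m.factorial * l := by
    intro m
    rw [iter_F P hP m, mul_add, Complex.add_re]
    have : (-1)^m * (P 1 * ((-1)^m * (m.factorial:ℂ))) = ((m.factorial : ℝ) : ℂ) * P 1 := by
      have h : ((-1:ℂ)^m) * (-1)^m = 1 := by rw [← mul_pow]; simp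
      calc _ = (((-1:ℂ)^m) * (-1)^m) * ((m.factorial : ℂ) * P 1) := by ring
        _ = _ := by rw [h]; simp
    rw [this, Complex.re_ofReal_mul]; ring
  have htlow : ∀ m, (if m = 0 then b0 else 0) - l * (2-β)^m ≤ t m := by
    intro m
    have hm0 : (0:ℝ) < m.factorial := by positivity
    rw [htform, htE]
    have : (m.factorial:ℝ)⁻¹ * (((-1)^m * iteratedDeriv m (fun s => riemannZeta s * P s) 2).re - m.factorial * l) = (m.factorial:ℝ)⁻¹ * ((-1)^m * iteratedDeriv m (fun s => riemannZeta s * P s) 2).re - l := by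
      field_simp
    rw [this, mul_sub]
    have h2 : (if m = 0 then b0 else 0) ≤ (2-β)^m * ((m.factorial:ℝ)⁻¹ * ((-1)^m * iteratedDeriv m (fun s => riemannZeta s * P s) 2).re) := by
      split_ifs with h
      · subst h; simpa using hF2
      · exact mul_nonneg (by positivity) (mul_nonneg (by positivity) (hF m))
    linarith
  have htabs : ∀ m, |t m| ≤ A' * (33/40)^m := by
    intro m
    have hm0 : (0:ℝ) < m.factorial := by positivity
    rw [htform, abs_mul, abs_mul, abs_of_nonneg (pow_nonneg hx0 m), abs_of_pos (inv_pos.2 hm0)]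
    have h1 : |((-1)^m * iteratedDeriv m (Ef P) 2).re| ≤ m.factorial * A' / (4/3)^m := by
      refine (Complex.abs_re_le_norm _).trans ?_
      rw [norm_mul, norm_pow, norm_neg, norm_one, one_pow, one_mul]
      exact hcoef m
    calc _ ≤ (11/10)^m * ((m.factorial:ℝ)⁻¹ * (m.factorial * A' / (4/3)^m)) := by gcongr
      _ = A' * ((11/10)/(4/3))^m := by
        have e : ((11/10:ℝ)/(4/3))^m = (11/10)^m/(4/3)^m := div_pow _ _ _
        rw [e]; generalize ((11:ℝ)/10)^m = u; have : (0:ℝ) < (4/3)^m := by positivity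
        generalize ((4:ℝ)/3)^m = v at *; field_simp
      _ = _ := by norm_num
  have hgs : Summable (fun m : ℕ => A' * (33/40:ℝ)^m) :=
    (summable_geometric_of_lt_one (by norm_num) (by norm_num)).mul_left _
  have hsplit := hTr.summable.sum_add_tsum_nat_add M
  rw [hTr.tsum_eq] at hsplit
  have htail : -(A' * (33/40)^M * 6) ≤ ∑' m, t (m + M) := by
    have h1 : ∑' m : ℕ, -(A' * (33/40:ℝ)^(m+M)) ≤ ∑' m, t (m + M) := by
      refine Summable.tsum_le_tsum (fun m => (abs_le.1 (htabs (m+M))).1) ?_ ?_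
      · exact ((summable_nat_add_iff M).2 hgs).neg
      · exact (summable_nat_add_iff M).2 hTr.summable
    have h2 : ∑' m : ℕ, -(A' * (33/40:ℝ)^(m+M)) = -(A' * (33/40)^M * (1 - 33/40)⁻¹) := by
      rw [tsum_neg, ← tsum_geometric_of_lt_one (r := 33/40) (by norm_num) (by norm_num), ← tsum_mul_left]
      congr 1
      refine tsum_congr fun m => ?_
      rw [pow_add]; ring
    rw [h2] at h1
    refine le_trans ?_ h1
    rw [neg_le_neg_iff]
    gcongr
    norm_num
  have hhead : b0 - l * (((2-β)^M - 1)/(1-β)) ≤ ∑ m ∈ range M, t m := by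
    refine le_trans (le_of_eq ?_) (Finset.sum_le_sum fun m _ => htlow m)
    rw [Finset.sum_sub_distrib, ← Finset.mul_sum, geom_sum_eq (by linarith)]
    congr 1
    · simp; omega
    · congr 2; ring
  have hEβ : (Ef P β).re = (riemannZeta β * P β).re + l / (1-β) := by
    have hne : (β:ℂ) ≠ 1 := by
      intro h; rw [Complex.ofReal_eq_one] at h; linarith
    rw [Ef_eq P hne, Complex.sub_re]
    have : (P 1 * ((β:ℂ) - 1)⁻¹).re = - (l / (1-β)) := by
      rw [show ((β:ℂ) - 1)⁻¹ = (((β - 1)⁻¹ : ℝ) : ℂ) by push_cast; rfl, mul_comm, Complex.re_ofReal_mul]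
      rw [← hl, show β - 1 = -(1-β) by ring, inv_neg]; field_simp
    rw [this]; ring
  have hb : 0 < 1 - β := by linarith
  have : l * (((2-β)^M - 1)/(1-β)) + l/(1-β) = l * (2-β)^M/(1-β) := by field_simp; ring
  have e2 : (K0 + 3) * A * (33/40)^M * 6 = A' * (33/40)^M * 6 := rfl
  rw [e2]
  linarith

end SW
end

section
open DirichletCharacter Finset

namespace SW

lemma est_fin {b0 : ℝ} (hb0 : 0 < b0) : ∃ c C : ℝ, 0 < c ∧ 0 < C ∧ ∀ (P : ℂ → ℂ) (A β : ℝ), 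
    Differentiable ℂ P → 1 ≤ A → 
    (∀ s, ‖s - 2‖ ≤ 4/3 → ‖P s‖ ≤ A) →
    (∀ m, 0 ≤ ((-1)^m * iteratedDeriv m (fun s => riemannZeta s * P s) 2).re) →
    b0 ≤ (riemannZeta 2 * P 2).re → 9/10 ≤ β → β < 1 →
    (riemannZeta β * P β).re ≤ 0 →
    c * (1-β) * A ^ (-(C*(1-β))) ≤ (P 1).re := by
  obtain ⟨K0, hK0, hK⟩ := zeta_sphere
  set r : ℝ := Real.log (40/33) with hr
  have hr0 : 0 < r := Real.log_pos (by norm_num)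
  set D : ℝ := (K0 + 3) * 6 * 2 / b0 with hD
  have hD0 : 0 < D := by positivity
  set C1 : ℝ := |Real.log D| / r + 2 with hC1
  have hC1p : 0 < C1 := by positivity
  refine ⟨b0/2 * Real.exp (-C1), 1/r, by positivity, by positivity, ?_⟩
  intro P A β hP hA hPA hF hF2 hβ hβ1 hFβ
  have hA0 : 0 < A := by linarith
  have hlA : 0 ≤ Real.log A := Real.log_nonneg hA
  set M : ℕ := ⌈(|Real.log D| + Real.log A)/r⌉₊ + 1 with hM
  have hM1 : (|Real.log D| + Real.log A)/r ≤ M := by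
    rw [hM]; push_cast; linarith [Nat.le_ceil ((|Real.log D| + Real.log A)/r)]
  have hM2 : (M:ℝ) ≤ C1 + Real.log A / r := by
    have := Nat.ceil_lt_add_one (a := (|Real.log D| + Real.log A)/r) (by positivity)
    rw [hM, hC1]; push_cast
    rw [add_div] at this ⊢
    linarith
  have h := est_core hK P hP hA0.le hPA hF hF2 hβ hβ1 hFβ M (by omega)
  have h33 : (33/40:ℝ)^M = Real.exp (-(M * r)) := by
    rw [hr, ← mul_neg, ← Real.log_inv, ← Real.rpow_natCast, Real.rpow_def_of_pos (by norm_num), mul_comm]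
    norm_num
  have h2 : (K0 + 3) * A * (33/40)^M * 6 ≤ b0/2 := by
    have h3 : (33/40:ℝ)^M ≤ (D*A)⁻¹ := by
      rw [h33, ← Real.exp_log (inv_pos.2 (mul_pos hD0 hA0)), Real.log_inv, Real.log_mul hD0.ne' hA0.ne']
      apply Real.exp_le_exp.2
      rw [div_le_iff₀ hr0] at hM1
      linarith [le_abs_self (Real.log D)]
    calc _ ≤ (K0 + 3) * A * (D*A)⁻¹ * 6 := by gcongr
      _ = b0/2 := by rw [hD]; field_simp
  have hb : 0 < 1 - β := by linarith
  have hpw : (2-β)^M ≤ Real.exp (C1) * A^(1/r*(1-β)) := by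
    have e1 : 2 - β ≤ Real.exp (1-β) := by linarith [Real.add_one_le_exp (1-β)]
    calc (2-β)^M ≤ (Real.exp (1-β))^M := by gcongr; linarith
      _ = Real.exp (M * (1-β)) := by rw [← Real.exp_nat_mul]
      _ ≤ Real.exp (C1 + Real.log A * (1/r*(1-β))) := by
        apply Real.exp_le_exp.2
        calc (M:ℝ) * (1-β) ≤ (C1 + Real.log A / r) * (1-β) := by gcongr
          _ = C1 * (1-β) + Real.log A * (1/r*(1-β)) := by ring
          _ ≤ _ := by nlinarith
      _ = _ := by rw [Real.exp_add, Real.rpow_def_of_pos hA0]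
  set W := Real.exp (C1) * A^(1/r*(1-β)) with hW
  have hW0 : 0 < W := by positivity
  have hmain : b0/2 ≤ (P 1).re * (2-β)^M/(1-β) := by linarith
  rw [le_div_iff₀ hb] at hmain
  have hp2 : 0 < (2-β)^M := by apply pow_pos; linarith
  have hP1 : 0 < (P 1).re := by
    by_contra hcon
    push Not at hcon
    nlinarith [mul_pos (half_pos hb0) hb]
  have : b0/2*(1-β) ≤ (P 1).re * W := hmain.trans (by gcongr)
  have e3 : b0/2 * Real.exp (-C1) * (1-β) * A^(-(1/r*(1-β))) = b0/2*(1-β) / W := by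
    rw [hW, Real.exp_neg, Real.rpow_neg hA0.le]; field_simp
  rw [e3, div_le_iff₀ hW0]; exact this

open scoped ComplexOrder in
lemma alt_nonneg (F : ℂ → ℂ) (a : ℕ → ℂ) (ha : 0 ≤ a) (hs : ∀ s : ℂ, 1 < s.re → LSeriesSummable a s)
    (hFd : DifferentiableOn ℂ F {s | 1 < s.re})
    (hF' : ∀ s : ℂ, 1 < s.re → deriv F s = - LSeries a s * F s) (hF2 : 0 ≤ F 2) (m : ℕ) :
    0 ≤ (-1)^m * iteratedDeriv m F 2 := by
  have hab : LSeries.abscissaOfAbsConv a ≤ (1:ℝ) := 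
    LSeries.abscissaOfAbsConv_le_of_forall_lt_LSeriesSummable fun y hy => hs y (by simpa using hy)
  have hab2 : LSeries.abscissaOfAbsConv a < ((2:ℝ):EReal) := hab.trans_lt (by norm_cast)
  have hopen : IsOpen {s : ℂ | 1 < s.re} := isOpen_lt continuous_const Complex.continuous_re
  have h2 : (2:ℂ) ∈ {s : ℂ | 1 < s.re} := by show 1 < (2:ℂ).re; norm_num
  have hLd : DifferentiableOn ℂ (LSeries a) {s | 1 < s.re} := 
    (LSeries_differentiableOn a).mono fun s hs => hab.trans_lt (by exact_mod_cast hs)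
  have hLc : ∀ n : ℕ, ContDiffAt ℂ n (LSeries a) 2 := fun n => 
    ((hLd.analyticOnNhd hopen) 2 h2).contDiffAt
  have hFc : ∀ n : ℕ, ContDiffAt ℂ n F 2 := fun n => 
    ((hFd.analyticOnNhd hopen) 2 h2).contDiffAt
  induction m using Nat.strong_induction_on with
  | _ m ih =>
    cases m with
    | zero => simpa using hF2
    | succ m =>
      have e : deriv F =ᶠ[nhds 2] fun s => -(LSeries a s * F s) := by
        filter_upwards [hopen.mem_nhds h2] with s hs
        rw [hF' s hs]; ring
      rw [iteratedDeriv_succ', e.iteratedDeriv_eq, iteratedDeriv_fun_neg, iteratedDeriv_fun_mul (hLc m) (hFc m), pow_succ]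
      have : (-1:ℂ)^m * -1 * -(∑ i ∈ range (m+1), (m.choose i : ℂ) * iteratedDeriv i (LSeries a) 2 * iteratedDeriv (m-i) F 2)
        = ∑ i ∈ range (m+1), (m.choose i : ℂ) * ((-1)^i * iteratedDeriv i (LSeries a) 2) * ((-1)^(m-i) * iteratedDeriv (m-i) F 2) := by
        rw [mul_neg, mul_neg_one, neg_mul, neg_neg, Finset.mul_sum]
        refine Finset.sum_congr rfl fun i hi => ?_
        have hi' : i + (m - i) = m := by have := Finset.mem_range.1 hi; omega
        have : (-1:ℂ)^m = (-1)^i * (-1)^(m-i) := by rw [← pow_add, hi']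
        rw [this]; ring
      rw [this]
      refine Finset.sum_nonneg fun i hi => ?_
      have h1 := LSeries.iteratedDeriv_alternating ha hab2 i
      have h2 := ih (m-i) (by omega)
      have h3 : (0:ℂ) ≤ (m.choose i : ℂ) := by exact_mod_cast Nat.zero_le _
      push_cast at h1
      exact mul_nonneg (mul_nonneg h3 h1) h2

lemma conj_quad {q : ℕ} [NeZero q] (χ : DirichletCharacter ℂ q) (h2 : χ ^ 2 = 1) (a : ZMod q) :
    ((χ a).re : ℂ) = χ a ∧ (χ a = 0 ∨ χ a = 1 ∨ χ a = -1) := by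
  have : χ a = 0 ∨ χ a = 1 ∨ χ a = -1 := by
    by_cases ha : IsUnit a
    · right
      have := congrArg (fun ψ => ψ a) h2
      simp only [MulChar.pow_apply' χ (two_ne_zero), MulChar.one_apply ha] at this
      exact by
        have h : (χ a - 1) * (χ a + 1) = 0 := by linear_combination this
        rcases mul_eq_zero.1 h with h | h
        · left; linear_combination h
        · right; linear_combination h
    · left; exact χ.map_nonunit ha
  refine ⟨?_, this⟩
  rcases this with h | h | h <;> simp [h]

lemma L_real {q : ℕ} [NeZero q] (χ : DirichletCharacter ℂ q) (hχ : χ ≠ 1) (h2 : χ ^ 2 = 1) {β : ℝ} (hβ : 0 < β) :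
    (((LFunction χ β).re : ℝ) : ℂ) = LFunction χ β := by
  rw [← Complex.conj_eq_iff_re, LFunction_eq χ hχ 0 (by simpa using hβ)]
  have e0 : (Icc 1 0 : Finset ℕ) = ∅ := by decide
  rw [e0, Finset.sum_empty, zero_add, map_mul, Complex.conj_ofReal]
  congr 1
  rw [sumInt, ← integral_conj]
  refine MeasureTheory.setIntegral_congr_fun measurableSet_Ioi fun t ht => ?_
  replace ht : 1 < t := ht
  simp only [map_mul, map_sum]
  congr 1
  · refine Finset.sum_congr rfl fun k hk => ?_
    rw [tl]
    split_ifs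
    · simp
    · exact Complex.conj_eq_iff_re.2 (conj_quad χ h2 _).1
  · have : ((t:ℂ)^(-((β:ℂ)+1))) = ((t^(-(β+1)) : ℝ) : ℂ) := by
      rw [Complex.ofReal_cpow (by linarith)]; push_cast; rfl
    rw [this, Complex.conj_ofReal]

lemma L_two {q : ℕ} [NeZero q] (χ : DirichletCharacter ℂ q) : 34/100 ≤ (LFunction χ 2).re := by
  rw [LFunction_eq_LSeries χ (by norm_num)]
  have hs := LSeriesSummable_of_one_lt_re χ (s := 2) (by norm_num)
  have hz := hasSum_zeta_two
  have h0 : (LSeries (fun n => χ n) 2) = ∑ i ∈ range 2, LSeries.term (fun n => χ n) 2 i + ∑' n, LSeries.term (fun n => χ n) 2 (n+2) :=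
    (hs.sum_add_tsum_nat_add 2).symm
  have hb : ∀ n:ℕ, ‖LSeries.term (fun n => χ n) 2 (n+2)‖ ≤ 1/((n+2:ℕ):ℝ)^2 := by
    intro n
    rw [LSeries.term_of_ne_zero (by omega), norm_div]
    have : ‖((n+2:ℕ):ℂ)^(2:ℂ)‖ = ((n+2:ℕ):ℝ)^2 := by
      rw [Complex.cpow_ofNat, norm_pow, Complex.norm_natCast]
    rw [this]
    gcongr
    exact χ.norm_le_one _
  have hz2 : HasSum (fun n:ℕ => 1/((n+2:ℕ):ℝ)^2) (Real.pi^2/6 - 1) := by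
    rw [hasSum_nat_add_iff (f := fun n : ℕ => 1/(n:ℝ)^2) 2]
    have e : Real.pi^2/6 - 1 + ∑ i ∈ range 2, 1/(i:ℝ)^2 = Real.pi^2/6 := by
      norm_num [Finset.sum_range_succ]
    rw [e]; exact hz
  have hn : ‖∑' n, LSeries.term (fun n => χ n) 2 (n+2)‖ ≤ Real.pi^2/6 - 1 :=
    tsum_of_norm_bounded hz2 hb
  have e : ∑ i ∈ range 2, LSeries.term (fun n => χ n) 2 i = 1 := by
    simp [Finset.sum_range_succ, LSeries.term]
  rw [h0, e, Complex.add_re, Complex.one_re]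
  have := (abs_le.1 ((Complex.abs_re_le_norm _).trans hn)).1
  have hpi := Real.pi_lt_d2
  have hpi0 := Real.pi_pos
  nlinarith
end SW
end

section
open DirichletCharacter Finset

namespace SW
open ArithmeticFunction (vonMangoldt)

def LD (F : ℂ → ℂ) (a : ℕ → ℂ) : Prop :=
  ∀ s : ℂ, 1 < s.re → HasDerivAt F (- LSeries a s * F s) s ∧ LSeriesSummable a s

lemma LD.mul {F G : ℂ → ℂ} {a b : ℕ → ℂ} (h1 : LD F a) (h2 : LD G b) : LD (fun s => F s * G s) (a + b) := by
  intro s hs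
  obtain ⟨h1, h1'⟩ := h1 s hs
  obtain ⟨h2, h2'⟩ := h2 s hs
  refine ⟨?_, h1'.add h2'⟩
  rw [LSeries_add h1' h2']
  exact (h1.mul h2).congr_deriv (by ring)

lemma LD_zeta : LD riemannZeta (fun n => (vonMangoldt n : ℂ)) := by
  intro s hs
  refine ⟨?_, ArithmeticFunction.LSeriesSummable_vonMangoldt hs⟩
  have hne : s ≠ 1 := by rintro rfl; simp at hs
  have hd := (differentiableAt_riemannZeta hne).hasDerivAt
  rw [ArithmeticFunction.LSeries_vonMangoldt_eq_deriv_riemannZeta_div hs]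
  have := riemannZeta_ne_zero_of_one_lt_re hs
  exact hd.congr_deriv (by field_simp)

lemma LD_L {q : ℕ} [NeZero q] (χ : DirichletCharacter ℂ q) (hχ : χ ≠ 1) :
    LD (LFunction χ) ((fun n : ℕ => χ n) * fun n => (vonMangoldt n : ℂ)) := by
  intro s hs
  refine ⟨?_, LSeriesSummable_twist_vonMangoldt χ hs⟩
  have hd := (differentiable_LFunction hχ s).hasDerivAt
  rw [LSeries_twist_vonMangoldt_eq χ hs, ← LFunction_eq_LSeries χ hs, ← deriv_LFunction_eq_deriv_LSeries χ hs]
  have := LFunction_ne_zero_of_one_le_re χ (Or.inl hχ) hs.le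
  exact hd.congr_deriv (by field_simp)

open scoped ComplexOrder in
lemma LD.alt {P : ℂ → ℂ} {a : ℕ → ℂ} (h : LD (fun s => riemannZeta s * P s) a) (ha : ∀ n, 0 ≤ a n)
    (hF2 : 0 ≤ riemannZeta 2 * P 2) (m : ℕ) : 0 ≤ ((-1)^m * iteratedDeriv m (fun s => riemannZeta s * P s) 2).re := by
  have := alt_nonneg _ a ha (fun s hs => (h s hs).2)
    (fun s hs => (h s hs).1.differentiableAt.differentiableWithinAt) (fun s hs => (h s hs).1.deriv) hF2 m
  exact (Complex.nonneg_iff.1 this).1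

lemma zeta2 : riemannZeta 2 = ((Real.pi^2/6 : ℝ) : ℂ) := by rw [riemannZeta_two]; push_cast; rfl

lemma zeta2_ge : 1 ≤ Real.pi^2/6 := by nlinarith [Real.pi_gt_three]

lemma ball_facts {s : ℂ} (hs : ‖s - 2‖ ≤ 4/3) : 2/3 ≤ s.re ∧ ‖s‖ ≤ 4 := by
  constructor
  · have := (abs_le.1 ((Complex.abs_re_le_norm _).trans hs)).1
    simp at this; linarith
  · have : s = (s - 2) + 2 := by ring
    rw [this]
    refine (norm_add_le _ _).trans ?_
    norm_num; linarith

/-- first kind of Estermann inequality -/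
lemma sieg1 : ∃ c C : ℝ, 0 < c ∧ 0 < C ∧ ∀ (q : ℕ) [NeZero q] (χ : DirichletCharacter ℂ q), χ ≠ 1 → χ^2 = 1 →
    ∀ β : ℝ, 9/10 ≤ β → β < 1 → (riemannZeta β * LFunction χ β).re ≤ 0 →
      c * (1-β) * (25*q) ^ (-(C*(1-β))) ≤ (LFunction χ 1).re := by
  obtain ⟨c, C, hc, hC, h⟩ := est_fin (b0 := 34/100) (by norm_num)
  refine ⟨c, C, hc, hC, fun q _ χ hχ h2 β hβ hβ1 hF => ?_⟩
  have hq : (1:ℝ) ≤ q := by exact_mod_cast NeZero.pos q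
  have hL2 := L_two χ
  have hLr := L_real χ hχ h2 (β := 2) (by norm_num)
  push_cast at hLr
  have hprod : riemannZeta 2 * LFunction χ 2 = ((Real.pi^2/6 * (LFunction χ 2).re : ℝ) : ℂ) := by
    rw [zeta2, Complex.ofReal_mul, hLr]
  have hz := zeta2_ge
  refine h (LFunction χ) (25*q) β (differentiable_LFunction hχ) (by linarith) ?_ ?_ ?_ hβ hβ1 hF
  · intro s hs
    exact L_crude χ hχ (ball_facts hs).1 (ball_facts hs).2
  · refine LD.alt (LD_zeta.mul (LD_L χ hχ)) ?_ ?_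
    · intro n
      have : ((fun n => (vonMangoldt n : ℂ)) + (fun n : ℕ => χ n) * fun n => (vonMangoldt n : ℂ)) n
          = ((vonMangoldt n * (1 + (χ n).re) : ℝ) : ℂ) := by
        simp only [Pi.add_apply, Pi.mul_apply]
        push_cast
        rw [(conj_quad χ h2 n).1]; ring
      rw [this]
      have h3 : 0 ≤ 1 + (χ n).re := by
        rcases (conj_quad χ h2 n).2 with h | h | h <;> simp [h]
      exact Complex.zero_le_real.2 (mul_nonneg ArithmeticFunction.vonMangoldt_nonneg h3)
    · rw [hprod]
      exact Complex.zero_le_real.2 (by positivity)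
  · rw [hprod, Complex.ofReal_re]
    nlinarith

noncomputable def chp {q1 q2 : ℕ} (χ1 : DirichletCharacter ℂ q1) (χ2 : DirichletCharacter ℂ q2) :
    DirichletCharacter ℂ (q1*q2) :=
  changeLevel (Nat.dvd_mul_right q1 q2) χ1 * changeLevel (Nat.dvd_mul_left q2 q1) χ2

lemma chp_apply {q1 q2 : ℕ} [NeZero q1] [NeZero q2] (χ1 : DirichletCharacter ℂ q1) (χ2 : DirichletCharacter ℂ q2) (n : ℕ) :
    chp χ1 χ2 (n : ZMod (q1*q2)) = χ1 n * χ2 n := by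
  rw [chp, MulChar.mul_apply]
  by_cases h : IsUnit (n : ZMod (q1*q2))
  · obtain ⟨u, hu⟩ := h
    rw [← hu, changeLevel_eq_cast_of_dvd, changeLevel_eq_cast_of_dvd, hu, ZMod.cast_natCast (Nat.dvd_mul_right q1 q2), ZMod.cast_natCast (Nat.dvd_mul_left q2 q1)]
  · rw [MulChar.map_nonunit _ h, zero_mul]
    rw [ZMod.isUnit_iff_coprime, Nat.coprime_mul_iff_right, not_and_or] at h
    rcases h with h | h
    · rw [MulChar.map_nonunit χ1 (by rwa [ZMod.isUnit_iff_coprime]), zero_mul]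
    · rw [MulChar.map_nonunit χ2 (by rwa [ZMod.isUnit_iff_coprime]), mul_zero]

lemma chp_sq {q1 q2 : ℕ} (χ1 : DirichletCharacter ℂ q1) (χ2 : DirichletCharacter ℂ q2) (h1 : χ1^2=1) (h2 : χ2^2=1) :
    (chp χ1 χ2)^2 = 1 := by
  rw [chp, mul_pow, ← map_pow, ← map_pow, h1, h2, map_one, map_one, one_mul]

open scoped ComplexOrder in
lemma sieg2 : ∃ c C : ℝ, 0 < c ∧ 0 < C ∧ ∀ (q1 q2 : ℕ) [NeZero q1] [NeZero q2] (χ1 : DirichletCharacter ℂ q1)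
    (χ2 : DirichletCharacter ℂ q2), χ1 ≠ 1 → χ1^2 = 1 → χ2 ≠ 1 → χ2^2 = 1 → chp χ1 χ2 ≠ 1 →
    ∀ β : ℝ, 9/10 ≤ β → β < 1 → LFunction χ1 β = 0 →
      c * (1-β) * ((25*q1)*(25*q2)*(25*(q1*q2))) ^ (-(C*(1-β))) ≤ (LFunction χ1 1 * LFunction χ2 1 * LFunction (chp χ1 χ2) 1).re := by
  obtain ⟨c, C, hc, hC, h⟩ := est_fin (b0 := (34/100)^3) (by norm_num)
  refine ⟨c, C, hc, hC, fun q1 q2 _ _ χ1 χ2 hχ1 h1 hχ2 h2 hχ3 β hβ hβ1 hF => ?_⟩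
  have h3 := chp_sq χ1 χ2 h1 h2
  have hq1 : (1:ℝ) ≤ q1 := by exact_mod_cast NeZero.pos q1
  have hq2 : (1:ℝ) ≤ q2 := by exact_mod_cast NeZero.pos q2
  have hr : ∀ (q:ℕ) [NeZero q] (χ : DirichletCharacter ℂ q), χ ≠ 1 → χ^2=1 → LFunction χ 2 = (((LFunction χ 2).re : ℝ) : ℂ) := by
    intro q _ χ hχ h2
    have hLr := L_real χ hχ h2 (β := 2) (by norm_num)
    push_cast at hLr
    exact hLr.symm
  have g1 := L_two χ1
  have g2 := L_two χ2
  have g3 := L_two (chp χ1 χ2)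
  have hprod : riemannZeta 2 * (LFunction χ1 2 * LFunction χ2 2 * LFunction (chp χ1 χ2) 2) = ((Real.pi^2/6 * ((LFunction χ1 2).re * (LFunction χ2 2).re * (LFunction (chp χ1 χ2) 2).re) : ℝ) : ℂ) := by
    rw [zeta2, hr _ χ1 hχ1 h1, hr _ χ2 hχ2 h2, hr _ _ hχ3 h3]; push_cast; simp
  have hz := zeta2_ge
  have hA := h (fun s => LFunction χ1 s * LFunction χ2 s * LFunction (chp χ1 χ2) s) ((25*q1)*(25*q2)*(25*(q1*q2))) β (((differentiable_LFunction hχ1).mul (differentiable_LFunction hχ2)).mul (differentiable_LFunction hχ3)) ?_ ?_ ?_ ?_ hβ hβ1 ?_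
  · exact hA
  · have a1 : (1:ℝ) ≤ 25*q1 := by linarith
    have a2 : (1:ℝ) ≤ 25*q2 := by linarith
    have a3 : (1:ℝ) ≤ 25*(q1*q2) := by nlinarith
    exact one_le_mul_of_one_le_of_one_le (one_le_mul_of_one_le_of_one_le a1 a2) a3
  · intro s hs
    rw [norm_mul, norm_mul]
    have b3 := L_crude _ hχ3 (ball_facts hs).1 (ball_facts hs).2
    push_cast at b3
    gcongr
    · exact L_crude χ1 hχ1 (ball_facts hs).1 (ball_facts hs).2
    · exact L_crude χ2 hχ2 (ball_facts hs).1 (ball_facts hs).2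
  · refine LD.alt (LD_zeta.mul (((LD_L χ1 hχ1).mul (LD_L χ2 hχ2)).mul (LD_L _ hχ3))) ?_ ?_
    · intro n
      have : ((fun n => (vonMangoldt n : ℂ)) + ((fun n : ℕ => χ1 n) * (fun n => (vonMangoldt n : ℂ)) + (fun n : ℕ => χ2 n) * (fun n => (vonMangoldt n : ℂ)) + (fun n : ℕ => chp χ1 χ2 n) * (fun n => (vonMangoldt n : ℂ)))) n
          = ((vonMangoldt n * ((1 + (χ1 n).re) * (1 + (χ2 n).re)) : ℝ) : ℂ) := by
        simp only [Pi.add_apply, Pi.mul_apply]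
        push_cast
        rw [chp_apply, (conj_quad χ1 h1 n).1, (conj_quad χ2 h2 n).1]; ring
      rw [this]
      have h3 : 0 ≤ 1 + (χ1 n).re := by
        rcases (conj_quad χ1 h1 n).2 with h | h | h <;> simp [h]
      have h4 : 0 ≤ 1 + (χ2 n).re := by
        rcases (conj_quad χ2 h2 n).2 with h | h | h <;> simp [h]
      exact Complex.zero_le_real.2 (mul_nonneg ArithmeticFunction.vonMangoldt_nonneg (mul_nonneg h3 h4))
    · show 0 ≤ riemannZeta 2 * (LFunction χ1 2 * LFunction χ2 2 * LFunction (chp χ1 χ2) 2)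
      rw [hprod]
      exact Complex.zero_le_real.2 (by positivity)
  · show _ ≤ (riemannZeta 2 * (LFunction χ1 2 * LFunction χ2 2 * LFunction (chp χ1 χ2) 2)).re
    rw [hprod, Complex.ofReal_re]
    have : (34/100:ℝ)^3 ≤ (LFunction χ1 2).re * (LFunction χ2 2).re * (LFunction (chp χ1 χ2) 2).re := by
      calc (34/100:ℝ)^3 = 34/100 * (34/100) * (34/100) := by ring
        _ ≤ _ := by gcongr
    nlinarith
  · simp [hF]
end SW
end

section
open DirichletCharacter Finset

namespace SW

lemma zeta_neg : ∃ r : ℝ, 0 < r ∧ ∀ β : ℝ, 1 - r ≤ β → β < 1 → (riemannZeta β).re ≤ 0 := by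
  have hc : ContinuousAt Zf 1 := (Zf_diff 1).continuousAt
  rw [Metric.continuousAt_iff] at hc
  obtain ⟨r, hr, h⟩ := hc (1/2) (by norm_num)
  refine ⟨r/2, by positivity, fun β hβ hβ1 => ?_⟩
  have hd : dist (β:ℂ) 1 < r := by
    rw [dist_eq_norm, ← Complex.ofReal_one, ← Complex.ofReal_sub, Complex.norm_real, Real.norm_eq_abs, abs_lt]
    constructor <;> linarith
  have h1 := h hd
  have hne : (β:ℂ) ≠ 1 := by
    intro h; rw [Complex.ofReal_eq_one] at h; linarith
  rw [Zf_one, Zf_ne hne, dist_eq_norm] at h1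
  have h2 := (abs_lt.1 ((Complex.abs_re_le_norm _).trans_lt h1)).1
  rw [Complex.sub_re, ← Complex.ofReal_one, ← Complex.ofReal_sub, Complex.re_ofReal_mul] at h2
  simp at h2
  by_contra hcon
  push Not at hcon
  nlinarith

lemma L_nonneg {q : ℕ} [NeZero q] (χ : DirichletCharacter ℂ q) (hχ : χ ≠ 1) (h2 : χ ^ 2 = 1) {β : ℝ} (hβ : 0 < β)
    (hβ1 : β < 1) (hno : ∀ t : ℝ, β ≤ t → t < 1 → LFunction χ t ≠ 0) : 0 ≤ (LFunction χ β).re := by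
  by_contra hcon
  push Not at hcon
  have hcont : ContinuousOn (fun t : ℝ => (LFunction χ t).re) (Set.Icc β 2) := by
    have := (differentiable_LFunction hχ).continuous
    exact (Complex.continuous_re.comp (this.comp Complex.continuous_ofReal)).continuousOn
  have hmem : (0:ℝ) ∈ Set.Icc (LFunction χ β).re (LFunction χ (2:ℝ)).re := by
    refine ⟨hcon.le, ?_⟩
    have := L_two χ
    push_cast; linarith
  obtain ⟨t, ht, h0⟩ := intermediate_value_Icc (by linarith) hcont hmem
  have h0' : LFunction χ t = 0 := by
    rw [← L_real χ hχ h2 (by linarith [ht.1] : 0 < t)]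
    simpa using h0
  by_cases h1 : t < 1
  · exact hno t ht.1 h1 h0'
  · exact LFunction_ne_zero_of_one_le_re χ (Or.inl hχ) (by simpa using h1) h0'

lemma chp_ne {q1 q2 : ℕ} [NeZero q1] [NeZero q2] (χ1 : DirichletCharacter ℂ q1) (χ2 : DirichletCharacter ℂ q2) 
    (h2 : χ2^2=1) {β : ℝ} (hβ : 0 < β) (hβ1 : β < 1) (hz : LFunction χ1 β = 0)
    (hn : LFunction χ2 β ≠ 0) : chp χ1 χ2 ≠ 1 := by
  intro h
  have hb1 : (β:ℂ) ≠ 1 := by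
    intro h; rw [Complex.ofReal_eq_one] at h; linarith
  have he : changeLevel (Nat.dvd_mul_right q1 q2) χ1 = changeLevel (Nat.dvd_mul_left q2 q1) χ2 := by
    have h3 : (changeLevel (Nat.dvd_mul_left q2 q1) χ2)^2 = 1 := by rw [← map_pow, h2, map_one]
    rw [chp] at h
    calc _ = changeLevel (Nat.dvd_mul_right q1 q2) χ1 * changeLevel (Nat.dvd_mul_left q2 q1) χ2 * changeLevel (Nat.dvd_mul_left q2 q1) χ2 := by
            rw [mul_assoc, ← sq, h3, mul_one]
      _ = _ := by rw [h, one_mul]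
  have e1 := LFunction_changeLevel (Nat.dvd_mul_right q1 q2) χ1 (s := β) (Or.inr hb1)
  have e2 := LFunction_changeLevel (Nat.dvd_mul_left q2 q1) χ2 (s := β) (Or.inr hb1)
  rw [← he, e1, hz, zero_mul] at e2
  have := (mul_eq_zero.1 e2.symm).resolve_left hn
  obtain ⟨p, hp, hp0⟩ := Finset.prod_eq_zero_iff.1 this
  have hpp := Nat.prime_of_mem_primeFactors hp
  have h5 : ‖χ2 p * (p:ℂ)^(-(β:ℂ))‖ < 1 := by
    rw [norm_mul, Complex.norm_natCast_cpow_of_pos hpp.pos]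
    have : ((p:ℝ)^((-(β:ℂ)).re)) < 1 := Real.rpow_lt_one_of_one_lt_of_neg (by exact_mod_cast hpp.one_lt) (by simpa using hβ)
    calc _ ≤ 1 * (p:ℝ)^((-(β:ℂ)).re) := by gcongr; exact χ2.norm_le_one _
      _ < 1 := by linarith
  rw [← sub_eq_zero.1 hp0] at h5
  simp at h5

theorem siegel (ε : ℝ) (hε : 0 < ε) : ∃ c : ℝ, 0 < c ∧ ∀ (q : ℕ) [NeZero q] (χ : DirichletCharacter ℂ q), 
    χ ≠ 1 → χ^2 = 1 → c * (q:ℝ)^(-ε) ≤ ‖LFunction χ 1‖ := by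
  obtain ⟨c1, C1, hc1, hC1, H1⟩ := sieg1
  obtain ⟨c2, C2, hc2, hC2, H2⟩ := sieg2
  obtain ⟨r, hr, hz⟩ := zeta_neg
  obtain ⟨C3, hC3, H3⟩ := L_deriv_growth 0 (ε/2) (by positivity)
  obtain ⟨η, hη0, hη1, hη2, hη3, hη4⟩ : ∃ η : ℝ, 0 < η ∧ η ≤ 1/10 ∧ η ≤ r ∧ C1 * η ≤ ε ∧ C2 * η ≤ ε/4 := by
    refine ⟨min (min (1/10) r) (min (ε/C1) (ε/4/C2)), by positivity, ?_, ?_, ?_, ?_⟩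
    · exact (min_le_left _ _).trans (min_le_left _ _)
    · exact (min_le_left _ _).trans (min_le_right _ _)
    · rw [mul_comm, ← le_div_iff₀ hC1]; exact (min_le_right _ _).trans (min_le_left _ _)
    · rw [mul_comm, ← le_div_iff₀ hC2]; exact (min_le_right _ _).trans (min_le_right _ _)
  -- consequence of sieg1
  have K1 : ∀ β : ℝ, 1 - η ≤ β → β < 1 → ∀ (q : ℕ) [NeZero q] (χ : DirichletCharacter ℂ q), χ ≠ 1 → χ^2 = 1 →
      (riemannZeta β * LFunction χ β).re ≤ 0 → (c1 * (1-β) * 25^(-ε)) * (q:ℝ)^(-ε) ≤ ‖LFunction χ 1‖ := by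
    intro β hβ hβ1 q _ χ hχ h2 hF
    have hq : (1:ℝ) ≤ q := by exact_mod_cast NeZero.pos q
    refine le_trans ?_ ((H1 q χ hχ h2 β (by linarith) hβ1 hF).trans (Complex.re_le_norm _))
    have hb : 0 < 1 - β := by linarith
    rw [mul_assoc, ← Real.mul_rpow (by norm_num) (by linarith)]
    gcongr
    · linarith
    · nlinarith
  by_cases hcase : ∃ (q1 : ℕ) (_ : NeZero q1) (χ1 : DirichletCharacter ℂ q1) (β : ℝ), χ1 ≠ 1 ∧ χ1^2 = 1 ∧ 
      1 - η ≤ β ∧ β < 1 ∧ LFunction χ1 β = 0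
  · obtain ⟨q1, hne, χ1, β, hχ1, h1, hβ, hβ1, hzero⟩ := hcase
    have hb : 0 < 1 - β := by linarith
    have hq1 : (1:ℝ) ≤ q1 := by exact_mod_cast NeZero.pos q1
    have hL1 : 0 < ‖LFunction χ1 1‖ := norm_pos_iff.2 (LFunction_apply_one_ne_zero hχ1)
    set d := c2 * (1-β) * (25^3*q1^2)^(-(ε/4)) / (‖LFunction χ1 1‖ * (C3 * (2*q1)^(ε/2))) with hd
    have hd0 : 0 < d := by positivity
    refine ⟨min (c1 * (1-β) * 25^(-ε)) d, by positivity, fun q _ χ hχ h2 => ?_⟩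
    have hq : (1:ℝ) ≤ q := by exact_mod_cast NeZero.pos q
    have hq0 : (0:ℝ) < q := by linarith
    by_cases hzq : LFunction χ β = 0
    · refine le_trans ?_ (K1 β hβ hβ1 q χ hχ h2 (by rw [hzq]; simp))
      gcongr
      exact min_le_left _ _
    · have hchp := chp_ne χ1 χ h2 (by linarith) hβ1 hzero hzq
      have g := (H2 q1 q χ1 χ hχ1 h1 hχ h2 hchp β (by linarith) hβ1 hzero).trans (Complex.re_le_norm _)
      rw [norm_mul, norm_mul] at g
      have g3 := H3 _ _ hchp 1 (by simp) (by simp)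
      rw [iteratedDeriv_zero] at g3
      have e3 : Qs (q1*q) 1 = (2*q1)*q := by simp [Qs]; ring
      rw [e3, Real.mul_rpow (by positivity) (by positivity)] at g3
      have e4 : ((25*q1)*(25*q)*(25*(q1*q)) : ℝ) = (25^3*q1^2)*q^2 := by ring
      rw [e4] at g
      have g5 : c2 * (1-β) * ((25^3*q1^2)^(-(ε/4)) * (q:ℝ)^(-(ε/2))) ≤ c2 * (1-β) * ((25^3*q1^2)*(q:ℝ)^2)^(-(C2*(1-β))) := by
        have : (q:ℝ)^(-(ε/2)) = ((q:ℝ)^2)^(-(ε/4)) := by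
          rw [← Real.rpow_natCast, ← Real.rpow_mul hq0.le]; congr 1; push_cast; ring
        rw [this, ← Real.mul_rpow (by positivity) (by positivity)]
        gcongr
        · have : (1:ℝ) ≤ q1^2 := one_le_pow₀ hq1
          have : (1:ℝ) ≤ q^2 := one_le_pow₀ hq
          nlinarith
        · nlinarith
      have g6 := g5.trans g
      have g7 : c2 * (1-β) * ((25^3*q1^2)^(-(ε/4)) * (q:ℝ)^(-(ε/2))) ≤ ‖LFunction χ1 1‖ * ‖LFunction χ 1‖ * (C3 * ((2*q1)^(ε/2) * (q:ℝ)^(ε/2))) :=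
        g6.trans (by gcongr)
      have e8 : d * (q:ℝ)^(-ε) = c2 * (1-β) * ((25^3*q1^2)^(-(ε/4)) * (q:ℝ)^(-(ε/2))) / (‖LFunction χ1 1‖ * (C3 * ((2*q1)^(ε/2) * (q:ℝ)^(ε/2)))) := by
        have : (q:ℝ)^(-ε) = (q:ℝ)^(-(ε/2)) / (q:ℝ)^(ε/2) := by
          rw [← Real.rpow_sub hq0]; congr 1; ring
        rw [hd, this]
        have p1 : (q:ℝ)^(ε/2) ≠ 0 := by positivity
        have p2 : (2*(q1:ℝ))^(ε/2) ≠ 0 := by positivity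
        field_simp
      calc _ ≤ d * (q:ℝ)^(-ε) := by gcongr; exact min_le_right _ _
        _ ≤ _ := by
          rw [e8, div_le_iff₀ (by positivity)]
          refine g7.trans (le_of_eq (by ring))
  · push Not at hcase
    refine ⟨c1 * (1-(1-η)) * 25^(-ε), ?_, fun q _ χ hχ h2 => ?_⟩
    · have : 1 - (1-η) = η := by ring
      rw [this]; positivity
    · refine K1 (1-η) le_rfl (by linarith) q χ hχ h2 ?_
      have hn := L_nonneg χ hχ h2 (β := 1-η) (by linarith) (by linarith) 
        (fun t ht ht1 => hcase q inferInstance χ t hχ h2 ht ht1)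
      rw [← L_real χ hχ h2 (β := 1-η) (by linarith), mul_comm, Complex.re_ofReal_mul]
      exact mul_nonpos_of_nonneg_of_nonpos hn (hz _ (by linarith) (by linarith))
end SW
end

section
open DirichletCharacter Finset

namespace SW

lemma omega_bound (δ : ℝ) (hδ : 0 < δ) : ∃ C : ℝ, 0 < C ∧ ∀ q : ℕ, q ≠ 0 → (2:ℝ)^q.primeFactors.card ≤ C * (q:ℝ)^δ := by
  obtain ⟨B, hB⟩ := exists_nat_ge ((2:ℝ)^(1/δ))
  refine ⟨2^B, by positivity, fun q hq => ?_⟩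
  have h1 : ∀ p ∈ q.primeFactors, (2:ℝ) ≤ (if p < B then 2 else 1) * (p:ℝ)^δ := by
    intro p hp
    have hp1 : (1:ℝ) ≤ p := by exact_mod_cast (Nat.prime_of_mem_primeFactors hp).one_lt.le
    have hpd : 1 ≤ (p:ℝ)^δ := Real.one_le_rpow hp1 hδ.le
    split_ifs with h
    · linarith
    · push Not at h
      have : (2:ℝ) = ((2:ℝ)^(1/δ))^δ := by
        rw [← Real.rpow_mul (by norm_num)]; field_simp; simp
      rw [one_mul, this]
      gcongr
      exact hB.trans (by exact_mod_cast h)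
  calc (2:ℝ)^q.primeFactors.card = ∏ p ∈ q.primeFactors, (2:ℝ) := by simp
    _ ≤ ∏ p ∈ q.primeFactors, (if p < B then 2 else 1) * (p:ℝ)^δ := 
        Finset.prod_le_prod (fun _ _ => by norm_num) h1
    _ = (∏ p ∈ q.primeFactors, (if p < B then (2:ℝ) else 1)) * ∏ p ∈ q.primeFactors, (p:ℝ)^δ := Finset.prod_mul_distrib
    _ ≤ 2^B * (q:ℝ)^δ := by
      gcongr
      · rw [← Finset.prod_filter, Finset.prod_const]
        gcongr
        · norm_num
        · calc _ ≤ (range B).card := Finset.card_le_card fun p hp => by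
                  rw [Finset.mem_filter] at hp; exact Finset.mem_range.2 hp.2
            _ = B := by simp
      · rw [Real.finsetProd_rpow _ _ (fun i _ => by positivity)]
        gcongr
        have := Nat.le_of_dvd (Nat.pos_of_ne_zero hq) (Nat.prod_primeFactors_dvd q)
        rw [← Nat.cast_prod]; exact_mod_cast this

lemma zeta_step {s : ℂ} (hs : 1 < s.re) {n : ℕ} (hn : 1 ≤ n) :
    ‖(n:ℂ)^(-s) - (((n+1:ℕ):ℂ)^(1-s)/(1-s) - (n:ℂ)^(1-s)/(1-s))‖ ≤ ‖s‖ * ((n:ℝ)^2)⁻¹ := by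
  have hn0 : (0:ℝ) < n := by exact_mod_cast hn
  have hn1 : (1:ℝ) ≤ n := by exact_mod_cast hn
  have hs1 : 1 - s ≠ 0 := by
    intro h
    have := congrArg Complex.re h
    simp at this; linarith
  have hs0 : s ≠ 0 := by rintro rfl; simp at hs; linarith
  have hd : ∀ (w : ℂ), w ≠ 0 → ∀ t ∈ Set.Icc (n:ℝ) (n+1), HasDerivWithinAt (fun t : ℝ => (t:ℂ)^w) (w * (t:ℂ)^(w-1)) (Set.Icc (n:ℝ) (n+1)) t := by
    intro w hw t ht
    have ht0 : t ≠ 0 := by linarith [ht.1]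
    exact (hasDerivAt_ofReal_cpow_const ht0 hw).hasDerivWithinAt
  have hcv : Convex ℝ (Set.Icc (n:ℝ) (n+1)) := convex_Icc _ _
  have hnI : (n:ℝ) ∈ Set.Icc (n:ℝ) (n+1) := ⟨le_rfl, by linarith⟩
  have hnI1 : (n:ℝ)+1 ∈ Set.Icc (n:ℝ) (n+1) := ⟨by linarith, le_rfl⟩
  have h1 : ∀ t ∈ Set.Icc (n:ℝ) (n+1), ‖((t:ℂ))^(-s) - ((n:ℝ):ℂ)^(-s)‖ ≤ ‖s‖ * ((n:ℝ)^2)⁻¹ := by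
    intro t ht
    have hb : ∀ u ∈ Set.Icc (n:ℝ) (n+1), ‖-s * (u:ℂ)^(-s-1)‖ ≤ ‖s‖ * ((n:ℝ)^2)⁻¹ := by
      intro u hu
      have hu0 : 0 < u := by linarith [hu.1]
      rw [norm_mul, norm_neg, Complex.norm_cpow_eq_rpow_re_of_pos hu0]
      gcongr
      calc u^((-s-1).re) ≤ (n:ℝ)^((-s-1).re) := Real.rpow_le_rpow_of_nonpos hn0 hu.1 (by simp; linarith)
        _ ≤ (n:ℝ)^(-2:ℝ) := Real.rpow_le_rpow_of_exponent_le hn1 (by simp; linarith)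
        _ = _ := by rw [Real.rpow_neg hn0.le]; norm_cast
    have := hcv.norm_image_sub_le_of_norm_hasDerivWithin_le (hd (-s) (neg_ne_zero.2 hs0)) hb hnI ht
    refine this.trans ?_
    have h5 : ‖t - n‖ ≤ 1 := by rw [Real.norm_eq_abs, abs_le]; constructor <;> linarith [ht.1, ht.2]
    calc _ ≤ ‖s‖ * ((n:ℝ)^2)⁻¹ * 1 := by gcongr
      _ = _ := mul_one _
  have h2 : ∀ t ∈ Set.Icc (n:ℝ) (n+1), HasDerivWithinAt (fun t : ℝ => (t:ℂ)^(1-s)/(1-s) - (t:ℂ) * ((n:ℝ):ℂ)^(-s)) ((t:ℂ)^(-s) - ((n:ℝ):ℂ)^(-s)) (Set.Icc (n:ℝ) (n+1)) t := by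
    intro t ht
    have a1 := (hd (1-s) hs1 t ht).div_const (1-s)
    have a2 : HasDerivWithinAt (fun t : ℝ => (t:ℂ) * ((n:ℝ):ℂ)^(-s)) (1 * ((n:ℝ):ℂ)^(-s)) (Set.Icc (n:ℝ) (n+1)) t :=
      (Complex.ofRealCLM.hasDerivAt (x := t)).hasDerivWithinAt.mul_const _
    refine (a1.sub a2).congr_deriv ?_
    rw [one_mul, mul_div_cancel_left₀ _ hs1]
    congr 2; ring
  have h3 := hcv.norm_image_sub_le_of_norm_hasDerivWithin_le h2 h1 hnI hnI1
  have h4 : ‖(n:ℝ)+1 - n‖ = 1 := by simp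
  rw [h4, mul_one] at h3
  rw [← norm_neg]
  refine le_of_eq_of_le (congrArg norm ?_) h3
  push_cast
  ring

lemma sum_inv_sq_le {N : ℕ} (hN : 1 ≤ N) (M : ℕ) : ∑ n ∈ Ico N M, ((n:ℝ)^2)⁻¹ ≤ 2 / N := by
  rcases le_or_gt M N with h | h
  · rw [Finset.Ico_eq_empty (by omega)]; simp; positivity
  · have h2 : Ico N M ⊆ insert N (Ioc N M) := by
      intro x hx; simp at hx ⊢; omega
    have hN0 : (1:ℝ) ≤ N := by exact_mod_cast hN
    have h3 := sum_Ioc_inv_sq_le_sub (α := ℝ) (k := N) (n := M) (by omega) h.le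
    calc _ ≤ ∑ n ∈ insert N (Ioc N M), ((n:ℝ)^2)⁻¹ := Finset.sum_le_sum_of_subset_of_nonneg h2 (fun _ _ _ => by positivity)
      _ = ((N:ℝ)^2)⁻¹ + ∑ n ∈ Ioc N M, ((n:ℝ)^2)⁻¹ := by rw [Finset.sum_insert (by simp)]
      _ ≤ (N:ℝ)⁻¹ + (N:ℝ)⁻¹ := by
        gcongr
        · nlinarith
        · refine h3.trans ?_
          have : 0 ≤ (M:ℝ)⁻¹ := by positivity
          linarith
      _ = 2/N := by field_simp; norm_num

lemma zeta_bound_N {s : ℂ} (hs : 1 < s.re) {N : ℕ} (hN : 1 ≤ N) :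
    ‖riemannZeta s‖ ≤ 1 + Real.log N + 2/‖s-1‖ + 2 * ‖s‖/N := by
  have hs0 : s ≠ 0 := by rintro rfl; simp at hs; linarith
  have hs1 : 0 < ‖s - 1‖ := norm_pos_iff.2 (by
    intro h
    have := congrArg Complex.re h
    simp at this; linarith)
  have hsum : Summable (fun n : ℕ => (n:ℂ)^(-s)) := by
    have := Complex.summable_one_div_nat_cpow.2 hs
    refine this.congr fun n => ?_
    rw [Complex.cpow_neg, one_div]
  have hz : riemannZeta s = ∑' n : ℕ, (n:ℂ)^(-s) := by
    rw [zeta_eq_tsum_one_div_nat_cpow hs]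
    refine tsum_congr fun n => ?_
    rw [Complex.cpow_neg, one_div]
  have ht := hsum.hasSum.tendsto_sum_nat
  rw [← hz] at ht
  refine le_of_tendsto ht.norm ?_
  filter_upwards [Filter.eventually_ge_atTop (N+1)] with M hM
  have hsplit : ∑ n ∈ range M, (n:ℂ)^(-s) = ∑ n ∈ range N, (n:ℂ)^(-s) + ∑ n ∈ Ico N M, (n:ℂ)^(-s) := by
    rw [Finset.sum_range_add_sum_Ico _ (by omega)]
  have hN0 : (1:ℝ) ≤ N := by exact_mod_cast hN
  have b1 : ‖∑ n ∈ range N, (n:ℂ)^(-s)‖ ≤ 1 + Real.log N := by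
    have : ∑ n ∈ range N, (n:ℂ)^(-s) = ∑ n ∈ Ico 1 N, (n:ℂ)^(-s) := by
      rw [Finset.range_eq_Ico, Finset.sum_eq_sum_Ico_succ_bot (by omega)]
      simp [Complex.zero_cpow (neg_ne_zero.2 hs0)]
    rw [this]
    refine (norm_sum_le _ _).trans ?_
    have h2 : ∑ n ∈ Ico 1 N, ‖(n:ℂ)^(-s)‖ ≤ ∑ n ∈ Ico 1 N, (n:ℝ)⁻¹ := by
      refine Finset.sum_le_sum fun n hn => ?_
      have hn1 : 1 ≤ n := (Finset.mem_Ico.1 hn).1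
      rw [Complex.norm_natCast_cpow_of_pos (by omega), ← Real.rpow_neg_one]
      refine Real.rpow_le_rpow_of_exponent_le (by exact_mod_cast hn1) (by simp; linarith)
    refine h2.trans ?_
    have h3 : ∑ n ∈ Ico 1 N, (n:ℝ)⁻¹ ≤ harmonic N := by
      rw [harmonic_eq_sum_Icc]; push_cast
      exact Finset.sum_le_sum_of_subset_of_nonneg (fun x hx => by simp at hx ⊢; omega) (fun _ _ _ => by positivity)
    exact h3.trans (harmonic_le_one_add_log N)
  have b2 : ‖∑ n ∈ Ico N M, (n:ℂ)^(-s)‖ ≤ 2/‖s-1‖ + 2*‖s‖/N := by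
    set g : ℕ → ℂ := fun n => (n:ℂ)^(1-s)/(1-s) with hg
    have e : ∑ n ∈ Ico N M, (n:ℂ)^(-s) = ∑ n ∈ Ico N M, ((n:ℂ)^(-s) - (g (n+1) - g n)) + (g M - g N) := by
      rw [Finset.sum_sub_distrib, Finset.sum_Ico_sub g (by omega)]; ring
    have hgb : ∀ n, 1 ≤ n → ‖g n‖ ≤ 1/‖s-1‖ := by
      intro n hn
      rw [hg]
      simp only [norm_div]
      rw [norm_sub_rev 1 s, Complex.norm_natCast_cpow_of_pos (by omega)]
      gcongr
      exact Real.rpow_le_one_of_one_le_of_nonpos (by exact_mod_cast hn) (by simp; linarith)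
    rw [e]
    refine (norm_add_le _ _).trans ?_
    have c1 : ‖∑ n ∈ Ico N M, ((n:ℂ)^(-s) - (g (n+1) - g n))‖ ≤ 2*‖s‖/N := by
      refine (norm_sum_le _ _).trans ?_
      calc _ ≤ ∑ n ∈ Ico N M, ‖s‖ * ((n:ℝ)^2)⁻¹ := 
            Finset.sum_le_sum fun n hn => zeta_step hs (hN.trans (Finset.mem_Ico.1 hn).1)
        _ ≤ ‖s‖ * (2/N) := by rw [← Finset.mul_sum]; gcongr; exact sum_inv_sq_le hN M
        _ = _ := by ring
    have c2 : ‖g M - g N‖ ≤ 2/‖s-1‖ := by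
      refine (norm_sub_le _ _).trans ?_
      have := hgb M (by omega)
      have := hgb N hN
      have : 2/‖s-1‖ = 1/‖s-1‖ + 1/‖s-1‖ := by ring
      linarith
    linarith
  rw [hsplit]
  refine (norm_add_le _ _).trans ?_
  linarith

lemma triv_bound (δ : ℝ) (hδ : 0 < δ) : ∃ C : ℝ, 0 < C ∧ ∀ (q : ℕ) [NeZero q] (s : ℂ), 1 < s.re → s.re ≤ 2 →
    ‖LFunction (1 : DirichletCharacter ℂ q) s‖ ≤ C * Qs q s ^ δ * (1 + 1/‖s-1‖) := by
  obtain ⟨C1, hC1, h1⟩ := omega_bound δ hδ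
  refine ⟨C1 * (5 + 2/δ), by positivity, fun q _ s hs hs2 => ?_⟩
  have hq0 : q ≠ 0 := NeZero.ne q
  have hs1' : s ≠ 1 := by rintro rfl; simp at hs
  have hs1 : 0 < ‖s - 1‖ := norm_pos_iff.2 (sub_ne_zero.2 hs1')
  have e := LFunctionTrivChar_eq_mul_riemannZeta (N := q) hs1'
  have e1 : LFunction (1 : DirichletCharacter ℂ q) s = LFunctionTrivChar q s := rfl
  rw [e1, e, norm_mul, norm_prod]
  have hp : ∏ p ∈ q.primeFactors, ‖1 - (p:ℂ)^(-s)‖ ≤ C1 * (q:ℝ)^δ := by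
    refine le_trans ?_ (h1 q hq0)
    rw [← Finset.prod_const]
    refine Finset.prod_le_prod (fun _ _ => norm_nonneg _) fun p hp => ?_
    have hpp := Nat.prime_of_mem_primeFactors hp
    refine (norm_sub_le _ _).trans ?_
    rw [Complex.norm_natCast_cpow_of_pos hpp.pos, norm_one]
    have : (p:ℝ)^((-s).re) ≤ 1 := Real.rpow_le_one_of_one_le_of_nonpos (by exact_mod_cast hpp.one_lt.le) (by simp; linarith)
    linarith
  set t := |s.im| with ht
  have ht0 : 0 ≤ t := abs_nonneg _
  have hN : (t + 2 ≤ ((⌈t+2⌉₊ : ℕ):ℝ)) := Nat.le_ceil _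
  have hN2 : ((⌈t+2⌉₊ : ℕ):ℝ) ≤ 2*(t+2) := by
    have := Nat.ceil_lt_add_one (a := t+2) (by positivity)
    linarith
  have hz := zeta_bound_N hs (N := ⌈t+2⌉₊) (Nat.one_le_ceil_iff.2 (by positivity))
  have hsn : ‖s‖ ≤ t + 2 := by
    refine (Complex.norm_le_abs_re_add_abs_im s).trans ?_
    rw [abs_of_pos (by linarith)]; linarith
  have hpow : 1 ≤ (t+2)^δ := Real.one_le_rpow (by linarith) hδ.le
  have hlog : Real.log (⌈t+2⌉₊ : ℕ) ≤ 1 + (2/δ) * (t+2)^δ := by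
    calc Real.log (⌈t+2⌉₊ : ℕ) ≤ Real.log (2*(t+2)) := Real.log_le_log (by linarith) hN2
      _ = Real.log 2 + Real.log (t+2) := Real.log_mul (by norm_num) (by linarith)
      _ ≤ 1 + (t+2)^δ/δ := by
        have := Real.log_two_lt_d9
        have := Real.log_le_rpow_div (x := t+2) (by linarith) hδ
        linarith
      _ ≤ _ := by
        have : (2/δ) * (t+2)^δ = (t+2)^δ/δ + (t+2)^δ/δ := by ring
        have : 0 ≤ (t+2)^δ/δ := by positivity
        linarith
  have hz2 : ‖riemannZeta s‖ ≤ (5+2/δ) * (t+2)^δ * (1 + 1/‖s-1‖) := by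
    have h6 : 2*‖s‖/(⌈t+2⌉₊ : ℕ) ≤ 2 := by
      rw [div_le_iff₀ (by linarith)]; linarith
    have h7 : 2/‖s-1‖ = 2 * (1/‖s-1‖) := by ring
    set w := 1/‖s-1‖ with hw
    have hw0 : 0 ≤ w := by positivity
    have h8 : 0 < 2/δ := by positivity
    set T := (t+2)^δ with hT
    have : (5+2/δ) * T * (1+w) = 5*T + 2/δ*T + 5*T*w + 2/δ*T*w := by ring
    have h9 : 0 ≤ 2/δ*T*w := by positivity
    have h10 : w ≤ T * w := le_mul_of_one_le_left hw0 hpow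
    rw [h7] at hz
    nlinarith
  calc _ ≤ (C1 * (q:ℝ)^δ) * ((5+2/δ) * (t+2)^δ * (1 + 1/‖s-1‖)) := by gcongr
    _ = _ := by
      rw [Qs, Real.mul_rpow (by positivity) (by positivity)]; ring

lemma triv_real {q : ℕ} [NeZero q] {x : ℝ} (hx : 0 < x) (hx1 : x ≤ 1) : ‖LFunctionTrivChar q (1 + x)‖ ≤ 2/x := by
  have hre : 1 < (1 + (x:ℂ)).re := by simp [hx]
  have e1 : LFunctionTrivChar q (1+x) = LFunction (1 : DirichletCharacter ℂ q) (1+x) := rfl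
  rw [e1, LFunction_eq_LSeries _ hre]
  have hs : 1 < 1 + x := by linarith
  have hsum : Summable (fun n : ℕ => 1/(n:ℝ)^(1+x)) := Real.summable_one_div_nat_rpow.2 hs
  have hb : ∀ n : ℕ, ‖LSeries.term (fun n => (1 : DirichletCharacter ℂ q) n) (1+x) n‖ ≤ 1/(n:ℝ)^(1+x) := by
    intro n
    rcases Nat.eq_zero_or_pos n with rfl | hn
    · rw [LSeries.term_zero, norm_zero]; positivity
    rw [LSeries.term_of_ne_zero hn.ne', norm_div, Complex.norm_natCast_cpow_of_pos hn]
    simp only [Complex.add_re, Complex.one_re, Complex.ofReal_re]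
    gcongr
    exact DirichletCharacter.norm_le_one _ _
  refine (tsum_of_norm_bounded hsum.hasSum hb).trans ?_
  have h1 := ZetaAsymptotics.zeta_limit_aux1 hs
  have h2 : 0 ≤ ZetaAsymptotics.termTSum (1+x) :=
    tsum_nonneg fun n => ZetaAsymptotics.term_nonneg _ _
  have h3 : (0:ℝ) ≤ (1+x) * ZetaAsymptotics.termTSum (1+x) := by positivity
  rw [hsum.tsum_eq_zero_add]
  have h4 : (1:ℝ)/((0:ℕ):ℝ)^(1+x) = 0 := by
    rw [Nat.cast_zero, Real.zero_rpow (by linarith)]; simp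
  have h5 : (1:ℝ)/(1+x-1) = 1/x := by congr 1; ring
  have h6 : 1 ≤ 1/x := by rw [le_div_iff₀ hx]; linarith
  have h7 : 2/x = 1/x + 1/x := by ring
  rw [h4]
  push_cast
  rw [h5] at h1
  linarith
end SW
end

section
open DirichletCharacter Finset

namespace SW

lemma L_mvt {q : ℕ} [NeZero q] {χ : DirichletCharacter ℂ q} (hχ : χ ≠ 1) {D : ℝ} {S : Set ℂ} (hS : Convex ℝ S)
    (hD : ∀ z ∈ S, ‖iteratedDeriv 1 (LFunction χ) z‖ ≤ D) {z w : ℂ} (hz : z ∈ S) (hw : w ∈ S) :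
    ‖LFunction χ w - LFunction χ z‖ ≤ D * ‖w - z‖ := by
  refine hS.norm_image_sub_le_of_norm_deriv_le (f := LFunction χ) (fun x _ => (differentiable_LFunction hχ) x) ?_ hz hw
  intro x hx
  have := hD x hx
  rwa [iteratedDeriv_one] at this

lemma low_core (δ B : ℝ) (hδ : 0 < δ) (hB : 0 < B) : ∃ c : ℝ, 0 < c ∧ ∀ (q : ℕ) [NeZero q] (χ : DirichletCharacter ℂ q), χ ≠ 1 →
    ∀ s : ℂ, 1 < s.re → s.re ≤ 2 → (∀ x : ℝ, s.re - 1 ≤ x → x ≤ 1 → ‖LFunction (χ^2) (1 + x + 2 * Complex.I * s.im)‖ ≤ B * Qs q s ^ δ) →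
      c * Qs q s ^ (-(4*δ)) ≤ ‖LFunction χ s‖ := by
  obtain ⟨C, hC, h1⟩ := L_deriv_growth 1 δ hδ
  set κ : ℝ := min 1 (1/(128 * B * C^4)) with hκ
  have hκ0 : 0 < κ := lt_min one_pos (by positivity)
  have hκ1 : κ ≤ 1 := min_le_left _ _
  have hκ2 : κ * (128 * B * C^4) ≤ 1 := by
    have : κ ≤ 1/(128 * B * C^4) := min_le_right _ _
    rwa [le_div_iff₀ (by positivity)] at this
  refine ⟨C * κ, by positivity, fun q _ χ hχ s hs hs2 hyp => ?_⟩
  set Q := Qs q s with hQ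
  have hQ2 : 2 ≤ Q := Qs_ge q s
  have hQ0 : 0 < Q := by linarith
  set P := Q ^ δ with hP
  have hP1 : 1 ≤ P := Real.one_le_rpow (by linarith) hδ.le
  have hP0 : 0 < P := by linarith
  have hP4 : Q ^ (-(4*δ)) = (P^4)⁻¹ := by
    rw [Real.rpow_neg hQ0.le, hP, ← Real.rpow_natCast, ← Real.rpow_mul hQ0.le]
    congr 2; push_cast; ring
  set η : ℝ := κ * (P^5)⁻¹ with hη
  have hη0 : 0 < η := by positivity
  have hη1 : η ≤ 1 := by
    calc η ≤ 1 * 1 := by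
          rw [hη]; gcongr
          exact inv_le_one_of_one_le₀ (one_le_pow₀ hP1)
      _ = 1 := one_mul 1
  have key : ∀ x : ℝ, s.re - 1 ≤ x → x ≤ 1 → η ≤ x → 2 * C * η * P ≤ ‖LFunction χ (1 + x + Complex.I * s.im)‖ := by
    intro x hx1 hx2 hx3
    have hx0 : 0 < x := by linarith
    have a := norm_LFunction_product_ge_one χ hx0 s.im
    rw [norm_mul, norm_mul, norm_pow, norm_pow] at a
    have a1 := triv_real (q := q) hx0 hx2
    have a2 := hyp x hx1 hx2
    set l := ‖LFunction χ (1 + x + Complex.I * s.im)‖ with hl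
    have hl0 : 0 ≤ l := norm_nonneg _
    have a3 : 1 ≤ (2/x)^3 * l^4 * (B * P) := by
      refine le_trans a ?_
      gcongr
    have a4 : (2/x)^3 * l^4 * (B * P) ≤ (2/η)^3 * l^4 * (B*P) := by gcongr
    have a5 : η^3 ≤ 8 * l^4 * (B*P) := by
      have := a3.trans a4
      have e : (2/η)^3 * l^4 * (B*P) = 8 * l^4 * (B*P) / η^3 := by field_simp; ring
      rw [e, le_div_iff₀ (by positivity)] at this
      linarith
    have a6 : (2*C*η*P)^4 ≤ l^4 := by
      have e2 : η * P^5 = κ := by rw [hη]; field_simp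
      have e3 : (2*C*η*P)^4 * (8 * (B*P)) = η^3 * (κ * (128 * B * C^4)) := by
        rw [← e2]; ring
      have e4 : (2*C*η*P)^4 * (8 * (B*P)) ≤ l^4 * (8*(B*P)) := by
        rw [e3]
        calc _ ≤ η^3 * 1 := by gcongr
          _ ≤ _ := by linarith
      exact le_of_mul_le_mul_right e4 (by positivity)
    exact le_of_pow_le_pow_left₀ (by norm_num) hl0 a6
  have hform : ∀ z : ℂ, z.im = s.im → z = 1 + ((z.re - 1 : ℝ):ℂ) + Complex.I * s.im := by
    intro z hz
    apply Complex.ext <;> simp [hz]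
  have htgt : C * κ * Q ^ (-(4*δ)) = C * η * P := by
    rw [hP4, hη]; field_simp
  rw [htgt]
  rcases le_or_gt η (s.re - 1) with h | h
  · have := key (s.re - 1) le_rfl (by linarith) h
    rw [← hform s rfl] at this
    have : 0 < C * η * P := by positivity
    linarith
  · have k1 := key η h.le hη1 le_rfl
    set s1 : ℂ := 1 + η + Complex.I * s.im with hs1
    have hre : s1.re = 1 + η := by simp [hs1]
    have him : s1.im = s.im := by simp [hs1]
    have hconv : Convex ℝ (Set.Icc (1:ℝ) 2 ×ℂ {s.im}) := ((convex_Icc (𝕜 := ℝ) (1:ℝ) 2).linear_preimage Complex.reLm).inter ((convex_singleton (𝕜 := ℝ) s.im).linear_preimage Complex.imLm)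
    have hm := L_mvt hχ (D := C * P) hconv (by
      intro z hz
      rw [Complex.mem_reProdIm] at hz
      have hzi : z.im = s.im := hz.2
      have := h1 q χ hχ z hz.1.1 hz.1.2
      have e : Qs q z = Q := by rw [hQ, Qs, Qs, hzi]
      rwa [e] at this) (z := s) (w := s1) (by
        rw [Complex.mem_reProdIm]; exact ⟨⟨by linarith, hs2⟩, rfl⟩) (by
        rw [Complex.mem_reProdIm]; exact ⟨⟨by linarith, by linarith⟩, him⟩)
    have hd : ‖s1 - s‖ ≤ η := by
      have : s1 - s = ((η - (s.re - 1) : ℝ) : ℂ) := by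
        apply Complex.ext <;> simp [hre, him]; ring
      rw [this, Complex.norm_real, Real.norm_eq_abs, abs_le]
      constructor <;> linarith
    have hm2 : ‖LFunction χ s1 - LFunction χ s‖ ≤ C * P * η := hm.trans (by gcongr)
    have := norm_sub_norm_le (LFunction χ s1) (LFunction χ s)
    nlinarith

lemma low_bound (δ : ℝ) (hδ : 0 < δ) : ∃ c : ℝ, 0 < c ∧ ∀ (q : ℕ) [NeZero q] (χ : DirichletCharacter ℂ q), χ ≠ 1 →
    ∀ s : ℂ, 1 < s.re → s.re ≤ 2 → c * Qs q s ^ (-(16*δ)) ≤ ‖LFunction χ s‖ := by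
  obtain ⟨C0, hC0, h0⟩ := L_deriv_growth 0 δ hδ
  obtain ⟨C1, hC1, h1⟩ := L_deriv_growth 1 δ hδ
  obtain ⟨C2, hC2, h2⟩ := triv_bound δ hδ
  obtain ⟨c3, hc3, h3⟩ := siegel δ hδ
  set τ0 : ℝ := min 1 (c3/(2 * C1 * 3^δ)) with hτ0
  have hτ00 : 0 < τ0 := lt_min one_pos (by positivity)
  have hτ01 : τ0 * (2 * C1 * 3^δ) ≤ c3 := by
    have : τ0 ≤ c3/(2 * C1 * 3^δ) := min_le_right _ _
    rwa [le_div_iff₀ (by positivity)] at this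
  set B : ℝ := C0 * 2^δ + C2 * 2^δ * (1 + 1/τ0) with hB
  have hB0 : 0 < B := by positivity
  obtain ⟨c, hc, h4⟩ := low_core (4*δ) B (by positivity) hB0
  refine ⟨min c (c3/2), lt_min hc (by positivity), fun q _ χ hχ s hs hs2 => ?_⟩
  set Q := Qs q s with hQ
  have hQ2 : 2 ≤ Q := Qs_ge q s
  have hQ0 : 0 < Q := by linarith
  have hq1 : (1:ℝ) ≤ q := by exact_mod_cast NeZero.one_le
  have hqQ : (q:ℝ) ≤ Q := q_le_Qs q s
  have hform : ∀ x : ℝ, ((1 + x + 2 * Complex.I * s.im : ℂ)).re = 1 + x ∧ ((1 + x + 2 * Complex.I * s.im : ℂ)).im = 2 * s.im := by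
    intro x; constructor <;> simp
  have hQs2 : ∀ z : ℂ, z.im = 2 * s.im → Qs q z ^ δ ≤ 2^δ * Q^δ := by
    intro z hz
    rw [← Real.mul_rpow (by norm_num) hQ0.le]
    have : Qs q z ≤ 2 * Q := by
      rw [hQ, Qs, Qs, hz, abs_mul]
      have : |(2:ℝ)| = 2 := by norm_num
      rw [this]
      nlinarith [abs_nonneg s.im]
    have := Qs_ge q z
    gcongr
  have hP1 : 1 ≤ Q ^ δ := Real.one_le_rpow (by linarith) hδ.le
  have hQ4 : Q ^ (4*δ) = (Q^δ)^4 := by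
    rw [← Real.rpow_natCast, ← Real.rpow_mul hQ0.le]; congr 1; push_cast; ring
  have e16 : -(4*(4*δ)) = -(16*δ) := by ring
  have fin : (∀ x : ℝ, s.re - 1 ≤ x → x ≤ 1 → ‖LFunction (χ^2) (1 + x + 2 * Complex.I * s.im)‖ ≤ B * Q ^ (4*δ)) → 
      min c (c3/2) * Q ^ (-(16*δ)) ≤ ‖LFunction χ s‖ := by
    intro hyp
    have := h4 q χ hχ s hs hs2 hyp
    rw [e16] at this
    refine le_trans ?_ this
    gcongr
    exact min_le_left _ _
  by_cases hχ2 : χ^2 = 1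
  · set τ : ℝ := τ0 * (Q^(3*δ))⁻¹ with hτ
    have hτpos : 0 < τ := by positivity
    rcases le_or_gt τ ‖s - 1‖ with h | h
    · apply fin
      intro x hx1 hx2
      rw [hχ2]
      obtain ⟨f1, f2⟩ := hform x
      set z : ℂ := 1 + x + 2 * Complex.I * s.im with hz
      have b := h2 q z (by linarith) (by linarith)
      have hzs : τ ≤ ‖z - 1‖ := by
        refine h.trans ?_
        rw [Complex.norm_def, Complex.norm_def]
        refine Real.sqrt_le_sqrt ?_
        rw [Complex.normSq_apply, Complex.normSq_apply]
        simp only [Complex.sub_re, Complex.sub_im, Complex.one_re, Complex.one_im, f1, f2]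
        nlinarith [sq_nonneg s.im]
      refine b.trans ?_
      have k1 : 1/‖z-1‖ ≤ 1/τ0 * (Q^δ)^3 := by
        calc 1/‖z-1‖ ≤ 1/τ := by gcongr
          _ = _ := by
            rw [hτ, show Q^(3*δ) = (Q^δ)^3 by
              rw [← Real.rpow_natCast, ← Real.rpow_mul hQ0.le]; congr 1; push_cast; ring]
            field_simp
      have k2 := hQs2 z f2
      rw [hQ4]
      set P := Q^δ with hP
      have hP3 : 1 ≤ P^3 := one_le_pow₀ hP1
      calc C2 * Qs q z ^ δ * (1 + 1/‖z-1‖) ≤ C2 * (2^δ * P) * (P^3 + 1/τ0 * P^3) := by gcongr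
        _ = C2 * 2^δ * (1 + 1/τ0) * P^4 := by ring
        _ ≤ B * P^4 := by
          rw [hB]; gcongr
          have : 0 < C0 * 2^δ := by positivity
          linarith
    · have hconv : Convex ℝ (Metric.closedBall (1:ℂ) 1 ∩ {z : ℂ | 1 ≤ z.re}) := (convex_closedBall _ _).inter (convex_halfSpace_re_ge 1)
      have hPge : 1 ≤ Q^(3*δ) := Real.one_le_rpow (by linarith) (by positivity)
      have hτ1 : τ ≤ 1 := by
        calc τ ≤ 1 * 1 := by
              rw [hτ]; gcongr
              · exact min_le_left _ _
              · exact inv_le_one_of_one_le₀ hPge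
          _ = 1 := one_mul 1
      have hm := L_mvt hχ (D := C1 * (3^δ * (q:ℝ)^δ)) hconv (by
        intro z hz
        have hz1 : ‖z - 1‖ ≤ 1 := by simpa [dist_eq_norm] using hz.1
        have hz2 : 1 ≤ z.re := hz.2
        have r1 := (Complex.abs_re_le_norm (z-1)).trans hz1
        have r2 := (Complex.abs_im_le_norm (z-1)).trans hz1
        simp only [Complex.sub_re, Complex.one_re, Complex.sub_im, Complex.one_im, sub_zero] at r1 r2
        refine (h1 q χ hχ z hz2 (by linarith [(abs_le.1 r1).2])).trans ?_
        rw [← Real.mul_rpow (by norm_num) (by positivity)]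
        have : Qs q z ≤ 3 * q := by rw [Qs]; nlinarith
        have := Qs_ge q z
        gcongr) (z := 1) (w := s) ⟨by simp, by simp⟩ ⟨by simpa [dist_eq_norm] using h.le.trans hτ1, hs.le⟩
      have hs3 := h3 q χ hχ hχ2
      have n1 := norm_sub_norm_le (LFunction χ 1) (LFunction χ s)
      rw [norm_sub_rev] at n1
      set p := (q:ℝ)^δ with hp
      have hp1 : 1 ≤ p := Real.one_le_rpow hq1 hδ.le
      have hpP : p ≤ Q^δ := by rw [hp]; gcongr
      rw [Real.rpow_neg (by positivity), ← hp] at hs3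
      have hQ3 : Q^(3*δ) = (Q^δ)^3 := by
        rw [← Real.rpow_natCast, ← Real.rpow_mul hQ0.le]; congr 1; push_cast; ring
      have m1 : ‖LFunction χ s - LFunction χ 1‖ ≤ c3/2 * p⁻¹ := by
        refine hm.trans ?_
        have m2 : τ ≤ τ0 * (p^2)⁻¹ := by
          rw [hτ, hQ3]
          gcongr
          calc p^2 ≤ p^3 := pow_le_pow_right₀ hp1 (by norm_num)
            _ ≤ _ := by gcongr
        calc C1 * (3^δ * p) * ‖s - 1‖ ≤ C1 * (3^δ * p) * (τ0 * (p^2)⁻¹) := by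
              gcongr; exact h.le.trans m2
          _ = (τ0 * (2 * C1 * 3^δ)) / 2 * p⁻¹ := by field_simp
          _ ≤ _ := by gcongr
      have m3 : c3/2 * p⁻¹ ≤ ‖LFunction χ s‖ := by
        have : c3/2 * p⁻¹ + c3/2 * p⁻¹ = c3 * p⁻¹ := by ring
        linarith
      refine le_trans ?_ m3
      gcongr
      · exact min_le_right _ _
      · rw [Real.rpow_neg hQ0.le]
        gcongr
        refine hpP.trans ?_
        exact Real.rpow_le_rpow_of_exponent_le (by linarith) (by linarith)
  · apply fin
    intro x hx1 hx2
    obtain ⟨f1, f2⟩ := hform x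
    have b := h0 q (χ^2) hχ2 (1 + x + 2 * Complex.I * s.im) (by linarith) (by linarith)
    rw [iteratedDeriv_zero] at b
    refine b.trans ?_
    have k2 := hQs2 _ f2
    rw [hQ4]
    have hP3 : 1 ≤ (Q^δ)^3 := one_le_pow₀ hP1
    calc C0 * Qs q (1 + x + 2 * Complex.I * s.im) ^ δ ≤ C0 * (2^δ * Q^δ) := by gcongr
      _ = (C0 * 2^δ) * Q^δ * 1 := by ring
      _ ≤ B * Q^δ * (Q^δ)^3 := by
        gcongr
        rw [hB]
        have : 0 < C2 * 2^δ * (1 + 1/τ0) := by positivity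
        linarith
      _ = _ := by ring
end SW
end

section
open DirichletCharacter Finset ArithmeticFunction

namespace SW

/-- twisted von Mangoldt -/
noncomputable def aL {q : ℕ} (χ : DirichletCharacter ℂ q) : ℕ → ℂ := (fun n : ℕ => χ n) * fun n => (vonMangoldt n : ℂ)

lemma aL_abs {q : ℕ} (χ : DirichletCharacter ℂ q) : LSeries.abscissaOfAbsConv (aL χ) ≤ 1 :=
  LSeries.abscissaOfAbsConv_le_of_forall_lt_LSeriesSummable' (x := 1) fun y hy =>
    LSeriesSummable_twist_vonMangoldt χ (by simpa using (by exact_mod_cast hy : (1:ℝ) < y))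

lemma aL_lt {q : ℕ} (χ : DirichletCharacter ℂ q) {s : ℂ} (hs : 1 < s.re) : LSeries.abscissaOfAbsConv (aL χ) < s.re :=
  lt_of_le_of_lt (aL_abs χ) (by exact_mod_cast hs)

lemma H_growth (k : ℕ) : ∀ (δ : ℝ), 0 < δ → ∃ C : ℝ, 0 < C ∧ ∀ (q : ℕ) [NeZero q] (χ : DirichletCharacter ℂ q), χ ≠ 1 →
    ∀ s : ℂ, 1 < s.re → s.re ≤ 2 → ‖iteratedDeriv k (LSeries (aL χ)) s‖ ≤ C * Qs q s ^ δ := by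
  induction k using Nat.strong_induction_on with
  | _ k ih =>
  intro δ hδ
  obtain ⟨c, hc, hlow⟩ := low_bound (δ/48) (by positivity)
  obtain ⟨C0, hC0, h0⟩ := L_deriv_growth (k+1) (δ/3) (by positivity)
  have hL : ∀ j : ℕ, ∃ C : ℝ, 0 < C ∧ ∀ (q : ℕ) [NeZero q] (χ : DirichletCharacter ℂ q), χ ≠ 1 →
    ∀ s : ℂ, 1 ≤ s.re → s.re ≤ 2 → ‖iteratedDeriv j (LFunction χ) s‖ ≤ C * Qs q s ^ (δ/3) := fun j =>
      L_deriv_growth j (δ/3) (by positivity)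
  choose CL hCL hL using hL
  have hH : ∀ i : ℕ, ∃ C : ℝ, 0 < C ∧ (i < k → ∀ (q : ℕ) [NeZero q] (χ : DirichletCharacter ℂ q), χ ≠ 1 →
    ∀ s : ℂ, 1 < s.re → s.re ≤ 2 → ‖iteratedDeriv i (LSeries (aL χ)) s‖ ≤ C * Qs q s ^ (δ/3)) := by
    intro i
    by_cases hi : i < k
    · obtain ⟨C, hC, h⟩ := ih i hi (δ/3) (by positivity)
      exact ⟨C, hC, fun _ => h⟩
    · exact ⟨1, one_pos, fun h => absurd h hi⟩
  choose CH hCH hH using hH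
  set A : ℝ := C0 + ∑ i ∈ range k, k.choose i * CH i * CL (k - i) with hA
  have hA0 : 0 < A := by
    have : 0 ≤ ∑ i ∈ range k, k.choose i * CH i * CL (k - i) := Finset.sum_nonneg fun i _ => by
      have := hCH i; have := hCL (k-i); positivity
    linarith
  refine ⟨A / c, by positivity, fun q _ χ hχ s hs hs2 => ?_⟩
  have hQ2 := Qs_ge q s
  set Q := Qs q s with hQ
  have hQ0 : 0 < Q := by linarith
  set P := Q ^ (δ/3) with hP
  have hP1 : 1 ≤ P := Real.one_le_rpow (by linarith) (by positivity)
  have hmem : {z : ℂ | 1 < z.re} ∈ nhds s := (isOpen_lt continuous_const Complex.continuous_re).mem_nhds hs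
  have hLan : ContDiffAt ℂ k (LFunction χ) s := (differentiable_LFunction hχ).contDiff.contDiffAt
  have hHan : ContDiffAt ℂ k (LSeries (aL χ)) s :=
    (LSeries_analyticOnNhd (aL χ) s (aL_lt χ hs)).contDiffAt
  have heq : (fun z => LSeries (aL χ) z * LFunction χ z) =ᶠ[nhds s] fun z => - deriv (LFunction χ) z := by
    filter_upwards [hmem] with z hz
    have := (LD_L χ hχ z hz).1.deriv
    rw [this, aL]; ring
  have e1 := heq.iteratedDeriv_eq k
  rw [iteratedDeriv_fun_mul hHan hLan, iteratedDeriv_fun_neg, Finset.sum_range_succ] at e1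
  have e2 : iteratedDeriv k (deriv (LFunction χ)) s = iteratedDeriv (k+1) (LFunction χ) s := by
    rw [iteratedDeriv_succ']
  rw [e2] at e1
  simp only [Nat.choose_self, Nat.cast_one, one_mul, Nat.sub_self, iteratedDeriv_zero] at e1
  have e3 : iteratedDeriv k (LSeries (aL χ)) s * LFunction χ s = 
     -iteratedDeriv (k+1) (LFunction χ) s - ∑ i ∈ range k, (k.choose i : ℂ) * iteratedDeriv i (LSeries (aL χ)) s * iteratedDeriv (k - i) (LFunction χ) s := by
    rw [← e1]; ring
  have b1 : ‖iteratedDeriv k (LSeries (aL χ)) s‖ * ‖LFunction χ s‖ ≤ A * P^2 := by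
    rw [← norm_mul, e3]
    refine (norm_sub_le _ _).trans ?_
    rw [norm_neg]
    have c1 : ‖iteratedDeriv (k+1) (LFunction χ) s‖ ≤ C0 * P^2 := by
      refine (h0 q χ hχ s hs.le hs2).trans ?_
      gcongr
      calc P = P^1 := (pow_one P).symm
        _ ≤ P^2 := pow_le_pow_right₀ hP1 (by norm_num)
    have c2 : ‖∑ i ∈ range k, (k.choose i : ℂ) * iteratedDeriv i (LSeries (aL χ)) s * iteratedDeriv (k - i) (LFunction χ) s‖ ≤ (∑ i ∈ range k, k.choose i * CH i * CL (k - i)) * P^2 := by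
      rw [Finset.sum_mul]
      refine (norm_sum_le _ _).trans (Finset.sum_le_sum fun i hi => ?_)
      rw [norm_mul, norm_mul, Complex.norm_natCast]
      have d1 := hH i (Finset.mem_range.1 hi) q χ hχ s hs hs2
      have d2 := hL (k-i) q χ hχ s hs.le hs2
      have := hCH i
      calc _ ≤ (k.choose i : ℝ) * (CH i * P) * (CL (k-i) * P) := by gcongr
        _ = _ := by ring
    rw [hA, add_mul]
    exact add_le_add c1 c2
  have b2 := hlow q χ hχ s hs hs2
  rw [show -(16*(δ/48)) = -(δ/3) by ring, Real.rpow_neg hQ0.le] at b2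
  have b3 : Q^δ = P^3 := by
    rw [hP, ← Real.rpow_natCast, ← Real.rpow_mul hQ0.le]; congr 1; push_cast; ring
  rw [b3]
  set X := ‖iteratedDeriv k (LSeries (aL χ)) s‖ with hX
  have hX0 : 0 ≤ X := norm_nonneg _
  have b4 : X * (c * P⁻¹) ≤ A * P^2 := le_trans (by gcongr) b1
  have hP0 : 0 < P := by linarith
  have : X = X * (c * P⁻¹) * (P / c) := by field_simp
  rw [this]
  calc _ ≤ A * P^2 * (P/c) := by gcongr
    _ = _ := by ring

/-- Dirichlet series with coefficients `χ Λ log^k` -/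
noncomputable def aLk {q : ℕ} (k : ℕ) (χ : DirichletCharacter ℂ q) : ℕ → ℂ := LSeries.logMul^[k] (aL χ)

lemma aLk_apply {q : ℕ} (k : ℕ) (χ : DirichletCharacter ℂ q) (n : ℕ) : aLk k χ n = χ n * vonMangoldt n * (Real.log n : ℂ)^k := by
  rw [aLk]
  induction k with
  | zero => simp [aL]
  | succ k ih =>
    rw [Function.iterate_succ_apply', LSeries.logMul, ih, pow_succ, Complex.natCast_log]; ring

lemma G_growth (k : ℕ) (δ : ℝ) (hδ : 0 < δ) : ∃ C : ℝ, 0 < C ∧ ∀ (q : ℕ) [NeZero q] (χ : DirichletCharacter ℂ q), χ ≠ 1 →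
    ∀ s : ℂ, 1 < s.re → s.re ≤ 2 → LSeriesSummable (aLk k χ) s ∧ ‖LSeries (aLk k χ) s‖ ≤ C * Qs q s ^ δ := by
  obtain ⟨C, hC, h⟩ := H_growth k δ hδ
  refine ⟨C, hC, fun q _ χ hχ s hs hs2 => ⟨?_, ?_⟩⟩
  · apply LSeriesSummable_of_abscissaOfAbsConv_lt_re
    rw [aLk, LSeries.absicssaOfAbsConv_logPowMul]
    exact aL_lt χ hs
  · have := h q χ hχ s hs hs2
    rw [LSeries_iteratedDeriv _ (aL_lt χ hs), norm_mul, norm_pow, norm_neg, norm_one, one_pow, one_mul] at this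
    exact this
end SW
end

section
open DirichletCharacter Finset ArithmeticFunction

namespace SW
open MeasureTheory

noncomputable def PK (s : ℂ) : ℂ := 1/s - 1/(s+1)

noncomputable def fR (t : ℝ) : ℂ := Set.indicator (Set.Ioc 0 1) (fun _ => 1 : ℝ → ℂ) t - Set.indicator (Set.Ioc 0 1) (fun t => (t:ℂ)^(1:ℂ) : ℝ → ℂ) t

lemma fR_eq {t : ℝ} (ht : 0 < t) : fR t = ((max (1-t) 0 : ℝ):ℂ) := by
  rw [fR]
  by_cases h : t ≤ 1
  · rw [Set.indicator_of_mem (show t ∈ Set.Ioc 0 1 from ⟨ht, h⟩), Set.indicator_of_mem (show t ∈ Set.Ioc 0 1 from ⟨ht, h⟩), max_eq_left (by linarith)]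
    simp
  · rw [Set.indicator_of_notMem (fun h' => h h'.2), Set.indicator_of_notMem (fun h' => h h'.2), max_eq_right (by linarith)]
    simp

lemma fR_mellin {s : ℂ} (hs : 0 < s.re) : HasMellin fR s (PK s) := by
  have h1 := hasMellin_one_Ioc hs
  have h2 := hasMellin_cpow_Ioc (1:ℂ) (s := s) (by simp; linarith)
  have := hasMellin_sub h1.1 h2.1
  rw [h1.2, h2.2] at this
  exact this

lemma PK_bound {σ : ℝ} (hσ : 1 ≤ σ) (y : ℝ) : ‖PK (σ + y * Complex.I)‖ ≤ 2 * ((1+|y|)^2)⁻¹ := by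
  set s : ℂ := σ + y * Complex.I with hs
  have hre : s.re = σ := by simp [hs]
  have him : s.im = y := by simp [hs]
  have hs0 : s ≠ 0 := by intro h; rw [h] at hre; simp at hre; linarith
  have hs1 : s + 1 ≠ 0 := by
    intro h
    have := congrArg Complex.re h
    simp [hre] at this; linarith
  have e : PK s = (s * (s+1))⁻¹ := by rw [PK]; field_simp; ring
  rw [e, norm_inv, norm_mul]
  have h1 : (1+|y|)^2/2 ≤ ‖s‖^2 := by
    rw [← Complex.normSq_eq_norm_sq, Complex.normSq_apply, hre, him]
    nlinarith [sq_abs y, sq_nonneg (|y|-1)]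
  have h2 : ‖s‖ ≤ ‖s+1‖ := by
    rw [Complex.norm_def, Complex.norm_def]
    refine Real.sqrt_le_sqrt ?_
    rw [Complex.normSq_apply, Complex.normSq_apply]
    simp only [Complex.add_re, Complex.add_im, Complex.one_re, Complex.one_im, hre, him]
    nlinarith
  have h3 : (1+|y|)^2/2 ≤ ‖s‖ * ‖s+1‖ := by nlinarith [norm_nonneg s]
  calc (‖s‖ * ‖s+1‖)⁻¹ ≤ ((1+|y|)^2/2)⁻¹ := by gcongr
    _ = _ := by field_simp

lemma PK_cont {σ : ℝ} (hσ : 1 ≤ σ) : Continuous fun y : ℝ => PK (σ + y * Complex.I) := by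
  unfold PK
  have hc : Continuous fun y : ℝ => (σ + y * Complex.I : ℂ) := by fun_prop
  refine Continuous.sub ?_ ?_
  · refine continuous_const.div hc fun y h => ?_
    have := congrArg Complex.re h
    simp at this; linarith
  · refine continuous_const.div (hc.add continuous_const) fun y h => ?_
    have := congrArg Complex.re h
    simp at this; linarith

lemma int_sq : Integrable fun y : ℝ => 2 * ((1+|y|)^2)⁻¹ := by
  have := integrable_one_add_norm (E := ℝ) (μ := volume) (r := 2) (by simp)
  refine (this.const_mul 2).congr (Filter.Eventually.of_forall fun y => ?_)
  simp only [Real.norm_eq_abs]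
  rw [Real.rpow_neg (by positivity)]; norm_cast

lemma int_half : Integrable fun y : ℝ => (1+|y|)^(-(3/2:ℝ)) := by
  have := integrable_one_add_norm (E := ℝ) (μ := volume) (r := 3/2) (by simp; norm_num)
  exact this

lemma PK_int {σ : ℝ} (hσ : 1 ≤ σ) : Integrable fun y : ℝ => PK (σ + y * Complex.I) :=
  int_sq.mono' (PK_cont hσ).aestronglyMeasurable (Filter.Eventually.of_forall fun y => PK_bound hσ y)

lemma perr {σ x : ℝ} (hσ : 1 ≤ σ) (hx : 0 < x) :
    ∫ y : ℝ, (x:ℂ)^(-(σ + y * Complex.I)) * PK (σ + y * Complex.I) = 2 * Real.pi * ((max (1-x) 0 : ℝ):ℂ) := by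
  have hm : ∀ y : ℝ, mellin fR (σ + y * Complex.I) = PK (σ + y * Complex.I) := fun y =>
    (fR_mellin (by simp; linarith)).2
  have h := mellinInv_mellin_eq σ fR hx (fR_mellin (by simp; linarith)).1 (by
    refine (PK_int hσ).congr (Filter.Eventually.of_forall fun y => (hm y).symm)) (by
    have : fR =ᶠ[nhds x] fun t => ((max (1-t) 0 : ℝ):ℂ) := by
      filter_upwards [lt_mem_nhds hx] with t ht using fR_eq ht
    refine ContinuousAt.congr ?_ this.symm
    have : Continuous fun t : ℝ => ((max (1-t) 0 : ℝ):ℂ) := by fun_prop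
    exact this.continuousAt)
  rw [fR_eq hx, mellinInv] at h
  simp only [hm, smul_eq_mul] at h
  rw [← h, Complex.real_smul]
  push_cast
  have : (Real.pi:ℂ) ≠ 0 := by exact_mod_cast Real.pi_ne_zero
  rw [← mul_assoc, mul_one_div_cancel (by simpa using this), one_mul]

lemma cpow_norm {x : ℝ} (hx : 0 < x) (σ y : ℝ) : ‖(x:ℂ)^(-(σ + y * Complex.I : ℂ))‖ = x^(-σ) := by
  rw [Complex.norm_cpow_eq_rpow_re_of_pos hx]; simp

lemma riesz_bound : ∃ C : ℝ, 0 < C ∧ ∀ (a : ℕ → ℂ) (σ z M : ℝ), a 0 = 0 → 1 ≤ σ → 0 < z → 0 ≤ M → LSeriesSummable a σ →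
    (∀ y : ℝ, ‖LSeries a (σ + y * Complex.I)‖ ≤ M * (|y|+2)^(1/2:ℝ)) →
    ‖∑' n : ℕ, a n * ((max (1-n/z) 0 : ℝ):ℂ)‖ ≤ C * z^σ * M := by
  set I0 := ∫ y : ℝ, (1+|y|)^(-(3/2:ℝ)) with hI0
  have hI00 : 0 ≤ I0 := integral_nonneg fun y => by positivity
  refine ⟨4 * I0 + 1, by positivity, fun a σ z M ha0 hσ hz hM hsum hbd => ?_⟩
  set F : ℕ → ℝ → ℂ := fun n y => a n * (((n/z : ℝ):ℂ)^(-(σ + y * Complex.I)) * PK (σ + y * Complex.I)) with hF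
  have hFint : ∀ n, Integrable (F n) := by
    intro n
    rcases Nat.eq_zero_or_pos n with rfl | hn
    · simp only [hF, ha0, zero_mul]; exact integrable_zero _ _ _
    have hx : 0 < (n/z : ℝ) := by positivity
    have hc : Continuous fun y : ℝ => ((n/z : ℝ):ℂ)^(-(σ + y * Complex.I)) := by
      refine Continuous.const_cpow (by fun_prop) (Or.inl ?_)
      exact_mod_cast hx.ne'
    refine Integrable.const_mul ?_ _
    refine (PK_int hσ).bdd_mul (c := (n/z:ℝ)^(-σ)) hc.aestronglyMeasurable (Filter.Eventually.of_forall fun y => (cpow_norm hx σ y).le)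
  set J := ∫ y : ℝ, ‖PK (σ + y * Complex.I)‖ with hJ
  have hnorm : ∀ n, ∫ y, ‖F n y‖ = ‖LSeries.term a σ n‖ * (z^σ * J) := by
    intro n
    rcases Nat.eq_zero_or_pos n with rfl | hn
    · simp [hF, ha0]
    have hx : 0 < (n/z : ℝ) := by positivity
    have : ∀ y, ‖F n y‖ = (‖a n‖ * (n/z:ℝ)^(-σ)) * ‖PK (σ + y * Complex.I)‖ := by
      intro y
      rw [hF]; simp only [norm_mul]
      rw [cpow_norm hx]; ring
    simp_rw [this]
    rw [integral_const_mul, LSeries.term_of_ne_zero hn.ne', norm_div, Complex.norm_natCast_cpow_of_pos hn,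
      Real.div_rpow (by positivity) hz.le, Real.rpow_neg (by positivity), Real.rpow_neg hz.le, Complex.ofReal_re]
    field_simp
    rw [← hJ]
  have hs := hasSum_integral_of_summable_integral_norm hFint (by
    simp_rw [hnorm]
    exact hsum.norm.mul_right _)
  have hinteg : ∀ n, ∫ y, F n y = 2 * Real.pi * (a n * ((max (1-n/z) 0 : ℝ):ℂ)) := by
    intro n
    rcases Nat.eq_zero_or_pos n with rfl | hn
    · simp [hF, ha0]
    have hx : 0 < (n/z : ℝ) := by positivity
    simp only [hF]
    rw [integral_const_mul, perr hσ hx]; ring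
  simp_rw [hinteg] at hs
  have hs2 := hs.tsum_eq
  rw [tsum_mul_left] at hs2
  have hpt : ∀ y, ∑' n, F n y = ((z⁻¹:ℝ):ℂ)^(-(σ + y * Complex.I)) * PK (σ + y * Complex.I) * LSeries a (σ + y * Complex.I) := by
    intro y
    rw [LSeries, ← tsum_mul_left]
    refine tsum_congr fun n => ?_
    rcases Nat.eq_zero_or_pos n with rfl | hn
    · simp [hF, ha0]
    rw [LSeries.term_of_ne_zero hn.ne']
    simp only [hF]
    rw [div_eq_mul_inv, Complex.ofReal_mul, Complex.mul_cpow_ofReal_nonneg (by positivity) (by positivity),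
      Complex.ofReal_natCast, Complex.cpow_neg (n:ℂ)]
    ring
  simp_rw [hpt] at hs2
  have hfin : ‖∫ y : ℝ, ((z⁻¹:ℝ):ℂ)^(-(σ + y * Complex.I)) * PK (σ + y * Complex.I) * LSeries a (σ + y * Complex.I)‖ ≤ ∫ y : ℝ, (4 * z^σ * M) * (1+|y|)^(-(3/2:ℝ)) := by
    refine norm_integral_le_of_norm_le (int_half.const_mul _) (Filter.Eventually.of_forall fun y => ?_)
    rw [norm_mul, norm_mul, cpow_norm (by positivity)]
    have h1 := PK_bound hσ y
    have h2 := hbd y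
    have h3 : (z⁻¹)^(-σ) = z^σ := by rw [Real.rpow_neg (by positivity), Real.inv_rpow hz.le, inv_inv]
    rw [h3]
    have hy : 0 < 1 + |y| := by positivity
    have h4 : (|y|+2)^(1/2:ℝ) ≤ 2 * (1+|y|)^(1/2:ℝ) := by
      calc (|y|+2)^(1/2:ℝ) ≤ (4*(1+|y|))^(1/2:ℝ) := by gcongr; linarith [abs_nonneg y]
        _ = _ := by
          rw [Real.mul_rpow (by norm_num) hy.le]
          congr 1
          rw [show (4:ℝ) = 2^(2:ℝ) by norm_num, ← Real.rpow_mul (by norm_num)]; norm_num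
    have h5 : (1+|y|)^(-(3/2:ℝ)) = ((1+|y|)^2)⁻¹ * (1+|y|)^(1/2:ℝ) := by
      rw [show -(3/2:ℝ) = -2 + 1/2 by norm_num, Real.rpow_add hy, Real.rpow_neg hy.le]; norm_cast
    calc z^σ * ‖PK (σ + y * Complex.I)‖ * ‖LSeries a (σ + y * Complex.I)‖ 
        ≤ z^σ * (2 * ((1+|y|)^2)⁻¹) * (M * (2 * (1+|y|)^(1/2:ℝ))) := by
          gcongr
          exact h2.trans (by gcongr)
      _ = _ := by rw [h5]; ring
  rw [integral_const_mul, ← hI0, ← hs2, norm_mul] at hfin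
  have hpi : ‖(2 * Real.pi : ℂ)‖ = 2 * Real.pi := by
    rw [norm_mul, Complex.norm_real]; simp [Real.pi_pos.le]
  rw [hpi] at hfin
  set N := ‖∑' n : ℕ, a n * ((max (1-n/z) 0 : ℝ):ℂ)‖ with hN
  have hN0 : 0 ≤ N := norm_nonneg _
  have hz0 : 0 ≤ z^σ * M := by positivity
  have : N ≤ 2 * Real.pi * N := by nlinarith [Real.pi_gt_three]
  have : (4 * I0 + 1) * z^σ * M = 4 * z^σ * M * I0 + z^σ * M := by ring
  linarith
end SW
end

section
open DirichletCharacter Finset ArithmeticFunction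

namespace SW

lemma log_pow_le (B : ℕ) (δ : ℝ) (hδ : 0 < δ) : ∃ C : ℝ, 0 < C ∧ ∀ x : ℝ, 1 ≤ x → (Real.log x)^B ≤ C * x^δ := by
  set e := δ/(B+1) with he
  have he0 : 0 < e := by positivity
  refine ⟨(e⁻¹)^B, by positivity, fun x hx => ?_⟩
  have h1 := Real.log_le_rpow_div (x := x) (by linarith) he0
  have h0 : 0 ≤ Real.log x := Real.log_nonneg hx
  calc (Real.log x)^B ≤ (x^e/e)^B := by gcongr
    _ = (e⁻¹)^B * x^(e*B) := by
      rw [div_eq_inv_mul, mul_pow, ← Real.rpow_natCast (x^e), ← Real.rpow_mul (by linarith)]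
    _ ≤ _ := by
      gcongr
      rw [he, div_mul_eq_mul_div, div_le_iff₀ (by positivity)]; nlinarith

lemma abel_bound {a : ℕ → ℂ} {w : ℕ → ℝ} {E : ℝ} (n : ℕ) (hw0 : ∀ i < n, 0 ≤ w i) (hw : ∀ i, i + 1 < n → w (i+1) ≤ w i)
    (hE : ∀ j ≤ n, ‖∑ i ∈ range j, a i‖ ≤ E) (hE0 : 0 ≤ E) : n ≠ 0 → ‖∑ i ∈ range n, (w i : ℂ) * a i‖ ≤ E * w 0 := by
  intro hn
  have := Finset.sum_range_by_parts (fun i => (w i : ℂ)) a n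
  simp only [smul_eq_mul] at this
  rw [this]
  refine (norm_sub_le _ _).trans ?_
  have h1 : ‖(w (n-1) : ℂ) * ∑ i ∈ range n, a i‖ ≤ w (n-1) * E := by
    rw [norm_mul, Complex.norm_real, Real.norm_eq_abs, abs_of_nonneg (hw0 _ (by omega))]
    exact mul_le_mul_of_nonneg_left (hE n le_rfl) (hw0 _ (by omega))
  have h2 : ‖∑ i ∈ range (n-1), ((w (i+1) : ℂ) - w i) * ∑ j ∈ range (i+1), a j‖ ≤ ∑ i ∈ range (n-1), (w i - w (i+1)) * E := by
    refine (norm_sum_le _ _).trans (Finset.sum_le_sum fun i hi => ?_)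
    have hi : i < n - 1 := Finset.mem_range.1 hi
    rw [norm_mul, ← Complex.ofReal_sub, Complex.norm_real, Real.norm_eq_abs, abs_of_nonpos (by linarith [hw i (by omega)])]
    have := hw i (by omega)
    rw [neg_sub]
    exact mul_le_mul_of_nonneg_left (hE _ (by omega)) (by linarith)
  rw [← Finset.sum_mul, Finset.sum_range_sub'] at h2
  linarith

lemma aLk_norm {q : ℕ} (k : ℕ) (χ : DirichletCharacter ℂ q) {n : ℕ} (hn : 1 ≤ n) : ‖aLk k χ n‖ ≤ (Real.log n)^(k+1) := by
  have hl : 0 ≤ Real.log n := Real.log_natCast_nonneg n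
  rw [aLk_apply, norm_mul, norm_mul, norm_pow, Complex.norm_real, Complex.norm_real, Real.norm_eq_abs, Real.norm_eq_abs,
    abs_of_nonneg hl, abs_of_nonneg vonMangoldt_nonneg]
  calc _ ≤ 1 * Real.log n * Real.log n ^ k := by
        gcongr
        · exact DirichletCharacter.norm_le_one _ _
        · exact vonMangoldt_le_log
    _ = _ := by ring

lemma T_bound (k : ℕ) : ∃ C : ℝ, 0 < C ∧ ∀ (q : ℕ) [NeZero q] (χ : DirichletCharacter ℂ q), χ ≠ 1 → ∀ m : ℕ, 3 ≤ m →
    ‖∑ n ∈ range m, aLk k χ n * ((m - n : ℝ) : ℂ)‖ ≤ C * q * (m:ℝ)^2 := by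
  obtain ⟨C1, hC1, h1⟩ := riesz_bound
  obtain ⟨C2, hC2, h2⟩ := G_growth k (1/2) (by norm_num)
  refine ⟨C1 * Real.exp 1 * C2, by positivity, fun q _ χ hχ m hm => ?_⟩
  have hm3 : (3:ℝ) ≤ m := by exact_mod_cast hm
  have hm0 : (0:ℝ) < m := by linarith
  have hl : 1 ≤ Real.log m := by
    rw [Real.le_log_iff_exp_le hm0]
    linarith [Real.exp_one_lt_d9]
  set σ := 1 + 1/Real.log m with hσ
  have hσ1 : 1 < σ := by rw [hσ]; have : 0 < 1/Real.log m := by positivity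
                         linarith
  have hσ2 : σ ≤ 2 := by
    have : 1/Real.log m ≤ 1 := by rw [div_le_iff₀ (by linarith)]; linarith
    linarith
  have hq1 : (1:ℝ) ≤ q := by exact_mod_cast NeZero.one_le
  have hzs : (m:ℝ)^σ = m * Real.exp 1 := by
    rw [hσ, Real.rpow_add hm0, Real.rpow_one, Real.rpow_def_of_pos hm0]
    congr 2; field_simp
  have h3 := h1 (aLk k χ) σ m (C2 * (q:ℝ)^(1/2:ℝ)) (by rw [aLk_apply]; simp) hσ1.le hm0 (by positivity)
    (h2 q χ hχ σ (by simpa using hσ1) (by simpa using hσ2)).1 (by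
      intro y
      have hre : (σ + y * Complex.I : ℂ).re = σ := by simp
      have him : (σ + y * Complex.I : ℂ).im = y := by simp
      refine (h2 q χ hχ (σ + y * Complex.I) (by rw [hre]; exact hσ1) (by rw [hre]; exact hσ2)).2.trans (le_of_eq ?_)
      rw [Qs, him, Real.mul_rpow (by positivity) (by positivity)]; ring)
  rw [hzs, tsum_eq_sum (s := range m) (by
    intro n hn
    have : m ≤ n := by simpa using hn
    have : (1:ℝ) ≤ n/m := by rw [le_div_iff₀ hm0]; rw [one_mul]; exact_mod_cast this
    rw [max_eq_right (by linarith)]; simp)] at h3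
  have e : ∑ n ∈ range m, aLk k χ n * ((m - n : ℝ) : ℂ) = (m:ℂ) * ∑ n ∈ range m, aLk k χ n * ((max (1 - n/m) 0 : ℝ):ℂ) := by
    rw [Finset.mul_sum]
    refine Finset.sum_congr rfl fun n hn => ?_
    have hn : n ≤ m := (Finset.mem_range.1 hn).le
    have : (n:ℝ)/m ≤ 1 := by rw [div_le_iff₀ hm0]; rw [one_mul]; exact_mod_cast hn
    rw [max_eq_left (by linarith)]
    push_cast
    have : (m:ℂ) ≠ 0 := by exact_mod_cast hm0.ne'
    field_simp
  rw [e, norm_mul, Complex.norm_natCast]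
  have hqh : (q:ℝ)^(1/2:ℝ) ≤ q := by
    calc (q:ℝ)^(1/2:ℝ) ≤ (q:ℝ)^(1:ℝ) := Real.rpow_le_rpow_of_exponent_le hq1 (by norm_num)
      _ = q := Real.rpow_one _
  calc _ ≤ (m:ℝ) * (C1 * (m * Real.exp 1) * (C2 * (q:ℝ)^(1/2:ℝ))) := by gcongr
    _ ≤ (m:ℝ) * (C1 * (m * Real.exp 1) * (C2 * q)) := by gcongr
    _ = _ := by ring

lemma A_bound (B : ℕ) : ∃ C : ℝ, 0 < C ∧ ∀ (q : ℕ) [NeZero q] (χ : DirichletCharacter ℂ q), χ ≠ 1 → ∀ m : ℕ, 3 ≤ m →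
    ‖∑ n ∈ range m, aLk (2*B+1) χ n‖ ≤ C * q * m * (Real.log m)^(B+1) := by
  set k := 2*B+1 with hk
  obtain ⟨C1, hC1, h1⟩ := T_bound k
  obtain ⟨C2, hC2, h2⟩ := log_pow_le (B+1) 1 one_pos
  refine ⟨5*C1 + (1+C2)*2^(k+1), by positivity, fun q _ χ hχ m hm => ?_⟩
  have hm3 : (3:ℝ) ≤ m := by exact_mod_cast hm
  have hm0 : (0:ℝ) < m := by linarith
  have hl : 1 ≤ Real.log m := by
    rw [Real.le_log_iff_exp_le hm0]
    linarith [Real.exp_one_lt_d9]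
  have hq1 : (1:ℝ) ≤ q := by exact_mod_cast NeZero.one_le
  set l := Real.log m with hl'
  have hl0 : 0 < l := by linarith
  have hlB : 1 ≤ l^(B+1) := one_le_pow₀ hl
  have h2' : l^(B+1) ≤ C2 * m := by simpa using h2 m (by linarith)
  set h : ℕ := ⌈(m:ℝ)/l^(B+1)⌉₊ with hh
  have hh1 : (m:ℝ)/l^(B+1) ≤ h := Nat.le_ceil _
  have hh0 : (0:ℝ) < h := lt_of_lt_of_le (by positivity) hh1
  have hhm : h ≤ m := by
    rw [hh, Nat.ceil_le]
    exact div_le_self hm0.le hlB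
  have hhm' : (h:ℝ) ≤ m := by exact_mod_cast hhm
  have hh2 : (h:ℝ) ≤ (1+C2) * (m/l^(B+1)) := by
    have := (Nat.ceil_lt_add_one (a := (m:ℝ)/l^(B+1)) (by positivity)).le
    have h3 : 1 ≤ C2 * (m/l^(B+1)) := by
      rw [mul_div_assoc', le_div_iff₀ (by positivity)]; linarith
    linarith
  have t1 := h1 q χ hχ m hm
  have t2 := h1 q χ hχ (m+h) (by omega)
  have id : ∑ n ∈ range (m+h), aLk k χ n * (((m+h:ℕ) - n : ℝ) : ℂ) - ∑ n ∈ range m, aLk k χ n * ((m - n : ℝ) : ℂ)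
      = (h:ℂ) * ∑ n ∈ range m, aLk k χ n + ∑ i ∈ range h, aLk k χ (m+i) * ((h - i : ℝ) : ℂ) := by
    rw [Finset.sum_range_add, Finset.mul_sum]
    rw [add_sub_right_comm, ← Finset.sum_sub_distrib]
    congr 1
    · refine Finset.sum_congr rfl fun n _ => ?_
      push_cast; ring
    · refine Finset.sum_congr rfl fun n _ => ?_
      push_cast; ring
  have t3 : ‖∑ i ∈ range h, aLk k χ (m+i) * ((h - i : ℝ) : ℂ)‖ ≤ h * (h * (2*l)^(k+1)) := by
    refine (norm_sum_le _ _).trans ?_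
    have : ∀ i ∈ range h, ‖aLk k χ (m+i) * ((h - i : ℝ) : ℂ)‖ ≤ h * (2*l)^(k+1) := by
      intro i hi
      have hi : i < h := Finset.mem_range.1 hi
      have hi' : (i:ℝ) ≤ h := by exact_mod_cast hi.le
      rw [norm_mul, Complex.norm_real, Real.norm_eq_abs, abs_of_nonneg (by linarith), mul_comm]
      have a1 := aLk_norm k χ (n := m+i) (by omega)
      have a2 : Real.log (m+i:ℕ) ≤ 2*l := by
        rw [hl', show 2 * Real.log m = Real.log ((m:ℝ)^2) by rw [Real.log_pow]; norm_num]
        refine Real.log_le_log (by exact_mod_cast (by omega : 0 < m + i)) ?_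
        push_cast; nlinarith
      have a3 : 0 ≤ Real.log (m+i:ℕ) := Real.log_natCast_nonneg _
      have i0 : (0:ℝ) ≤ i := by positivity
      gcongr
      · linarith
      · exact a1.trans (by gcongr)
    refine (Finset.sum_le_sum this).trans ?_
    simp
  set A := ∑ n ∈ range m, aLk k χ n with hA
  have t4 : (h:ℝ) * ‖A‖ ≤ C1 * q * ((m+h:ℕ):ℝ)^2 + C1 * q * (m:ℝ)^2 + h * (h * (2*l)^(k+1)) := by
    have e : (h:ℂ) * A = (∑ n ∈ range (m+h), aLk k χ n * (((m+h:ℕ) - n : ℝ) : ℂ) - ∑ n ∈ range m, aLk k χ n * ((m - n : ℝ) : ℂ)) - ∑ i ∈ range h, aLk k χ (m+i) * ((h - i : ℝ) : ℂ) := by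
      rw [id]; ring
    have : (h:ℝ) * ‖A‖ = ‖(h:ℂ) * A‖ := by rw [norm_mul, Complex.norm_natCast]
    rw [this, e]
    refine (norm_sub_le _ _).trans (add_le_add ((norm_sub_le _ _).trans (add_le_add t2 t1)) t3)
  have t5 : C1 * q * ((m+h:ℕ):ℝ)^2 + C1 * q * (m:ℝ)^2 ≤ 5 * C1 * q * m^2 := by
    have : ((m+h:ℕ):ℝ)^2 ≤ 4 * (m:ℝ)^2 := by push_cast; nlinarith
    have hcq : 0 < C1 * q := by positivity
    nlinarith
  have t6 : 5 * C1 * q * (m:ℝ)^2 ≤ h * (5 * C1 * q * m * l^(B+1)) := by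
    have : (m:ℝ) ≤ h * l^(B+1) := by rwa [div_le_iff₀ (by positivity)] at hh1
    calc 5 * C1 * q * (m:ℝ)^2 = 5 * C1 * q * m * m := by ring
      _ ≤ 5 * C1 * q * m * (h * l^(B+1)) := by gcongr
      _ = _ := by ring
  have t7 : (h:ℝ) * (2*l)^(k+1) ≤ (1+C2)*2^(k+1) * m * l^(B+1) := by
    calc (h:ℝ) * (2*l)^(k+1) ≤ ((1+C2) * (m/l^(B+1))) * (2*l)^(k+1) := by gcongr
      _ = (1+C2) * m * 2^(k+1) * (l^(k+1)/l^(B+1)) := by rw [mul_pow]; ring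
      _ = (1+C2) * m * 2^(k+1) * l^(B+1) := by
        congr 1
        rw [div_eq_iff (by positivity), ← pow_add]; congr 1; omega
      _ = _ := by ring
  have t8 : (h:ℝ) * ‖A‖ ≤ h * (5 * C1 * q * m * l^(B+1) + (1+C2)*2^(k+1) * m * l^(B+1)) := by
    have : (h:ℝ) * (h * (2*l)^(k+1)) ≤ h * ((1+C2)*2^(k+1) * m * l^(B+1)) := by gcongr
    linarith
  have t9 := le_of_mul_le_mul_left t8 hh0
  refine t9.trans ?_
  have : (1+C2)*2^(k+1) * m * l^(B+1) * 1 ≤ (1+C2)*2^(k+1) * m * l^(B+1) * q := by gcongr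
  have e : (5*C1 + (1+C2)*2^(k+1)) * q * m * l^(B+1) = 5 * C1 * q * m * l^(B+1) + (1+C2)*2^(k+1) * m * l^(B+1) * q := by ring
  linarith
end SW
end

section
open DirichletCharacter Finset ArithmeticFunction

namespace SW

lemma SWp (B : ℕ) : ∃ C : ℝ, 0 < C ∧ ∀ (q : ℕ) [NeZero q] (χ : DirichletCharacter ℂ q), χ ≠ 1 → ∀ m : ℕ, 3 ≤ m →
    ‖∑ p ∈ range m with p.Prime, χ p‖ ≤ C * q * m / (Real.log m)^(B+1) := by
  set k := 2*B+1 with hk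
  obtain ⟨C1, hC1, h1⟩ := A_bound B
  obtain ⟨C2, hC2, h2⟩ := log_pow_le (B+2) (1/2) (by norm_num)
  refine ⟨2^(k+2) * C1 + 6*C2, by positivity, fun q _ χ hχ m hm => ?_⟩
  have hm3 : (3:ℝ) ≤ m := by exact_mod_cast hm
  have hm0 : (0:ℝ) < m := by linarith
  have hl : 1 ≤ Real.log m := by
    rw [Real.le_log_iff_exp_le hm0]
    linarith [Real.exp_one_lt_d9]
  have hq1 : (1:ℝ) ≤ q := by exact_mod_cast NeZero.one_le
  set l := Real.log m with hl'
  have hl0 : 0 < l := by linarith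
  set b : ℕ → ℂ := fun n => χ n * ((vonMangoldt n / Real.log n : ℝ) : ℂ) with hb
  have hvm : ∀ n : ℕ, n < 2 → vonMangoldt n = 0 := by
    intro n hn; interval_cases n <;> simp
  have hlogn : ∀ n : ℕ, 2 ≤ n → 1/2 ≤ Real.log n := by
    intro n hn
    have : Real.log 2 ≤ Real.log n := Real.log_le_log (by norm_num) (by exact_mod_cast hn)
    linarith [Real.log_two_gt_d9]
  have hb1 : ∀ n, ‖b n‖ ≤ vonMangoldt n / Real.log n := by
    intro n
    have h0 : 0 ≤ vonMangoldt n / Real.log n := div_nonneg vonMangoldt_nonneg (Real.log_natCast_nonneg n)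
    rw [hb]; simp only [norm_mul]
    rw [Complex.norm_real, Real.norm_eq_abs, abs_of_nonneg h0]
    exact mul_le_of_le_one_left h0 (DirichletCharacter.norm_le_one _ _)
  have hb2 : ∀ n, ‖b n‖ ≤ 1 := fun n => (hb1 n).trans (div_le_one_of_le₀ vonMangoldt_le_log (Real.log_natCast_nonneg n))
  have hb3 : ∀ n, ‖b n‖ ≤ 2 * vonMangoldt n := by
    intro n
    rcases lt_or_ge n 2 with h | h
    · have := hb1 n
      rw [hvm n h] at this ⊢
      simpa using this
    · refine (hb1 n).trans ?_
      have := hlogn n h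
      rw [div_le_iff₀ (by linarith)]
      nlinarith [vonMangoldt_nonneg (n := n)]
  set w : ℕ → ℝ := fun n => ((Real.log n)^(k+1))⁻¹ with hw
  have hbw : ∀ n, 2 ≤ n → b n = (w n : ℂ) * aLk k χ n := by
    intro n hn
    have h0 := hlogn n hn
    have : (Real.log n : ℂ) ≠ 0 := by exact_mod_cast (by linarith : (0:ℝ) < Real.log n).ne'
    rw [aLk_apply, hb, hw]
    simp only [Complex.ofReal_inv, Complex.ofReal_pow, Complex.ofReal_div]
    field_simp
    ring
  have hA : ∀ j ≤ m, ‖∑ n ∈ range j, aLk k χ n‖ ≤ C1 * q * m * l^(B+1) := by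
    intro j hj
    rcases lt_or_ge j 3 with h | h
    · have : ∑ n ∈ range j, aLk k χ n = 0 := Finset.sum_eq_zero fun n hn => by
        have : n < 2 := by have := Finset.mem_range.1 hn; omega
        rw [aLk_apply, hvm n this]; simp
      rw [this, norm_zero]; positivity
    · refine (h1 q χ hχ j h).trans ?_
      have hj0 : (0:ℝ) < j := by exact_mod_cast (by omega : 0 < j)
      have : Real.log j ≤ l := Real.log_le_log hj0 (by exact_mod_cast hj)
      have : 0 ≤ Real.log j := Real.log_natCast_nonneg j
      gcongr
  set D := C1 * q * m * l^(B+1) with hD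
  have hsq1 : 1 < √(m:ℝ) := by rw [Real.lt_sqrt (by norm_num)]; linarith
  have hsqm : √(m:ℝ) * √(m:ℝ) = m := Real.mul_self_sqrt hm0.le
  set M := ⌈√(m:ℝ)⌉₊ with hM
  have hM1 : √(m:ℝ) ≤ M := Nat.le_ceil _
  have hM2 : 2 ≤ M := by
    have : (1:ℝ) < M := by linarith
    exact_mod_cast this
  have hMm : M ≤ m := by
    rw [hM, Nat.ceil_le]; nlinarith
  have hM3 : (M:ℝ) ≤ 2 * √m := by
    have := (Nat.ceil_lt_add_one (a := √(m:ℝ)) (by positivity)).le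
    linarith
  have hlM : l/2 ≤ Real.log M := by
    rw [hl', ← Real.log_sqrt hm0.le]
    exact Real.log_le_log (by linarith) hM1
  have s1 : ‖∑ n ∈ range M, b n‖ ≤ 2 * √m := by
    refine (norm_sum_le _ _).trans ?_
    calc _ ≤ ∑ n ∈ range M, (1:ℝ) := Finset.sum_le_sum fun n _ => hb2 n
      _ = M := by simp
      _ ≤ _ := hM3
  have s2 : ‖∑ i ∈ range (m - M), b (M+i)‖ ≤ 2 * D * w M := by
    have hwM : 0 ≤ w M := by simp only [hw]; have := Real.log_natCast_nonneg M; positivity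
    rcases eq_or_ne (m - M) 0 with h | h
    · rw [h]; simp; positivity
    have := abel_bound (a := fun i => aLk k χ (M+i)) (w := fun i => w (M+i)) (E := 2 * D) (m - M)
      (fun i _ => by simp only [hw]; have := Real.log_natCast_nonneg (M+i); positivity)
      (fun i _ => by
        simp only [hw]
        have := hlogn (M+i) (by omega)
        gcongr
        omega)
      (fun j hj => by
        have e : ∑ i ∈ range j, aLk k χ (M+i) = ∑ n ∈ range (M+j), aLk k χ n - ∑ n ∈ range M, aLk k χ n := by
          rw [Finset.sum_range_add]; ring
        rw [e]
        refine (norm_sub_le _ _).trans ?_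
        linarith [hA (M+j) (by omega), hA M hMm]) (by positivity) h
    rw [Finset.sum_congr rfl (fun i _ => hbw (M+i) (by omega))]
    simpa using this
  have s3 : w M ≤ 2^(k+1) / (l^(B+1) * l^(B+1)) := by
    simp only [hw]
    rw [← one_div, div_le_div_iff₀ (by have := hlogn M hM2; positivity) (by positivity), one_mul, ← mul_pow 2 (Real.log M)]
    calc l^(B+1) * l^(B+1) = l^(k+1) := by rw [← pow_add]; congr 1; omega
      _ ≤ (2 * Real.log M)^(k+1) := by gcongr; linarith
  have s4 : ‖∑ n ∈ range m with ¬ n.Prime, b n‖ ≤ 4 * √m * l := by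
    have c1 := Chebyshev.psi_sub_theta_le (x := (m:ℝ)) (by linarith)
    rw [Chebyshev.psi_sub_theta_eq_sum_not_prime, Nat.floor_natCast] at c1
    refine (norm_sum_le _ _).trans ?_
    calc _ ≤ ∑ n ∈ range m with ¬ n.Prime, 2 * vonMangoldt n := Finset.sum_le_sum fun n _ => hb3 n
      _ = ∑ n ∈ range m with ¬ n.Prime ∧ 0 < n, 2 * vonMangoldt n := by
        rw [← Finset.filter_filter]
        symm
        apply Finset.sum_filter_of_ne
        intro n _ hn
        rcases Nat.eq_zero_or_pos n with rfl | h
        · simp at hn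
        · exact h
      _ ≤ ∑ n ∈ Ioc 0 m with ¬ n.Prime, 2 * vonMangoldt n := by
        refine Finset.sum_le_sum_of_subset_of_nonneg ?_ (fun n _ _ => by have := vonMangoldt_nonneg (n := n); positivity)
        intro n hn
        simp only [Finset.mem_filter, Finset.mem_range, Finset.mem_Ioc] at hn ⊢
        exact ⟨⟨hn.2.2, hn.1.le⟩, hn.2.1⟩
      _ ≤ _ := by rw [← Finset.mul_sum]; linarith
  have s5 : ∑ p ∈ range m with p.Prime, χ p = ∑ p ∈ range m with p.Prime, b p := by
    refine Finset.sum_congr rfl fun p hp => ?_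
    have hp := (Finset.mem_filter.1 hp).2
    have : Real.log p ≠ 0 := by have := hlogn p hp.two_le; linarith
    simp only [hb]
    rw [vonMangoldt_apply_prime hp, div_self this]; simp
  have s6 : ∑ p ∈ range m with p.Prime, χ p = ∑ n ∈ range M, b n + ∑ i ∈ range (m - M), b (M+i) - ∑ n ∈ range m with ¬ n.Prime, b n := by
    rw [s5, ← Finset.sum_range_add, Nat.add_sub_cancel' hMm, ← Finset.sum_filter_add_sum_filter_not (range m) (fun n => n.Prime)]
    ring
  rw [s6]
  refine (norm_sub_le _ _).trans ?_
  have s7 := norm_add_le (∑ n ∈ range M, b n) (∑ i ∈ range (m - M), b (M+i))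
  have hsqr : √(m:ℝ) = (m:ℝ)^(1/2:ℝ) := Real.sqrt_eq_rpow _
  have h3 := h2 m (by linarith)
  rw [← hsqr] at h3
  have s8 : 6 * √m * l ≤ 6 * C2 * m / l^(B+1) := by
    rw [le_div_iff₀ (by positivity)]
    calc 6 * √m * l * l^(B+1) = 6 * √m * l^(B+2) := by ring
      _ ≤ 6 * √m * (C2 * √m) := by gcongr
      _ = 6 * C2 * (√m * √m) := by ring
      _ = _ := by rw [hsqm]
  have s9 : 2 * D * w M ≤ 2^(k+2) * C1 * q * m / l^(B+1) := by
    calc 2 * D * w M ≤ 2 * D * (2^(k+1) / (l^(B+1) * l^(B+1))) := by gcongr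
      _ = _ := by rw [hD]; field_simp; ring
  have s10 : 6 * C2 * m / l^(B+1) ≤ 6 * C2 * q * m / l^(B+1) := by
    have : 6 * C2 * m * 1 ≤ 6 * C2 * m * q := by gcongr
    rw [div_le_div_iff_of_pos_right (by positivity)]; linarith
  have e : (2^(k+2) * C1 + 6*C2) * q * m / l^(B+1) = 2^(k+2) * C1 * q * m / l^(B+1) + 6 * C2 * q * m / l^(B+1) := by ring
  have : 2 * √m ≤ 2 * √m * l := by nlinarith
  have : 6 * √m * l = 2 * √m * l + 4 * √m * l := by ring
  linarith
end SW
end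

section
open DirichletCharacter Finset ArithmeticFunction

namespace SW

lemma prime_eq (B : ℕ) : ∃ C : ℝ, 0 < C ∧ ∀ (q : ℕ) [NeZero q] (g : ZMod q → ℝ), (∀ v, |g v| ≤ 1) → 
    ∀ m1 m2 : ℕ, 3 ≤ m1 → m1 ≤ m2 → q < m1 →
    |∑ p ∈ Ico m1 m2 with p.Prime, g p - (∑ u : (ZMod q)ˣ, g u) / (Nat.totient q) * ((Ico m1 m2).filter Nat.Prime).card| ≤
      C * q^2 * m2 / (Real.log m1)^(B+1) := by
  obtain ⟨C, hC, h⟩ := SWp B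
  refine ⟨2*C, by positivity, fun q _ g hg m1 m2 hm1 hm2 hq => ?_⟩
  have hφ : 0 < Nat.totient q := Nat.totient_pos.2 (NeZero.pos q)
  have hφ' : (0:ℝ) < Nat.totient q := by exact_mod_cast hφ
  have hφc : (Nat.totient q : ℂ) ≠ 0 := by exact_mod_cast hφ.ne'
  set PP := (Ico m1 m2).filter Nat.Prime with hPP
  have hm3 : (3:ℝ) ≤ m1 := by exact_mod_cast hm1
  have hm12 : (m1:ℝ) ≤ m2 := by exact_mod_cast hm2
  have hl : 1 ≤ Real.log m1 := by
    rw [Real.le_log_iff_exp_le (by linarith)]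
    linarith [Real.exp_one_lt_d9]
  have hl2 : Real.log m1 ≤ Real.log m2 := Real.log_le_log (by linarith) hm12
  have hcop : ∀ p ∈ PP, IsUnit ((p:ℕ) : ZMod q) := by
    intro p hp
    obtain ⟨hp1, hp2⟩ := Finset.mem_filter.1 hp
    rw [ZMod.isUnit_iff_coprime]
    rw [hp2.coprime_iff_not_dvd]
    intro hd
    have := Nat.le_of_dvd (NeZero.pos q) hd
    have := (Finset.mem_Ico.1 hp1).1
    omega
  set E := 2 * C * q * m2 / (Real.log m1)^(B+1) with hE
  have hchi : ∀ χ : DirichletCharacter ℂ q, χ ≠ 1 → ‖∑ p ∈ PP, χ p‖ ≤ E := by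
    intro χ hχ
    have e : ∑ p ∈ PP, χ p = ∑ p ∈ range m2 with p.Prime, χ p - ∑ p ∈ range m1 with p.Prime, χ p := by
      rw [hPP, Finset.sum_filter, Finset.sum_filter, Finset.sum_filter, Finset.sum_Ico_eq_sub _ hm2]
    rw [e]
    refine (norm_sub_le _ _).trans ?_
    have a1 := h q χ hχ m2 (by omega)
    have a2 := h q χ hχ m1 hm1
    have b1 : C * q * m2 / (Real.log m2)^(B+1) ≤ C * q * m2 / (Real.log m1)^(B+1) := by gcongr
    have b2 : C * q * m1 / (Real.log m1)^(B+1) ≤ C * q * m2 / (Real.log m1)^(B+1) := by gcongr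
    have : E = C * q * m2 / (Real.log m1)^(B+1) + C * q * m2 / (Real.log m1)^(B+1) := by rw [hE]; ring
    linarith
  have hE0 : 0 ≤ E := by positivity
  -- expansion of g on units
  set gh : DirichletCharacter ℂ q → ℂ := fun χ => (∑ u : (ZMod q)ˣ, (g u : ℂ) * χ ((u:ZMod q)⁻¹)) / Nat.totient q with hgh
  have hexp : ∀ v : ZMod q, IsUnit v → (g v : ℂ) = ∑ χ : DirichletCharacter ℂ q, gh χ * χ v := by
    intro v hv
    simp only [hgh]
    simp_rw [div_mul_eq_mul_div, Finset.sum_mul]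
    rw [← Finset.sum_div, Finset.sum_comm]
    simp_rw [mul_assoc, ← Finset.mul_sum]
    have : ∀ u : (ZMod q)ˣ, ∑ χ : DirichletCharacter ℂ q, χ ((u:ZMod q)⁻¹) * χ v = if (u : ZMod q) = v then (Nat.totient q : ℂ) else 0 := 
      fun u => DirichletCharacter.sum_char_inv_mul_char_eq ℂ u.isUnit v
    simp_rw [this]
    rw [Finset.sum_eq_single hv.unit]
    · simp
    · intro b _ hb
      rw [if_neg, mul_zero]
      intro hbv; apply hb; ext; simp [hbv]
    · simp
  have hghb : ∀ χ, ‖gh χ‖ ≤ 1 := by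
    intro χ
    simp only [hgh]
    rw [norm_div, Complex.norm_natCast, div_le_one hφ']
    refine (norm_sum_le _ _).trans ?_
    calc _ ≤ ∑ u : (ZMod q)ˣ, (1:ℝ) := by
          refine Finset.sum_le_sum fun u _ => ?_
          rw [norm_mul, Complex.norm_real, Real.norm_eq_abs]
          exact mul_le_one₀ (hg _) (norm_nonneg _) (DirichletCharacter.norm_le_one _ _)
      _ = _ := by simp [ZMod.card_units_eq_totient]
  have hsum : ((∑ p ∈ PP, g p : ℝ) : ℂ) = ∑ χ : DirichletCharacter ℂ q, gh χ * ∑ p ∈ PP, χ p := by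
    push_cast
    rw [Finset.sum_congr rfl (fun (p:ℕ) hp => hexp (p : ZMod q) (hcop p hp)), Finset.sum_comm]
    simp_rw [Finset.mul_sum]
  have hone : gh 1 * ∑ p ∈ PP, (1 : DirichletCharacter ℂ q) p = (((∑ u : (ZMod q)ˣ, g u) / (Nat.totient q) * PP.card : ℝ) : ℂ) := by
    rw [Finset.sum_congr rfl (fun (p:ℕ) hp => MulChar.one_apply (hcop p hp))]
    simp only [hgh]
    have : ∀ u : (ZMod q)ˣ, (1 : DirichletCharacter ℂ q) ((u:ZMod q)⁻¹) = 1 := by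
      intro u
      rw [ZMod.inv_coe_unit]
      exact MulChar.one_apply (Units.isUnit _)
    simp_rw [this]
    push_cast
    simp
  rw [← Finset.add_sum_erase _ _ (Finset.mem_univ (1 : DirichletCharacter ℂ q)), hone] at hsum
  have hfin : ‖((∑ p ∈ PP, g p - (∑ u : (ZMod q)ˣ, g u) / (Nat.totient q) * PP.card : ℝ) : ℂ)‖ ≤ Nat.totient q * E := by
    rw [Complex.ofReal_sub, hsum, add_sub_cancel_left]
    refine (norm_sum_le _ _).trans ?_
    calc _ ≤ ∑ χ ∈ univ.erase (1 : DirichletCharacter ℂ q), E := by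
          refine Finset.sum_le_sum fun χ hχ => ?_
          rw [norm_mul]
          calc _ ≤ 1 * E := by
                gcongr
                · exact hghb χ
                · exact hchi χ (Finset.ne_of_mem_erase hχ)
            _ = E := one_mul E
      _ ≤ ∑ χ : DirichletCharacter ℂ q, E := Finset.sum_le_sum_of_subset_of_nonneg (Finset.erase_subset _ _) (fun _ _ _ => hE0)
      _ = _ := by
        rw [Finset.sum_const, nsmul_eq_mul, Finset.card_univ, ← Nat.card_eq_fintype_card, DirichletCharacter.card_eq_totient_of_hasEnoughRootsOfUnity]
  rw [Complex.norm_real, Real.norm_eq_abs] at hfin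
  refine hfin.trans ?_
  have : (Nat.totient q : ℝ) ≤ q := by exact_mod_cast Nat.totient_le q
  calc Nat.totient q * E ≤ q * E := by gcongr
    _ = _ := by rw [hE]; ring
end SW
end

section
open Finset
namespace SW

/-- Averaging operator. -/
noncomputable def TT {A : Type*} [CommRing A] [Fintype A] [DecidableEq A] (R S : ℤ) (h : A → ℝ) (w : A) : ℝ :=
  (∑ v : Aˣ, h (w * (R * (v : A) + S))) / (Fintype.card Aˣ : ℝ)

/-- Iterated prime sums with weights. -/
noncomputable def AA {A : Type*} [CommRing A] (PP : Finset ℕ) (ρ : ℕ → A) (h : A → ℝ) : ℕ → ℕ → A → ℝ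
  | 0, Z, w => if 1 ≤ Z then h w else 0
  | (J+1), Z, w => ∑ P ∈ PP, AA PP ρ h J (Z / P) (w * ρ P)

/-- Iterated prime sums. -/
noncomputable def BB (PP : Finset ℕ) : ℕ → ℕ → ℝ
  | 0, Z => if 1 ≤ Z then 1 else 0
  | (J+1), Z => ∑ P ∈ PP, BB PP J (Z / P)

/-- number of primes of PP dividing n -/
def DD (PP : Finset ℕ) (n : ℕ) : ℕ := (PP.filter (· ∣ n)).card

lemma AA_zero {A : Type*} [CommRing A] (PP : Finset ℕ) (ρ : ℕ → A) (h : A → ℝ) (J : ℕ) (w : A) :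
    AA PP ρ h J 0 w = 0 := by
  induction J generalizing w with
  | zero => simp [AA]
  | succ J ih => simp [AA, ih]

lemma BB_nonneg (PP : Finset ℕ) (J Z : ℕ) : 0 ≤ BB PP J Z := by
  induction J generalizing Z with
  | zero => simp only [BB]; split_ifs <;> norm_num
  | succ J ih => exact Finset.sum_nonneg fun P _ => ih _

lemma TT_le {A : Type*} [CommRing A] [Fintype A] [DecidableEq A] (R S : ℤ) (h : A → ℝ) (hh : ∀ w, |h w| ≤ 1) (w : A) :
    |TT R S h w| ≤ 1 := by
  unfold TT
  have : (0:ℝ) < Fintype.card Aˣ := by exact_mod_cast Fintype.card_pos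
  rw [abs_div, abs_of_pos this, div_le_one this]
  refine (Finset.abs_sum_le_sum_abs _ _).trans ?_
  calc _ ≤ ∑ v : Aˣ, (1:ℝ) := Finset.sum_le_sum fun v _ => hh _
    _ = _ := by simp

lemma TTJ_le {A : Type*} [CommRing A] [Fintype A] [DecidableEq A] (R S : ℤ) (h : A → ℝ) (hh : ∀ w, |h w| ≤ 1) (J : ℕ) (w : A) :
    |(TT R S)^[J] h w| ≤ 1 := by
  induction J generalizing w with
  | zero => exact hh w
  | succ J ih => rw [Function.iterate_succ_apply']; exact TT_le R S _ ih w

lemma natdiv_sum_le (PP : Finset ℕ) (L : ℝ) (hL : ∑ P ∈ PP, (1:ℝ)/P ≤ L) (Z : ℕ) (c : ℝ) (hc : 0 ≤ c) :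
    ∑ P ∈ PP, c * ((Z / P : ℕ) : ℝ) ≤ c * Z * L := by
  calc _ ≤ ∑ P ∈ PP, c * Z * ((1:ℝ)/P) := by
        refine Finset.sum_le_sum fun P _ => ?_
        rw [mul_assoc]
        refine mul_le_mul_of_nonneg_left ?_ hc
        rw [mul_one_div]; exact Nat.cast_div_le
    _ = c * Z * ∑ P ∈ PP, (1:ℝ)/P := by rw [Finset.mul_sum]
    _ ≤ _ := by gcongr

lemma swapB (PP : Finset ℕ) (L η : ℝ) (hL1 : 0 ≤ L) (hη : 0 ≤ η) (hL : ∑ P ∈ PP, (1:ℝ)/P ≤ L)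
    (G : ℕ → ℝ) (μ : ℝ) (hG : ∀ Z : ℕ, |∑ P ∈ PP with P ≤ Z, (G P - μ)| ≤ η * Z) (hPP : ∀ P ∈ PP, 0 < P) (J Z : ℕ) :
    |∑ P ∈ PP, (G P - μ) * BB PP J (Z / P)| ≤ η * Z * L ^ J := by
  induction J generalizing Z with
  | zero =>
    simp only [BB, pow_zero, mul_one]
    refine le_of_eq_of_le (congrArg abs ?_) (hG Z)
    rw [Finset.sum_filter]
    refine Finset.sum_congr rfl fun P hP => ?_
    have : 1 ≤ Z / P ↔ P ≤ Z := Nat.div_pos_iff.trans ⟨fun h => h.2, fun h => ⟨hPP P hP, h⟩⟩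
    simp only [this]
    split_ifs <;> simp
  | succ J ih =>
    simp only [BB]
    simp_rw [Finset.mul_sum]
    rw [Finset.sum_comm]
    refine (Finset.abs_sum_le_sum_abs _ _).trans ?_
    calc _ ≤ ∑ P ∈ PP, (η * L ^ J) * ((Z / P : ℕ) : ℝ) := by
          refine Finset.sum_le_sum fun P _ => ?_
          have := ih (Z / P)
          simp_rw [Nat.div_div_eq_div_mul, mul_comm P, ← Nat.div_div_eq_div_mul] at this
          linarith
      _ ≤ _ := by
          refine (natdiv_sum_le PP L hL Z _ (by positivity)).trans_eq ?_
          ring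

/-- main mixing of prime sums -/
lemma AA_approx {A : Type*} [CommRing A] [Fintype A] [DecidableEq A] (R S : ℤ) (PP : Finset ℕ) (ρ : ℕ → A) (hρ : ∀ P ∈ PP, ρ P = R * (P : A) + S)
    (h : A → ℝ) (hh : ∀ w, |h w| ≤ 1)
    (L η : ℝ) (hL1 : 1 ≤ L) (hη : 0 ≤ η) (hL : ∑ P ∈ PP, (1:ℝ)/P ≤ L) (hPP : ∀ P ∈ PP, 0 < P)
    (HP : ∀ G : A → ℝ, (∀ v, |G v| ≤ 1) → ∀ Z : ℕ,
      |∑ P ∈ PP with P ≤ Z, (G (P : A) - (∑ u : Aˣ, G u) / (Fintype.card Aˣ : ℝ))| ≤ η * Z)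
    (J Z : ℕ) (w : A) :
    |AA PP ρ h J Z w - (TT R S)^[J] h w * BB PP J Z| ≤ J * Z * L ^ J * η := by
  induction J generalizing Z w with
  | zero => simp only [AA, BB]; split_ifs <;> simp
  | succ J ih =>
    simp only [AA, BB]
    rw [Function.iterate_succ_apply']
    set G : A → ℝ := fun v => (TT R S)^[J] h (w * (R * v + S)) with hGdef
    have h1 := swapB PP L η (by linarith) hη hL (fun P => G (P:A)) _ (HP G fun v => TTJ_le R S h hh J _) hPP J Z
    have h2 : |∑ P ∈ PP, (AA PP ρ h J (Z / P) (w * ρ P) - G P * BB PP J (Z / P))| ≤ (J * L ^ J * η) * Z * L := by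
      refine (Finset.abs_sum_le_sum_abs _ _).trans ?_
      refine le_trans ?_ (natdiv_sum_le PP L hL Z _ (by positivity))
      refine Finset.sum_le_sum fun P hP => ?_
      have := ih (Z / P) (w * ρ P)
      rw [hρ P hP] at this ⊢
      linarith
    have h3 : TT R S ((TT R S)^[J] h) w = (∑ u : Aˣ, G u) / (Fintype.card Aˣ : ℝ) := rfl
    rw [h3]
    set μ := (∑ u : Aˣ, G u) / (Fintype.card Aˣ : ℝ)
    have h4 : ∑ P ∈ PP, AA PP ρ h J (Z / P) (w * ρ P) - μ * ∑ P ∈ PP, BB PP J (Z / P)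
      = ∑ P ∈ PP, (AA PP ρ h J (Z / P) (w * ρ P) - G P * BB PP J (Z / P)) + ∑ P ∈ PP, (G P - μ) * BB PP J (Z / P) := by
      rw [Finset.mul_sum, ← Finset.sum_sub_distrib, ← Finset.sum_add_distrib]
      exact Finset.sum_congr rfl fun P _ => by ring
    rw [h4]
    refine (abs_add_le _ _).trans ((add_le_add h2 h1).trans ?_)
    have : η * Z * L ^ J ≤ η * Z * L ^ (J+1) := by
      gcongr
      omega
    push_cast
    rw [pow_succ] at this ⊢
    nlinarith

lemma sum_mult {k : ℕ → ℝ} (X P : ℕ) (hP : 0 < P) :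
    ∑ n ∈ Ioc 0 X with P ∣ n, k n = ∑ m ∈ Ioc 0 (X / P), k (m * P) := by
  symm
  refine Finset.sum_bij (fun m _ => m * P) ?_ ?_ ?_ ?_
  · intro m hm
    simp only [mem_Ioc, mem_filter] at hm ⊢
    exact ⟨⟨Nat.mul_pos hm.1 hP, (Nat.le_div_iff_mul_le hP).1 hm.2⟩, Dvd.intro_left m rfl⟩
  · intro a _ b _ hab
    exact Nat.eq_of_mul_eq_mul_right hP hab
  · intro n hn
    simp only [mem_Ioc, mem_filter] at hn
    obtain ⟨⟨h0, h1⟩, m, rfl⟩ := hn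
    refine ⟨m, ?_, by ring⟩
    simp only [mem_Ioc]
    exact ⟨Nat.pos_of_mul_pos_left h0, (Nat.le_div_iff_mul_le hP).2 (by linarith [mul_comm m P])⟩
  · intros; rfl

lemma DD_mul (PP : Finset ℕ) (hPP : ∀ P ∈ PP, P.Prime) (m P : ℕ) (hP : P ∈ PP) (h : ¬ P ∣ m) :
    DD PP (m * P) = DD PP m + 1 := by
  unfold DD
  have : PP.filter (· ∣ m * P) = insert P (PP.filter (· ∣ m)) := by
    ext p
    simp only [mem_filter, mem_insert]
    constructor
    · rintro ⟨hp, hd⟩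
      rcases (hPP p hp).dvd_mul.1 hd with h1 | h1
      · exact Or.inr ⟨hp, h1⟩
      · exact Or.inl ((Nat.prime_dvd_prime_iff_eq (hPP p hp) (hPP P hP)).1 h1)
    · rintro (rfl | ⟨hp, hd⟩)
      · exact ⟨hP, Dvd.intro_left m rfl⟩
      · exact ⟨hp, Dvd.dvd.mul_right hd _⟩
  rw [this, Finset.card_insert_of_notMem]
  simp [h]

lemma step_conv {A : Type*} [CommRing A] (F : ℕ → A) (hF : ∀ m n : ℕ, Nat.Coprime m n → F (m * n) = F m * F n)
    (PP : Finset ℕ) (hPP : ∀ P ∈ PP, P.Prime) (h : A → ℝ) (hh : ∀ w, |h w| ≤ 1)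
    (g : ℕ → ℝ) (hg : ∀ t, |g t| ≤ 1) (hg0 : g 0 = 0) (e : ℝ) (he : ∑ P ∈ PP, (1:ℝ)/P^2 ≤ e) (X : ℕ) (w : A) :
    |∑ n ∈ Ioc 0 X, g (DD PP n) * h (w * F n)
      - ∑ P ∈ PP, ∑ m ∈ Ioc 0 (X / P), g (DD PP m + 1) / ((DD PP m : ℝ) + 1) * h (w * F P * F m)| ≤ 2 * X * e := by
  set k : ℕ → ℝ := fun n => g (DD PP n) / (DD PP n : ℝ) * h (w * F n) with hk
  have hkb : ∀ n, |k n| ≤ 1 := by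
    intro n
    simp only [hk]
    rw [abs_mul]
    refine mul_le_one₀ ?_ (abs_nonneg _) (hh _)
    rcases Nat.eq_zero_or_pos (DD PP n) with h0 | h0
    · simp [h0]
    · have : (1:ℝ) ≤ DD PP n := by exact_mod_cast h0
      rw [abs_div, abs_of_pos (by linarith : (0:ℝ) < DD PP n), div_le_one (by linarith)]
      exact (hg _).trans this
  have h1 : ∑ n ∈ Ioc 0 X, g (DD PP n) * h (w * F n) = ∑ P ∈ PP, ∑ m ∈ Ioc 0 (X / P), k (m * P) := by
    have : ∀ P ∈ PP, ∑ m ∈ Ioc 0 (X / P), k (m * P) = ∑ n ∈ Ioc 0 X, if P ∣ n then k n else 0 := by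
      intro P hP
      rw [← sum_mult X P (hPP P hP).pos, Finset.sum_filter]
    rw [Finset.sum_congr rfl this, Finset.sum_comm]
    refine Finset.sum_congr rfl fun n _ => ?_
    rw [← Finset.sum_filter, Finset.sum_const, nsmul_eq_mul]
    show _ = (DD PP n : ℝ) * k n
    simp only [hk]
    rcases Nat.eq_zero_or_pos (DD PP n) with h0 | h0
    · simp [h0, hg0]
    · have : (DD PP n : ℝ) ≠ 0 := by positivity
      field_simp
  rw [h1, ← Finset.sum_sub_distrib]
  refine (Finset.abs_sum_le_sum_abs _ _).trans ?_
  calc _ ≤ ∑ P ∈ PP, 2 * X * ((1:ℝ)/P^2) := ?_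
    _ = 2 * X * ∑ P ∈ PP, (1:ℝ)/P^2 := by rw [Finset.mul_sum]
    _ ≤ _ := by gcongr
  refine Finset.sum_le_sum fun P hP => ?_
  rw [← Finset.sum_sub_distrib]
  refine (Finset.abs_sum_le_sum_abs _ _).trans ?_
  calc _ ≤ ∑ m ∈ Ioc 0 (X / P), if P ∣ m then (2:ℝ) else 0 := ?_
    _ = 2 * ((X / P / P : ℕ) : ℝ) := by
      rw [← Finset.sum_filter, Finset.sum_const, Nat.Ioc_filter_dvd_card_eq_div, nsmul_eq_mul, mul_comm]
    _ ≤ 2 * ((X:ℝ) * (1 / P ^ 2)) := by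
      gcongr
      rw [Nat.div_div_eq_div_mul, mul_one_div, sq, ← Nat.cast_mul]
      exact Nat.cast_div_le
    _ = _ := by ring
  refine Finset.sum_le_sum fun m _ => ?_
  split_ifs with hd
  · refine (abs_sub _ _).trans ?_
    have : |g (DD PP m + 1) / ((DD PP m : ℝ) + 1) * h (w * F P * F m)| ≤ 1 := by
      rw [abs_mul]
      refine mul_le_one₀ ?_ (abs_nonneg _) (hh _)
      have h0 : (0:ℝ) ≤ DD PP m := by positivity
      rw [abs_div, abs_of_pos (by linarith : (0:ℝ) < DD PP m + 1), div_le_one (by linarith)]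
      exact (hg _).trans (by linarith)
    linarith [hkb (m * P)]
  · have hc : Nat.Coprime m P := ((hPP P hP).coprime_iff_not_dvd.2 hd).symm
    simp only [hk]
    rw [DD_mul PP hPP m P hP hd, hF m P hc]
    push_cast
    rw [show w * (F m * F P) = w * F P * F m by ring]
    simp

/-- Iterating the step lemma. -/
lemma iter_conv {A : Type*} [CommRing A] (F : ℕ → A) (hF : ∀ m n : ℕ, Nat.Coprime m n → F (m * n) = F m * F n)
    (PP : Finset ℕ) (hPP : ∀ P ∈ PP, P.Prime) (e L : ℝ) (he : ∑ P ∈ PP, (1:ℝ)/P^2 ≤ e) (hL1 : 1 ≤ L)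
    (hL : ∑ P ∈ PP, (1:ℝ)/P ≤ L) (J : ℕ) (g : ℕ → ℝ) (hg0 : ∀ t, 0 ≤ g t) (hg : ∀ t, g t ≤ 1) (hgJ : ∀ t < J, g t = 0) :
    ∃ G : ℕ → ℝ, (∀ t, 0 ≤ G t) ∧ (∀ t, G t ≤ 1) ∧ ∀ h : A → ℝ, (∀ w, |h w| ≤ 1) → ∀ (X : ℕ) (w : A),
    |∑ n ∈ Ioc 0 X, g (DD PP n) * h (w * F n) - ∑ m ∈ Ioc 0 X, G (DD PP m) * AA PP F h J (X / m) (w * F m)|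
      ≤ 2 * J * X * e * L ^ J := by
  have he0 : 0 ≤ e := le_trans (Finset.sum_nonneg fun P _ => by positivity) he
  induction J generalizing g with
  | zero =>
    refine ⟨g, hg0, hg, fun h hh X w => ?_⟩
    have : ∑ n ∈ Ioc 0 X, g (DD PP n) * h (w * F n) = ∑ m ∈ Ioc 0 X, g (DD PP m) * AA PP F h 0 (X / m) (w * F m) := by
      refine Finset.sum_congr rfl fun m hm => ?_
      rw [mem_Ioc] at hm
      simp only [AA]
      rw [if_pos (show 1 ≤ X / m from Nat.div_pos hm.2 hm.1)]
    rw [this]; simp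
  | succ J ih =>
    obtain ⟨G, hG0, hG1, hG⟩ := ih (fun t => g (t+1) / ((t:ℝ)+1)) (fun t => div_nonneg (hg0 _) (by positivity))
      (fun t => by
        rw [div_le_one (by positivity)]
        exact (hg _).trans (by linarith [(Nat.cast_nonneg t : (0:ℝ) ≤ t)]))
      (fun t ht => by simp [hgJ (t+1) (by omega)])
    refine ⟨G, hG0, hG1, fun h hh X w => ?_⟩
    have h1 := step_conv F hF PP hPP h hh g (fun t => by rw [abs_of_nonneg (hg0 t)]; exact hg t) (hgJ 0 (by omega)) e he X w
    have h2 : ∑ m ∈ Ioc 0 X, G (DD PP m) * AA PP F h (J+1) (X / m) (w * F m)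
        = ∑ P ∈ PP, ∑ m ∈ Ioc 0 (X / P), G (DD PP m) * AA PP F h J (X / P / m) (w * F P * F m) := by
      simp only [AA]
      simp_rw [Finset.mul_sum]
      rw [Finset.sum_comm]
      refine Finset.sum_congr rfl fun P hP => ?_
      symm
      have hsub : Ioc 0 (X / P) ⊆ Ioc 0 X := Finset.Ioc_subset_Ioc_right (Nat.div_le_self _ _)
      rw [← Finset.sum_subset hsub]
      · refine Finset.sum_congr rfl fun m _ => ?_
        rw [Nat.div_div_eq_div_mul, Nat.div_div_eq_div_mul, mul_comm P m, mul_right_comm]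
      · intro m hm hm'
        rw [mem_Ioc] at hm hm'
        have : X / m / P = 0 := by
          rw [Nat.div_div_eq_div_mul, mul_comm, ← Nat.div_div_eq_div_mul]
          exact Nat.div_eq_of_lt (by omega)
        rw [this, AA_zero, mul_zero]
    rw [h2]
    have h3 : |∑ P ∈ PP, ∑ m ∈ Ioc 0 (X / P), g (DD PP m + 1) / ((DD PP m : ℝ) + 1) * h (w * F P * F m)
        - ∑ P ∈ PP, ∑ m ∈ Ioc 0 (X / P), G (DD PP m) * AA PP F h J (X / P / m) (w * F P * F m)| ≤ (2 * J * e * L ^ J) * X * L := by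
      rw [← Finset.sum_sub_distrib]
      refine (Finset.abs_sum_le_sum_abs _ _).trans ?_
      refine le_trans ?_ (natdiv_sum_le PP L hL X _ (by positivity))
      refine Finset.sum_le_sum fun P hP => ?_
      have := hG h hh (X / P) (w * F P)
      linarith
    have h4 : (2:ℝ) * X * e ≤ 2 * X * e * L ^ (J+1) := le_mul_of_one_le_right (by positivity) (one_le_pow₀ hL1)
    refine (abs_sub_le _ _ _).trans ((add_le_add h1 h3).trans ?_)
    push_cast
    rw [pow_succ] at h4 ⊢
    nlinarith

/-- Final convenient estimate. -/
lemma conv_final {A : Type*} [CommRing A] [Fintype A] [DecidableEq A] (R S : ℤ)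
    (F : ℕ → A) (hF : ∀ m n : ℕ, Nat.Coprime m n → F (m * n) = F m * F n)
    (PP : Finset ℕ) (hPP : ∀ P ∈ PP, P.Prime) (hρ : ∀ P ∈ PP, F P = R * (P : A) + S)
    (e L η : ℝ) (he : ∑ P ∈ PP, (1:ℝ)/P^2 ≤ e) (hL1 : 1 ≤ L) (hη : 0 ≤ η)
    (hL : ∑ P ∈ PP, (1:ℝ)/P ≤ L)
    (HP : ∀ G : A → ℝ, (∀ v, |G v| ≤ 1) → ∀ Z : ℕ,
      |∑ P ∈ PP with P ≤ Z, (G (P : A) - (∑ u : Aˣ, G u) / (Fintype.card Aˣ : ℝ))| ≤ η * Z)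
    (J X : ℕ) (hLX : ∑ m ∈ Ioc 0 X, (1:ℝ)/m ≤ L)
    (h h' : A → ℝ) (hh : ∀ w, |h w| ≤ 1) (hh' : ∀ w, |h' w| ≤ 1) (κ : ℝ) (hκ0 : 0 ≤ κ)
    (hκ : ∀ w, |(TT R S)^[J] h w| ≤ κ * (TT R S)^[J] h' w) :
    |∑ n ∈ Ioc 0 X with J ≤ DD PP n, h (F n)| ≤ κ * ∑ n ∈ Ioc 0 X with J ≤ DD PP n, h' (F n)
      + (1 + κ) * (J * X * L ^ (J + 1) * (2 * e + η)) := by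
  obtain ⟨G, hG0, hG1, hG⟩ := iter_conv F hF PP hPP e L he hL1 hL J (fun t => if J ≤ t then 1 else 0)
    (fun t => by positivity) (fun t => by split_ifs <;> norm_num) (fun t ht => by simp [ht])
  have he0 : 0 ≤ e := le_trans (Finset.sum_nonneg fun P _ => by positivity) he
  have key : ∀ k : A → ℝ, (∀ w, |k w| ≤ 1) → |∑ n ∈ Ioc 0 X with J ≤ DD PP n, k (F n)
      - ∑ m ∈ Ioc 0 X, G (DD PP m) * ((TT R S)^[J] k (F m) * BB PP J (X / m))| ≤ J * X * L ^ (J + 1) * (2 * e + η) := by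
    intro k hk
    have h1 := hG k hk X 1
    simp only [ite_mul, one_mul, zero_mul] at h1
    rw [← Finset.sum_filter] at h1
    have h2 : |∑ m ∈ Ioc 0 X, G (DD PP m) * AA PP F k J (X / m) (F m)
        - ∑ m ∈ Ioc 0 X, G (DD PP m) * ((TT R S)^[J] k (F m) * BB PP J (X / m))| ≤ (J * L ^ J * η) * X * L := by
      rw [← Finset.sum_sub_distrib]
      refine (Finset.abs_sum_le_sum_abs _ _).trans ?_
      refine le_trans ?_ (natdiv_sum_le (Ioc 0 X) L hLX X _ (by positivity))
      refine Finset.sum_le_sum fun m _ => ?_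
      rw [← mul_sub, abs_mul, abs_of_nonneg (hG0 _)]
      have := AA_approx R S PP F hρ k hk L η hL1 hη hL (fun P hP => (hPP P hP).pos) HP J (X / m) (F m)
      calc _ ≤ 1 * |AA PP F k J (X / m) (F m) - (TT R S)^[J] k (F m) * BB PP J (X / m)| := by
            gcongr; exact hG1 _
        _ ≤ _ := by linarith
    refine (abs_sub_le _ _ _).trans ((add_le_add h1 h2).trans ?_)
    have h4 : (2:ℝ) * J * X * e * L ^ J ≤ 2 * J * X * e * L ^ (J+1) := by
      gcongr
      omega
    rw [pow_succ] at h4 ⊢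
    nlinarith
  have k1 := key h hh
  have k2 := key h' hh'
  set E := J * X * L ^ (J + 1) * (2 * e + η)
  have k3 : |∑ m ∈ Ioc 0 X, G (DD PP m) * ((TT R S)^[J] h (F m) * BB PP J (X / m))|
      ≤ κ * ∑ m ∈ Ioc 0 X, G (DD PP m) * ((TT R S)^[J] h' (F m) * BB PP J (X / m)) := by
    refine (Finset.abs_sum_le_sum_abs _ _).trans ?_
    rw [Finset.mul_sum]
    refine Finset.sum_le_sum fun m _ => ?_
    rw [abs_mul, abs_mul, abs_of_nonneg (hG0 _), abs_of_nonneg (BB_nonneg _ _ _)]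
    have := hκ (F m)
    calc _ ≤ G (DD PP m) * (κ * (TT R S)^[J] h' (F m) * BB PP J (X / m)) := by
          have := hG0 (DD PP m)
          have := BB_nonneg PP J (X / m)
          gcongr
      _ = _ := by ring
  rw [abs_le] at k1 k2 k3 ⊢
  constructor <;> nlinarith

end SW
end

section
open Finset
namespace SW
set_option linter.unusedSectionVars false
section mix
variable (R S : ℤ)

open Classical in
/-- indicator of a point -/
noncomputable def ind {A : Type*} (a : A) : A → ℝ := fun w => if w = a then 1 else 0

open Classical in
/-- indicator of units -/
noncomputable def uni {A : Type*} [CommRing A] : A → ℝ := fun w => if IsUnit w then 1 else 0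

lemma ind_apply {A : Type*} (a w : A) [Decidable (w = a)] : ind a w = if w = a then 1 else 0 := by
  unfold ind; congr

lemma uni_apply {A : Type*} [CommRing A] (w : A) [Decidable (IsUnit w)] : uni w = if IsUnit w then 1 else 0 := by
  unfold uni; congr

lemma uni_unit {A : Type*} [CommRing A] {w : A} (h : IsUnit w) : uni w = 1 := by
  unfold uni; rw [if_pos h]

lemma uni_nonunit {A : Type*} [CommRing A] {w : A} (h : ¬ IsUnit w) : uni w = 0 := by
  unfold uni; rw [if_neg h]

/-- Mixing property. -/
def Mix (A : Type*) [CommRing A] [Fintype A] [DecidableEq A] (J : ℕ) (κ : ℝ) : Prop :=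
  ∀ a w : A, IsUnit a → IsUnit w →
    |(Fintype.card Aˣ : ℝ) * (TT R S)^[J] (ind a) w - (TT R S uni (1:A)) ^ J| ≤ κ * (TT R S uni (1:A)) ^ J

lemma card_units_pos (A : Type*) [CommRing A] [Fintype A] [DecidableEq A] : (0:ℝ) < Fintype.card Aˣ := by
  exact_mod_cast Fintype.card_pos

variable {A B : Type*} [CommRing A] [Fintype A] [DecidableEq A] [CommRing B] [Fintype B] [DecidableEq B]

lemma TT_prod (h : A → ℝ) (k : B → ℝ) :
    TT R S (fun z : A × B => h z.1 * k z.2) = fun z => TT R S h z.1 * TT R S k z.2 := by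
  funext z
  unfold TT
  have h1 : (Fintype.card (A × B)ˣ : ℝ) = Fintype.card Aˣ * Fintype.card Bˣ := by
    rw [← Nat.cast_mul, ← Fintype.card_prod]
    exact_mod_cast Fintype.card_congr MulEquiv.prodUnits.toEquiv
  rw [h1, div_mul_div_comm, Finset.sum_mul_sum]
  congr 1
  rw [← Finset.sum_product', Finset.univ_product_univ]
  refine Fintype.sum_equiv MulEquiv.prodUnits.toEquiv _ _ fun v => ?_
  simp [MulEquiv.prodUnits]

lemma TTJ_prod (h : A → ℝ) (k : B → ℝ) (J : ℕ) :
    (TT R S)^[J] (fun z : A × B => h z.1 * k z.2) = fun z => (TT R S)^[J] h z.1 * (TT R S)^[J] k z.2 := by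
  induction J with
  | zero => rfl
  | succ J ih => simp only [Function.iterate_succ_apply', ih, TT_prod]

lemma ind_prod (a : A) (b : B) : (ind (a, b) : A × B → ℝ) = fun z => ind a z.1 * ind b z.2 := by
  funext z
  unfold ind
  rcases z with ⟨x, y⟩
  by_cases h1 : x = a <;> by_cases h2 : y = b <;> simp [h1, h2]

lemma uni_prod : (uni : A × B → ℝ) = fun z => uni z.1 * uni z.2 := by
  funext z
  unfold uni
  by_cases h1 : IsUnit z.1 <;> by_cases h2 : IsUnit z.2 <;> simp [h1, h2, Prod.isUnit_iff]

lemma TT_uni_nonneg (w : A) : 0 ≤ TT R S uni w := by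
  unfold TT
  refine div_nonneg (Finset.sum_nonneg fun v _ => ?_) (Nat.cast_nonneg _)
  unfold uni; split_ifs <;> norm_num

lemma Mix_prod (J : ℕ) (κ₁ κ₂ : ℝ) (h1 : Mix R S A J κ₁) (h2 : Mix R S B J κ₂) (hκ₁ : 0 ≤ κ₁) :
    Mix R S (A × B) J ((1 + κ₁) * (1 + κ₂) - 1) := by
  rintro ⟨a, b⟩ ⟨w, z⟩ hab hwz
  rw [Prod.isUnit_iff] at hab hwz
  have h3 := h1 a w hab.1 hwz.1
  have h4 := h2 b z hab.2 hwz.2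
  have hc : (Fintype.card (A × B)ˣ : ℝ) = Fintype.card Aˣ * Fintype.card Bˣ := by
    rw [← Nat.cast_mul, ← Fintype.card_prod]
    exact_mod_cast Fintype.card_congr MulEquiv.prodUnits.toEquiv
  rw [ind_prod, uni_prod, TTJ_prod, TT_prod, hc]
  simp only [Prod.fst_one, Prod.snd_one]
  have p1 := pow_nonneg (TT_uni_nonneg R S (1:A)) J
  have p2 := pow_nonneg (TT_uni_nonneg R S (1:B)) J
  rw [mul_pow]
  set α := (TT R S uni (1:A)) ^ J
  set β := (TT R S uni (1:B)) ^ J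
  set u := (TT R S)^[J] (ind a) w
  set v := (TT R S)^[J] (ind b) z
  set m := (Fintype.card Aˣ : ℝ)
  set n := (Fintype.card Bˣ : ℝ)
  have e1 : m * n * (u * v) - α * β = (m * u - α) * (n * v - β) + (m * u - α) * β + α * (n * v - β) := by ring
  rw [e1]
  refine (abs_add_le _ _).trans ?_
  refine (add_le_add_left (abs_add_le _ _) _).trans ?_
  rw [abs_mul, abs_mul, abs_mul, abs_of_nonneg p1, abs_of_nonneg p2]
  have q1 := mul_le_mul h3 h4 (abs_nonneg _) (by positivity)
  have q2 := mul_le_mul_of_nonneg_right h3 p2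
  have q3 := mul_le_mul_of_nonneg_left h4 p1
  nlinarith

lemma TT_equiv (e : A ≃+* B) (h : B → ℝ) : TT R S (h ∘ e) = TT R S h ∘ e := by
  funext w
  unfold TT
  have hc : Fintype.card Aˣ = Fintype.card Bˣ := Fintype.card_congr (Units.mapEquiv e.toMulEquiv).toEquiv
  simp only [Function.comp_apply]
  rw [hc]
  congr 1
  refine Fintype.sum_equiv (Units.mapEquiv e.toMulEquiv).toEquiv _ _ fun v => ?_
  simp

lemma Mix_equiv (e : A ≃+* B) (J : ℕ) (κ : ℝ) (h : Mix R S B J κ) : Mix R S A J κ := by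
  intro a w ha hw
  have := h (e a) (e w) (ha.map e) (hw.map e)
  have hc : Fintype.card Aˣ = Fintype.card Bˣ := Fintype.card_congr (Units.mapEquiv e.toMulEquiv).toEquiv
  have hJ : ∀ J h, (TT R S)^[J] (h ∘ e) = (TT R S)^[J] h ∘ e := by
    intro J h
    induction J with
    | zero => rfl
    | succ J ih => simp only [Function.iterate_succ_apply', ih, TT_equiv]
  have h1 : (ind a : A → ℝ) = ind (e a) ∘ e := by funext x; simp [ind]
  have h2 : (uni : A → ℝ) = uni ∘ e := by funext x; simp [uni]
  rw [h1, h2, hJ, TT_equiv, hc]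
  simpa using this

/-- reduction to residue field -/
lemma TT_comp (π : A →+* B) (hs : Function.Surjective π) [IsLocalHom π] (g : B → ℝ) :
    TT R S (g ∘ π) = TT R S g ∘ π := by
  funext w
  unfold TT
  have hsu : Function.Surjective (Units.map (π : A →* B)) := by
    intro t
    obtain ⟨x, hx⟩ := hs t
    have : IsUnit x := by
      apply isUnit_of_map_unit π
      rw [hx]; exact t.isUnit
    refine ⟨this.unit, ?_⟩
    ext; simp [hx]
  have key : ∀ G : Bˣ → ℝ, ∑ v : Aˣ, G (Units.map (π : A →* B) v) =
      ((univ.filter (fun v : Aˣ => Units.map (π : A →* B) v = 1)).card : ℝ) * ∑ t : Bˣ, G t := by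
    intro G
    rw [← Finset.sum_fiberwise_of_maps_to (t := univ) (g := Units.map (π : A →* B)) (fun _ _ => mem_univ _), Finset.mul_sum]
    refine Finset.sum_congr rfl fun t _ => ?_
    rw [Finset.sum_congr rfl (g := fun _ => G t) (fun v hv => by rw [(mem_filter.1 hv).2]), Finset.sum_const, nsmul_eq_mul]
    congr 2
    exact MonoidHom.card_fiber_eq_of_mem_range _ (hsu t) (hsu 1)
  have hcard := key (fun _ => 1)
  simp only [Finset.sum_const, nsmul_eq_mul, mul_one, Finset.card_univ] at hcard
  have hmain := key (fun t => g (π w * (R * (t : B) + S)))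
  have hA := card_units_pos A
  have hB := card_units_pos B
  simp only [Function.comp_apply, map_mul, map_add, map_intCast]
  have : ∀ v : Aˣ, π (v : A) = ((Units.map (π : A →* B) v : Bˣ) : B) := fun v => rfl
  simp_rw [this]
  rw [hmain, hcard]
  have hc : (((univ.filter (fun v : Aˣ => Units.map (π : A →* B) v = 1)).card : ℝ)) ≠ 0 := by
    intro h0; rw [h0] at hcard; simp at hcard
  rw [mul_div_mul_left _ _ hc]

lemma TT_ind_comp {k : Type*} [Field k] [Fintype k] [DecidableEq k] (π : A →+* k) (hs : Function.Surjective π) [IsLocalHom π] (hR : IsUnit (R : A)) (a : A) (ha : IsUnit a) :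
    (fun w => (Fintype.card Aˣ : ℝ) * TT R S (ind a) w) = (fun w => (Fintype.card kˣ : ℝ) * TT R S (ind (π a)) w) ∘ π := by
  classical
  funext w
  have hA := card_units_pos A
  have hB := card_units_pos k
  simp only [TT, Function.comp_apply]
  rw [mul_div_cancel₀ _ hA.ne', mul_div_cancel₀ _ hB.ne']
  simp only [ind_apply, Finset.sum_boole]
  norm_cast
  have hw : w * ((R:A) * 0 + S) = w * ((R:A) * 0 + S) := rfl
  by_cases hwu : IsUnit w
  · refine Finset.card_bij (fun v _ => Units.map (π : A →* k) v) ?_ ?_ ?_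
    · intro v hv
      simp only [mem_filter, mem_univ, true_and] at hv ⊢
      rw [← hv]; simp
    · intro v hv v' hv' _
      simp only [mem_filter, mem_univ, true_and] at hv hv'
      rw [← hv'] at hv
      have := hR.mul_left_cancel (add_right_cancel (hwu.mul_left_cancel hv))
      exact Units.ext this
    · intro t ht
      simp only [mem_filter, mem_univ, true_and] at ht
      obtain ⟨w', hw'⟩ := hwu.exists_right_inv
      obtain ⟨r', hr'⟩ := hR.exists_right_inv
      have hp1 : π w * π w' = 1 := by rw [← map_mul, hw', map_one]
      have hp2 : (R : k) * π r' = 1 := by rw [← map_intCast π, ← map_mul, hr', map_one]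
      have hv : π (r' * (w' * a - S)) = t := by
        simp only [map_mul, map_sub, map_intCast]
        rw [← ht]
        linear_combination (π r' * (R * (t:k) + S)) * hp1 + (t:k) * hp2
      have hu : IsUnit (r' * (w' * a - S)) := by
        apply isUnit_of_map_unit π; rw [hv]; exact t.isUnit
      refine ⟨hu.unit, ?_, ?_⟩
      · simp only [mem_filter, mem_univ, true_and, IsUnit.unit_spec]
        linear_combination a * hw' + (w * (w' * a - S)) * hr'
      · ext; simpa using hv
  · have hw0 : π w = 0 := by
      by_contra h0
      exact hwu (isUnit_of_map_unit π w (isUnit_iff_ne_zero.2 h0))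
    have ha0 : π a ≠ 0 := (ha.map π).ne_zero
    rw [Finset.filter_false_of_mem, Finset.filter_false_of_mem]
    · simp
    · intro t _ h; rw [hw0, zero_mul] at h; exact ha0 h.symm
    · intro v _ h; apply hwu; rw [← h] at ha; exact isUnit_of_mul_isUnit_left ha

lemma TT_smul (c : ℝ) (h : A → ℝ) : TT R S (fun w => c * h w) = fun w => c * TT R S h w := by
  funext w; unfold TT; rw [← Finset.mul_sum, mul_div_assoc]

lemma TTJ_smul (c : ℝ) (h : A → ℝ) (J : ℕ) : (TT R S)^[J] (fun w => c * h w) = fun w => c * (TT R S)^[J] h w := by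
  induction J with
  | zero => rfl
  | succ J ih => simp only [Function.iterate_succ_apply', ih, TT_smul]

lemma Mix_local {k : Type*} [Field k] [Fintype k] [DecidableEq k] (π : A →+* k) (hs : Function.Surjective π) [IsLocalHom π]
    (hR : IsUnit (R : A)) (J : ℕ) (hJ : 1 ≤ J) (κ : ℝ) (h : Mix R S k J κ) : Mix R S A J κ := by
  intro a w ha hw
  have h0 := h (π a) (π w) (ha.map π) (hw.map π)
  have hJJ : ∀ J h, (TT R S)^[J] (h ∘ π) = (TT R S)^[J] h ∘ π := by
    intro J h
    induction J with
    | zero => rfl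
    | succ J ih => simp only [Function.iterate_succ_apply', ih, TT_comp R S π hs]
  obtain ⟨J, rfl⟩ : ∃ j, J = j + 1 := ⟨J - 1, by omega⟩
  have h1 : (Fintype.card Aˣ : ℝ) * (TT R S)^[J+1] (ind a) w = (Fintype.card kˣ : ℝ) * (TT R S)^[J+1] (ind (π a)) (π w) := by
    rw [Function.iterate_succ_apply, Function.iterate_succ_apply]
    have e1 := congrFun (TTJ_smul R S (Fintype.card Aˣ : ℝ) (TT R S (ind a)) J) w
    have e2 := congrFun (TTJ_smul R S (Fintype.card kˣ : ℝ) (TT R S (ind (π a))) J) (π w)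
    rw [← e1, ← e2, TT_ind_comp R S π hs hR a ha, hJJ]; rfl
  have h2 : (uni : A → ℝ) = uni ∘ π := by 
    funext x
    by_cases hx : IsUnit x
    · rw [Function.comp_apply, uni_unit hx, uni_unit (hx.map π)]
    · rw [Function.comp_apply, uni_nonunit hx, uni_nonunit]
      rwa [isUnit_map_iff π x]
  rw [h1, h2, TT_comp R S π hs]
  simpa using h0

/-- the field case -/
lemma TT_field {k : Type*} [Field k] [Fintype k] [DecidableEq k] (hR : (R : k) ≠ 0) (g : k → ℝ) (t : k) (ht : t ≠ 0) :
    (Fintype.card kˣ : ℝ) * TT R S g t = ∑ u : k, g u - g (t * S) := by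
  unfold TT
  rw [mul_div_cancel₀ _ (card_units_pos k).ne']
  have h1 : ∑ u : k, g u = ∑ v : k, g (t * (R * v + S)) := by
    symm
    refine Fintype.sum_bijective (fun v : k => t * (R * v + S)) ?_ _ _ (fun _ => rfl)
    refine Finite.injective_iff_bijective.1 ?_
    intro v v' h
    exact mul_left_cancel₀ hR (add_right_cancel (mul_left_cancel₀ ht h))
  rw [h1, ← Finset.add_sum_erase _ _ (mem_univ (0:k))]
  simp only [mul_zero, zero_add, add_sub_cancel_left]
  refine Finset.sum_bij (fun v _ => (v : k)) ?_ ?_ ?_ ?_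
  · intro v _; simp
  · intro v _ v' _ h; exact Units.ext h
  · intro b hb; exact ⟨Units.mk0 b (by simpa using hb), mem_univ _, rfl⟩
  · intros; rfl

lemma Mix_field {k : Type*} [Field k] [Fintype k] [DecidableEq k] (hR : (R : k) ≠ 0) (J : ℕ) (hJ : 1 ≤ J) (hk : 3 ≤ Fintype.card kˣ) :
    Mix R S k J (1 / ((Fintype.card kˣ : ℝ) - 1) ^ (J - 1)) := by
  classical
  have hN0 := card_units_pos k
  have hN3 : (3:ℝ) ≤ Fintype.card kˣ := by exact_mod_cast hk
  intro a w ha hw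
  rw [isUnit_iff_ne_zero] at ha hw
  set N := (Fintype.card kˣ : ℝ) with hN
  set G : ℕ → k → ℝ := fun J t => N * (TT R S)^[J] (ind a) t with hG
  have hG0 : ∀ J, G J 0 = 0 := by
    intro J
    simp only [hG]
    suffices (TT R S)^[J] (ind a) 0 = 0 by rw [this, mul_zero]
    induction J with
    | zero => simp [ind, ha.symm]
    | succ J ih => rw [Function.iterate_succ_apply']; unfold TT at ih ⊢; simp [ih]
  have hGs : ∀ J t, t ≠ 0 → N * G (J+1) t = ∑ u : k, G J u - G J (t * S) := by
    intro J t ht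
    have := TT_field R S hR (fun u => N * (TT R S)^[J] (ind a) u) t ht
    rw [TT_smul] at this
    simp only [hG, Function.iterate_succ_apply']
    exact this
  have hcardk : ∑ u : k, (uni u) = N := by
    simp only [uni_apply, Finset.sum_boole]
    rw [hN]
    norm_cast
    rw [Fintype.card_units]
    simp only [isUnit_iff_ne_zero]
    rw [Finset.filter_ne', Finset.card_erase_of_mem (mem_univ _), Finset.card_univ]
  have hα := TT_field R S hR uni (1:k) one_ne_zero
  rw [hcardk, one_mul, ← hN] at hα
  set α := TT R S uni (1:k)
  have hsumG0 : ∑ u : k, G 0 u = N := by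
    show ∑ u : k, N * ind a u = N
    rw [← Finset.mul_sum]
    simp [ind_apply]
  by_cases hS : (S : k) = 0
  · have hα1 : α = 1 := by
      rw [hS] at hα; simp only [uni, not_isUnit_zero, if_false, sub_zero] at hα
      exact mul_left_cancel₀ hN0.ne' (by rw [hα, mul_one])
    have : ∀ j t, t ≠ 0 → G (j+1) t = 1 := by
      intro j
      induction j with
      | zero =>
        intro t ht
        have := hGs 0 t ht
        rw [hS, mul_zero, hG0, hsumG0, sub_zero] at this
        exact mul_left_cancel₀ hN0.ne' (by rw [this, mul_one])
      | succ j ih =>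
        intro t ht
        have h1 := hGs (j+1) t ht
        rw [hS, mul_zero, hG0, sub_zero] at h1
        have h2 : ∑ u : k, G (j+1) u = ∑ u : k, uni u := by
          refine Finset.sum_congr rfl fun u _ => ?_
          by_cases hu : u = 0
          · rw [hu, hG0]; simp [uni]
          · rw [ih u hu]; simp [uni, hu]
        rw [h2, hcardk] at h1
        exact mul_left_cancel₀ hN0.ne' (by rw [h1, mul_one])
    have h2 := this (J - 1) w hw
    rw [Nat.sub_add_cancel hJ] at h2
    show |G J w - α ^ J| ≤ _
    rw [h2, hα1]
    simp only [one_pow, sub_self, abs_zero, mul_one]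
    have : 0 < N - 1 := by linarith
    positivity
  · have hα1 : N * α = N - 1 := by
      rw [hα]; simp [uni, hS]
    have hmain : ∀ j, (∑ u : k, G j u = N * α ^ j) ∧ ∀ t, t ≠ 0 → |G j t - α ^ j| ≤ (N - 1) / N ^ j := by
      intro j
      induction j with
      | zero =>
        refine ⟨by rw [hsumG0]; simp, fun t _ => ?_⟩
        simp only [hG, ind, Function.iterate_zero, id, pow_zero, div_one]
        split_ifs
        · rw [mul_one, abs_of_nonneg (by linarith)]
        · rw [mul_zero, zero_sub, abs_neg, abs_one]; linarith
      | succ j ih =>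
        have h1 : ∀ t, t ≠ 0 → G (j+1) t - α^(j+1) = - (G j (t * S) - α ^ j) / N := by
          intro t ht
          have h2 := hGs j t ht
          rw [ih.1] at h2
          field_simp
          rw [pow_succ]
          linear_combination h2 - α ^ j * hα1
        constructor
        · have h3 : ∀ u : k, G (j+1) u = (α^(j+1) + α ^ j / N) * uni u - G j (u * S) / N := by
            intro u
            by_cases hu : u = 0
            · rw [hu, zero_mul, hG0, hG0]; simp [uni]
            · have := h1 u hu
              simp only [uni, isUnit_iff_ne_zero, ne_eq, hu, not_false_eq_true, if_true, mul_one]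
              linear_combination this
          simp_rw [h3]
          rw [Finset.sum_sub_distrib, ← Finset.mul_sum, hcardk, ← Finset.sum_div]
          have h4 : ∑ u : k, G j (u * S) = ∑ u : k, G j u :=
            Fintype.sum_equiv (Equiv.mulRight₀ (S : k) hS) _ _ (fun _ => rfl)
          rw [h4, ih.1]
          field_simp
          ring
        · intro t ht
          rw [h1 t ht, abs_div, abs_neg, abs_of_pos hN0, pow_succ, ← div_div]
          gcongr
          exact ih.2 _ (mul_ne_zero ht hS)
    have h2 := (hmain J).2 w hw
    show |G J w - α ^ J| ≤ _
    refine h2.trans_eq ?_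
    have hα2 : α = (N - 1) / N := by field_simp; linarith
    have hN1 : N - 1 ≠ 0 := by linarith
    rw [hα2, div_pow]
    obtain ⟨j, rfl⟩ : ∃ j, J = j + 1 := ⟨J - 1, by omega⟩
    simp only [Nat.add_sub_cancel]
    field_simp
    ring

end mix
end SW
end

section
open Finset
namespace SW

lemma al_field (R S : ℤ) {k : Type*} [Field k] [Fintype k] [DecidableEq k] (hR : (R : k) ≠ 0) :
    1 - 1 / (Fintype.card kˣ : ℝ) ≤ TT R S uni (1:k) := by
  classical
  have hN0 := card_units_pos k
  have hcardk : ∑ u : k, (uni u) = (Fintype.card kˣ : ℝ) := by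
    simp only [uni_apply, Finset.sum_boole]
    norm_cast
    rw [Fintype.card_units]
    simp only [isUnit_iff_ne_zero]
    rw [Finset.filter_ne', Finset.card_erase_of_mem (mem_univ _), Finset.card_univ]
  have hα := TT_field R S hR uni (1:k) one_ne_zero
  rw [hcardk, one_mul] at hα
  have hu : (uni (S:k)) ≤ 1 := by unfold uni; split_ifs <;> norm_num
  have : 1 - 1 / (Fintype.card kˣ : ℝ) = (Fintype.card kˣ - 1 : ℝ) / Fintype.card kˣ := by field_simp
  rw [this, div_le_iff₀ hN0]
  linarith

lemma isUnit_pp (p n : ℕ) (hn : 0 < n) (z : ℤ) : IsUnit (z : ZMod (p ^ n)) ↔ IsUnit (z : ZMod p) := by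
  rw [ZMod.coe_int_isUnit_iff_isCoprime, ZMod.coe_int_isUnit_iff_isCoprime, Nat.cast_pow, IsCoprime.pow_left_iff hn]

lemma mix_zmod (R S : ℤ) (J : ℕ) (hJ : 1 ≤ J) (q : ℕ) : 0 < q → (∀ ℓ : ℕ, ℓ.Prime → ℓ ∣ q → 5 ≤ ℓ ∧ ¬ (ℓ : ℤ) ∣ R) →
    ∀ [NeZero q], Mix R S (ZMod q) J (∏ ℓ ∈ q.primeFactors, (1 + 1 / ((ℓ : ℝ) - 2) ^ (J - 1)) - 1) ∧
      ∏ ℓ ∈ q.primeFactors, (1 - 1 / ((ℓ : ℝ) - 1)) ≤ TT R S uni (1 : ZMod q) := by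
  induction q using Nat.recOnPosPrimePosCoprime with
  | zero => intro h; omega
  | one =>
    intro _ _ _
    have h1 : ∀ w : ZMod 1, uni w = 1 := fun w => uni_unit (isUnit_of_subsingleton w)
    have h2 : ∀ a w : ZMod 1, ind a w = 1 := fun a w => by
      unfold ind; rw [if_pos (Subsingleton.elim _ _)]
    have h3 : TT R S (fun _ : ZMod 1 => (1:ℝ)) = fun _ => 1 := by
      funext w; unfold TT; simp
    have h4 : TT R S (uni : ZMod 1 → ℝ) = fun _ => 1 := by rw [← h3]; congr 1; funext w; exact h1 w
    refine ⟨?_, ?_⟩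
    · intro a w _ _
      have h5 : (TT R S)^[J] (ind a) = fun _ : ZMod 1 => (1:ℝ) := by
        rw [show (ind a) = fun _ : ZMod 1 => (1:ℝ) from funext (h2 a)]
        exact Function.iterate_fixed h3 J
      rw [h5, h4]
      simp
    · rw [h4]; simp
  | prime_pow p n hp hn =>
    intro _ hq _
    have := Fact.mk hp
    have hdvd : p ∣ p ^ n := dvd_pow_self p hn.ne'
    obtain ⟨hp5, hpR⟩ := hq p hp hdvd
    have hRk : (R : ZMod p) ≠ 0 := by rwa [Ne, ZMod.intCast_zmod_eq_zero_iff_dvd]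
    have hRA : IsUnit (R : ZMod (p ^ n)) := by
      rw [isUnit_pp p n hn]
      exact isUnit_iff_ne_zero.2 hRk
    set π := ZMod.castHom hdvd (ZMod p)
    have hs : Function.Surjective π := ZMod.castHom_surjective hdvd
    have hloc : IsLocalHom π := by
      constructor
      intro a ha
      obtain ⟨z, rfl⟩ := ZMod.intCast_surjective a
      rw [isUnit_pp p n hn]
      simpa [π] using ha
    have hcard : (Fintype.card (ZMod p)ˣ : ℝ) = (p : ℝ) - 1 := by
      rw [ZMod.card_units p, Nat.cast_sub hp.one_le, Nat.cast_one]
    rw [Nat.primeFactors_prime_pow hn.ne' hp, Finset.prod_singleton, Finset.prod_singleton]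
    constructor
    · refine Mix_local R S π hs hRA J hJ _ ?_
      have := Mix_field R S hRk J hJ (by rw [ZMod.card_units p]; omega)
      rw [hcard] at this
      convert this using 1
      rw [add_sub_cancel_left]; congr 2; ring
    · have h1 : (uni : ZMod (p^n) → ℝ) = uni ∘ π := by
        funext x
        by_cases hx : IsUnit x
        · rw [Function.comp_apply, uni_unit hx, uni_unit (hx.map π)]
        · rw [Function.comp_apply, uni_nonunit hx, uni_nonunit]
          rwa [isUnit_map_iff π x]
      rw [h1, TT_comp R S π hs, Function.comp_apply, map_one]
      have := al_field R S hRk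
      rwa [hcard] at this
  | coprime a b ha hb hab iha ihb =>
    intro _ hq _
    have : NeZero a := ⟨by omega⟩
    have : NeZero b := ⟨by omega⟩
    obtain ⟨ha1, ha2⟩ := iha (by omega) (fun ℓ h1 h2 => hq ℓ h1 (h2.mul_right b))
    obtain ⟨hb1, hb2⟩ := ihb (by omega) (fun ℓ h1 h2 => hq ℓ h1 (h2.mul_left a))
    rw [hab.primeFactors_mul, Finset.prod_union hab.disjoint_primeFactors, Finset.prod_union hab.disjoint_primeFactors]
    constructor
    · apply Mix_equiv R S (ZMod.chineseRemainder hab)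
      have := Mix_prod R S J _ _ ha1 hb1 (by
        rw [sub_nonneg]
        have h1 : ∀ ℓ ∈ a.primeFactors, (1:ℝ) ≤ (1 + 1 / ((ℓ : ℝ) - 2) ^ (J - 1)) := by
          intro ℓ hℓ
          have := (hq ℓ (Nat.prime_of_mem_primeFactors hℓ) ((Nat.dvd_of_mem_primeFactors hℓ).mul_right b)).1
          have : (5:ℝ) ≤ ℓ := by exact_mod_cast this
          have : (0:ℝ) < ℓ - 2 := by linarith
          have : 0 < 1 / ((ℓ : ℝ) - 2) ^ (J - 1) := by positivity
          linarith
        calc (1:ℝ) = ∏ ℓ ∈ a.primeFactors, 1 := by simp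
          _ ≤ _ := Finset.prod_le_prod (fun _ _ => zero_le_one) h1)
      convert this using 1
      ring
    · have h1 : (uni : ZMod (a*b) → ℝ) = uni ∘ (ZMod.chineseRemainder hab) := by funext x; simp [uni]
      rw [h1, TT_equiv, uni_prod, TT_prod, Function.comp_apply, map_one, Prod.fst_one, Prod.snd_one]
      refine mul_le_mul ha2 hb2 (Finset.prod_nonneg fun ℓ hℓ => ?_) (TT_uni_nonneg _ _ _)
      have := (hq ℓ (Nat.prime_of_mem_primeFactors hℓ) ((Nat.dvd_of_mem_primeFactors hℓ).mul_left a)).1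
      have : (5:ℝ) ≤ ℓ := by exact_mod_cast this
      rw [sub_nonneg, div_le_one (by linarith)]; linarith

lemma TT_uni (R S : ℤ) {A : Type*} [CommRing A] [Fintype A] [DecidableEq A] (w : A) :
    TT R S uni w = TT R S uni (1:A) * uni w := by
  unfold TT
  by_cases hw : IsUnit w
  · rw [uni_unit hw, mul_one]
    congr 1
    refine Finset.sum_congr rfl fun v _ => ?_
    unfold uni
    simp [hw]
  · rw [uni_nonunit hw, mul_zero, Finset.sum_eq_zero, zero_div]
    intro v _
    refine uni_nonunit fun h => hw (isUnit_of_mul_isUnit_left h)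

lemma TTJ_uni (R S : ℤ) {A : Type*} [CommRing A] [Fintype A] [DecidableEq A] (J : ℕ) (w : A) :
    (TT R S)^[J] uni w = TT R S uni (1:A) ^ J * uni w := by
  induction J generalizing w with
  | zero => simp
  | succ J ih =>
    rw [Function.iterate_succ_apply', funext ih, TT_smul]
    show TT R S uni 1 ^ J * TT R S uni w = _
    rw [TT_uni R S w, pow_succ]
    ring

lemma TTJ_ind_nonunit (R S : ℤ) {A : Type*} [CommRing A] [Fintype A] [DecidableEq A] (J : ℕ) (a w : A) (ha : IsUnit a)
    (hw : ¬ IsUnit w) : (TT R S)^[J] (ind a) w = 0 := by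
  induction J generalizing w with
  | zero =>
    show ind a w = 0
    unfold ind; rw [if_neg]; rintro rfl; exact hw ha
  | succ J ih =>
    rw [Function.iterate_succ_apply']
    unfold TT at ih ⊢
    rw [Finset.sum_eq_zero, zero_div]
    intro v _
    exact ih _ fun h => hw (isUnit_of_mul_isUnit_left h)

lemma TTJ_sub (R S : ℤ) {A : Type*} [CommRing A] [Fintype A] [DecidableEq A] (J : ℕ) (h k : A → ℝ) :
    (TT R S)^[J] (fun w => h w - k w) = fun w => (TT R S)^[J] h w - (TT R S)^[J] k w := by
  induction J with
  | zero => rfl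
  | succ J ih =>
    simp only [Function.iterate_succ_apply', ih]
    funext w; unfold TT
    rw [Finset.sum_sub_distrib, sub_div]

lemma kappa_bound : ∃ C : ℝ, 0 < C ∧ ∀ (J : ℕ) (s : Finset ℕ), 3 ≤ J → (∀ ℓ ∈ s, 5 ≤ ℓ) →
    ∏ ℓ ∈ s, (1 + 1 / ((ℓ : ℝ) - 2) ^ (J - 1)) ≤ Real.exp (C / 3 ^ (J - 3)) := by
  have hsum : Summable (fun n : ℕ => 1 / (n:ℝ)^2) := Real.summable_one_div_nat_pow.2 (by norm_num)
  refine ⟨4 * ∑' n : ℕ, 1 / (n:ℝ)^2 + 1, by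
    have : 0 ≤ ∑' n : ℕ, 1 / (n:ℝ)^2 := tsum_nonneg fun n => by positivity
    positivity, fun J s hJ hs => ?_⟩
  have h5 : ∀ ℓ ∈ s, (5:ℝ) ≤ ℓ := fun ℓ h => by exact_mod_cast hs ℓ h
  calc _ ≤ ∏ ℓ ∈ s, Real.exp (1 / ((ℓ : ℝ) - 2) ^ (J - 1)) := by
        refine Finset.prod_le_prod (fun ℓ hℓ => ?_) (fun ℓ hℓ => ?_)
        · have := h5 ℓ hℓ
          have : (0:ℝ) < ℓ - 2 := by linarith
          positivity
        · rw [add_comm]; exact Real.add_one_le_exp _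
    _ = Real.exp (∑ ℓ ∈ s, 1 / ((ℓ : ℝ) - 2) ^ (J - 1)) := (Real.exp_sum _ _).symm
    _ ≤ _ := by
        apply Real.exp_le_exp.2
        calc _ ≤ ∑ ℓ ∈ s, (4 / 3 ^ (J - 3)) * (1 / (ℓ:ℝ)^2) := by
              refine Finset.sum_le_sum fun ℓ hℓ => ?_
              have h := h5 ℓ hℓ
              rw [show J - 1 = (J - 3) + 2 by omega, pow_add, div_mul_div_comm, div_le_div_iff₀ (by
                have : (0:ℝ) < ℓ - 2 := by linarith
                positivity) (by positivity)]
              have h1 : (3:ℝ) ^ (J-3) ≤ ((ℓ:ℝ) - 2) ^ (J-3) := by gcongr; linarith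
              have h3 : (0:ℝ) ≤ (ℓ:ℝ) - 2 := by linarith
              have h2 : (ℓ:ℝ)^2 ≤ 4 * (ℓ - 2)^2 := by nlinarith
              calc _ = (3:ℝ) ^ (J-3) * (ℓ:ℝ)^2 := by ring
                _ ≤ ((ℓ:ℝ) - 2) ^ (J-3) * (4 * (ℓ - 2)^2) := by gcongr
                _ = _ := by ring
          _ = (4 / 3 ^ (J - 3)) * ∑ ℓ ∈ s, 1 / (ℓ:ℝ)^2 := by rw [Finset.mul_sum]
          _ ≤ (4 / 3 ^ (J - 3)) * ∑' n : ℕ, 1 / (n:ℝ)^2 := by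
              gcongr
              exact hsum.sum_le_tsum s (fun n _ => by positivity)
          _ ≤ _ := by
              rw [div_mul_eq_mul_div]; gcongr; linarith

lemma mix_final (R S : ℤ) (ε : ℝ) (hε : 0 < ε) : ∃ J : ℕ, 1 ≤ J ∧ ∀ (q : ℕ) [NeZero q],
    (∀ ℓ : ℕ, ℓ.Prime → ℓ ∣ q → 5 ≤ ℓ ∧ ¬ (ℓ : ℤ) ∣ R) → ∀ a b w : ZMod q, IsUnit a → IsUnit b →
    |(TT R S)^[J] (fun w => ind a w - ind b w) w| ≤ ε / (Nat.totient q) * (TT R S)^[J] uni w := by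
  obtain ⟨C, hC, hCb⟩ := kappa_bound
  have hlim : Filter.Tendsto (fun j : ℕ => Real.exp (C / 3 ^ j) - 1) Filter.atTop (nhds 0) := by
    have h1 : Filter.Tendsto (fun j : ℕ => C / (3:ℝ) ^ j) Filter.atTop (nhds 0) :=
      Filter.Tendsto.const_div_atTop (tendsto_pow_atTop_atTop_of_one_lt (by norm_num)) C
    have h2 := (Real.continuous_exp.tendsto 0).comp h1
    rw [Real.exp_zero] at h2
    have := h2.sub_const 1
    simpa using this
  obtain ⟨j, hj⟩ := (hlim.eventually (gt_mem_nhds (half_pos hε))).exists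
  refine ⟨j + 3, by omega, fun q _ hq a b w ha hb => ?_⟩
  have hq0 : 0 < q := Nat.pos_of_ne_zero (NeZero.ne q)
  have hm := (mix_zmod R S (j+3) (by omega) q hq0 hq).1
  have hκ := hCb (j+3) q.primeFactors (by omega) (fun ℓ hℓ => (hq ℓ (Nat.prime_of_mem_primeFactors hℓ) (Nat.dvd_of_mem_primeFactors hℓ)).1)
  simp only [Nat.add_sub_cancel] at hκ
  rw [TTJ_sub, TTJ_uni]
  show |(TT R S)^[j + 3] (ind a) w - (TT R S)^[j + 3] (ind b) w| ≤ _
  by_cases hw : IsUnit w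
  · have h1 := hm a w ha hw
    have h2 := hm b w hb hw
    rw [uni_unit hw, mul_one]
    have hφ : (Fintype.card (ZMod q)ˣ : ℝ) = Nat.totient q := by rw [ZMod.card_units_eq_totient]
    rw [hφ] at h1 h2
    have hφ0 : (0:ℝ) < Nat.totient q := by exact_mod_cast Nat.totient_pos.2 hq0
    have hα := pow_nonneg (TT_uni_nonneg R S (1:ZMod q)) (j+3)
    set α := TT R S uni (1:ZMod q) ^ (j+3)
    set κ := ∏ ℓ ∈ q.primeFactors, (1 + 1 / ((ℓ : ℝ) - 2) ^ ((j+3) - 1)) - 1 with hκd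
    have hκ2 : κ ≤ ε / 2 := by
      have : κ ≤ Real.exp (C / 3 ^ j) - 1 := by rw [hκd]; exact sub_le_sub_right hκ 1
      linarith
    rw [div_mul_eq_mul_div, le_div_iff₀ hφ0, mul_comm]
    nth_rewrite 1 [← abs_of_pos hφ0]
    rw [← abs_mul, mul_sub]
    have := mul_le_mul_of_nonneg_right hκ2 hα
    rw [abs_le] at h1 h2 ⊢
    constructor <;> linarith
  · rw [TTJ_ind_nonunit R S _ a w ha hw, TTJ_ind_nonunit R S _ b w hb hw, uni_nonunit hw]
    simp

lemma prod_odd_lower (n : ℕ) : ∀ s : Finset ℕ, s.card = n → (∀ ℓ ∈ s, 5 ≤ ℓ ∧ Odd ℓ) →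
    1 / Real.sqrt (n + 1) ≤ ∏ ℓ ∈ s, (1 - 1 / ((ℓ : ℝ) - 1)) := by
  induction n with
  | zero => intro s hs _; rw [Finset.card_eq_zero] at hs; simp [hs]
  | succ n ih =>
    intro s hs hodd
    have hne : s.Nonempty := by rw [← Finset.card_pos]; omega
    set M := s.max' hne with hM
    have hMs : M ∈ s := s.max'_mem hne
    have hMge : 2 * (n + 1) + 3 ≤ M := by
      have hsub : s ⊆ (Finset.Icc 2 (M/2)).image (fun i => 2 * i + 1) := by
        intro ℓ hℓ
        obtain ⟨h5, k, hk⟩ := hodd ℓ hℓ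
        have := s.le_max' ℓ hℓ
        rw [Finset.mem_image]
        exact ⟨k, by rw [Finset.mem_Icc]; omega, hk.symm⟩
      have h1 := (Finset.card_le_card hsub).trans Finset.card_image_le
      rw [hs, Nat.card_Icc] at h1
      obtain ⟨_, k, hk⟩ := hodd M hMs
      omega
    rw [← Finset.mul_prod_erase s _ hMs]
    have h2 := ih (s.erase M) (by rw [Finset.card_erase_of_mem hMs, hs]; omega) (fun ℓ hℓ => hodd ℓ (Finset.mem_of_mem_erase hℓ))
    have hMr : (2 * ((n:ℝ) + 1) + 3) ≤ M := by exact_mod_cast hMge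
    have h3 : 1 - 1 / (2 * (n:ℝ) + 4) ≤ 1 - 1 / ((M : ℝ) - 1) := by
      gcongr
      linarith
    have h4 : Real.sqrt (n + 1) / Real.sqrt (n + 1 + 1) ≤ 1 - 1 / (2 * (n:ℝ) + 4) := by
      rw [← Real.sqrt_div (by positivity)]
      apply Real.sqrt_le_iff.2
      constructor
      · rw [sub_nonneg, div_le_one (by positivity)]; linarith [(Nat.cast_nonneg n : (0:ℝ) ≤ n)]
      · have : 1 - 1 / (2 * (n:ℝ) + 4) = (2 * n + 3) / (2 * n + 4) := by field_simp; ring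
        rw [this, div_pow, div_le_div_iff₀ (by positivity) (by positivity)]
        nlinarith [(Nat.cast_nonneg n : (0:ℝ) ≤ n)]
    have hs1 : 0 < Real.sqrt ((n:ℝ) + 1) := Real.sqrt_pos.2 (by positivity)
    have hs2 : 0 < Real.sqrt ((n:ℝ) + 1 + 1) := Real.sqrt_pos.2 (by positivity)
    push_cast
    calc 1 / Real.sqrt ((n:ℝ) + 1 + 1) = Real.sqrt (n + 1) / Real.sqrt (n + 1 + 1) * (1 / Real.sqrt (n + 1)) := by field_simp
      _ ≤ _ := mul_le_mul (h4.trans h3) h2 (by positivity) (le_trans (by positivity) (h4.trans h3))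

lemma al_lower (R S : ℤ) (q : ℕ) [NeZero q] (hq : ∀ ℓ : ℕ, ℓ.Prime → ℓ ∣ q → 5 ≤ ℓ ∧ ¬ (ℓ : ℤ) ∣ R) :
    1 / Real.sqrt (q.primeFactors.card + 1) ≤ TT R S uni (1 : ZMod q) := by
  refine le_trans (prod_odd_lower _ q.primeFactors rfl fun ℓ hℓ => ?_) (mix_zmod R S 1 le_rfl q (Nat.pos_of_ne_zero (NeZero.ne q)) hq).2
  have h5 := (hq ℓ (Nat.prime_of_mem_primeFactors hℓ) (Nat.dvd_of_mem_primeFactors hℓ)).1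
  exact ⟨h5, (Nat.prime_of_mem_primeFactors hℓ).odd_of_ne_two (by omega)⟩

end SW
end

section
open Finset
namespace SW

lemma card_primes_le (z Y : ℕ) (hz : 1 ≤ z) :
    (((Ioc z Y).filter Nat.Prime).card : ℝ) * Real.log z ≤ 2 * Y := by
  have h1 : (((Ioc z Y).filter Nat.Prime).card : ℝ) * Real.log z ≤ Chebyshev.theta Y := by
    unfold Chebyshev.theta
    rw [Nat.floor_natCast, ← nsmul_eq_mul]
    calc _ ≤ ∑ p ∈ (Ioc z Y).filter Nat.Prime, Real.log p := by
          refine Finset.card_nsmul_le_sum _ _ _ fun p hp => ?_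
          simp only [mem_filter, mem_Ioc] at hp
          exact Real.log_le_log (by exact_mod_cast hz) (by exact_mod_cast hp.1.1.le)
      _ ≤ _ := by
          refine Finset.sum_le_sum_of_subset_of_nonneg ?_ fun p hp _ => Real.log_natCast_nonneg p
          intro p hp
          simp only [mem_filter, mem_Ioc] at hp ⊢
          exact ⟨⟨by omega, hp.1.2⟩, hp.2⟩
  have h2 := Chebyshev.theta_le_log4_mul_x (x := (Y:ℝ)) (by positivity)
  have h3 : Real.log 4 ≤ 2 := by
    rw [show (4:ℝ) = 2^2 by norm_num, Real.log_pow]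
    have := Real.log_two_lt_d9; push_cast; linarith
  nlinarith [(Nat.cast_nonneg Y : (0:ℝ) ≤ Y)]

lemma block_inv (i : ℕ) (hi : 1 ≤ i) :
    ∑ p ∈ (Ioc (2^i) (2^(i+1))).filter Nat.Prime, (1:ℝ)/p ≤ 6 / i := by
  have h := card_primes_le (2^i) (2^(i+1)) Nat.one_le_two_pow
  push_cast at h
  rw [Real.log_pow] at h
  have hi' : (1:ℝ) ≤ i := by exact_mod_cast hi
  have hlog := Real.log_two_gt_d9
  calc _ ≤ ∑ p ∈ (Ioc (2^i) (2^(i+1))).filter Nat.Prime, (1:ℝ)/2^i := by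
        refine Finset.sum_le_sum fun p hp => ?_
        simp only [mem_filter, mem_Ioc] at hp
        gcongr
        exact_mod_cast hp.1.1.le
    _ = (((Ioc (2^i) (2^(i+1))).filter Nat.Prime).card : ℝ) / 2^i := by
        rw [Finset.sum_const, nsmul_eq_mul]; ring
    _ ≤ 6 / i := by
        rw [div_le_div_iff₀ (by positivity) (by positivity)]
        have hc : (0:ℝ) ≤ (((Ioc (2^i) (2^(i+1))).filter Nat.Prime).card : ℝ) := by positivity
        rw [pow_succ] at h
        have : (((Ioc (2^i) (2^(i+1))).filter Nat.Prime).card : ℝ) * i * (2/3) ≤ (((Ioc (2^i) (2^(i+1))).filter Nat.Prime).card : ℝ) * (i * Real.log 2) := by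
          rw [mul_assoc]; gcongr; linarith
        rw [← pow_succ] at *
        have h4 : (2:ℝ)^(i+1) = 2^i*2 := pow_succ _ _
        linarith

lemma mert_pow (n : ℕ) : ∑ p ∈ (Ioc 0 (2^(n+1))).filter Nat.Prime, (1:ℝ)/p ≤ 1/2 + 6 * (harmonic n : ℝ) := by
  induction n with
  | zero => simp; rw [show (Ioc 0 2).filter Nat.Prime = {2} by decide]; simp
  | succ n ih =>
    have : (Ioc 0 (2^(n+1+1))).filter Nat.Prime = (Ioc 0 (2^(n+1))).filter Nat.Prime ∪ (Ioc (2^(n+1)) (2^(n+1+1))).filter Nat.Prime := by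
      rw [← Finset.filter_union, Finset.Ioc_union_Ioc_eq_Ioc (by positivity) (Nat.pow_le_pow_right (by norm_num) (by omega))]
    rw [this, Finset.sum_union]
    · have := block_inv (n+1) (by omega)
      rw [harmonic_succ]
      push_cast at this ⊢
      have h2 : (6:ℝ)/(n+1) = 6 * (n+1:ℝ)⁻¹ := by ring
      linarith
    · refine Finset.disjoint_filter_filter ?_
      rw [Finset.disjoint_left]
      intro a ha hb
      simp only [mem_Ioc] at ha hb
      omega

lemma mertens (X : ℕ) (hX : 3 ≤ X) : ∑ p ∈ (Ioc 0 X).filter Nat.Prime, (1:ℝ)/p ≤ 14 + 6 * Real.log (Real.log X) := by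
  set n := Nat.log 2 X with hn
  have h1 : X < 2^(n+1) := Nat.lt_pow_succ_log_self (by norm_num) X
  have hn1 : 1 ≤ n := by
    rw [hn]; exact Nat.log_pos (by norm_num) (by omega)
  have h2 : 2^n ≤ X := Nat.pow_log_le_self 2 (by omega)
  have hl1 : 1 ≤ Real.log X := by
    rw [Real.le_log_iff_exp_le (by positivity)]
    have : (3:ℝ) ≤ X := by exact_mod_cast hX
    linarith [Real.exp_one_lt_d9]
  have h3 : (n:ℝ) ≤ 3 * Real.log X := by
    have : Real.log (2^n : ℝ) ≤ Real.log X := Real.log_le_log (by positivity) (by exact_mod_cast h2)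
    rw [Real.log_pow] at this
    nlinarith [Real.log_two_gt_d9, (Nat.cast_nonneg n : (0:ℝ) ≤ n)]
  have h4 : Real.log n ≤ Real.log 3 + Real.log (Real.log X) := by
    rw [← Real.log_mul (by norm_num) (by positivity)]
    exact Real.log_le_log (by exact_mod_cast hn1) h3
  have h5 : Real.log 3 ≤ 1.2 := by
    rw [Real.log_le_iff_le_exp (by norm_num)]
    have := Real.exp_one_gt_d9
    have h6 : Real.exp 1.2 = Real.exp 1 * Real.exp 0.2 := by rw [← Real.exp_add]; norm_num
    have := Real.add_one_le_exp (0.2:ℝ)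
    rw [h6]; nlinarith
  calc _ ≤ ∑ p ∈ (Ioc 0 (2^(n+1))).filter Nat.Prime, (1:ℝ)/p := by
        refine Finset.sum_le_sum_of_subset_of_nonneg ?_ fun p hp _ => by positivity
        refine Finset.filter_subset_filter _ (Finset.Ioc_subset_Ioc_right h1.le)
    _ ≤ _ := mert_pow n
    _ ≤ _ := by
      have := harmonic_le_one_add_log n
      linarith

lemma ev_M3 : ∃ Y0 : ℕ, 8 ≤ Y0 ∧ ∀ Y : ℕ, Y0 ≤ Y → 
    Real.log (8*Y+1) + 2 * √(8*Y) * Real.log (8*Y) ≤ 2 * Y := by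
  obtain ⟨C, hC, h⟩ := log_pow_le 1 (1/4) (by norm_num)
  refine ⟨⌈(100 * C + 8)^4⌉₊ + 8, by omega, fun Y hY => ?_⟩
  have hY1 : (100 * C + 8)^4 ≤ (Y:ℝ) := by
    refine (Nat.le_ceil _).trans ?_
    exact_mod_cast (by omega : ⌈(100 * C + 8)^4⌉₊ ≤ Y)
  have hY8 : (8:ℝ) ≤ Y := by exact_mod_cast (by omega : 8 ≤ Y)
  set u : ℝ := (Y:ℝ)^((1:ℝ)/4) with hu
  have hu4 : u^4 = Y := by
    rw [hu, ← Real.rpow_natCast, ← Real.rpow_mul (by positivity)]; norm_num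
  have hu0 : 0 ≤ u := by positivity
  have huC : 100 * C + 8 ≤ u := by
    by_contra hcon
    push Not at hcon
    have : u^4 < (100*C+8)^4 := by gcongr
    linarith
  have h1 : Real.log (8*Y+1) ≤ C * (2*u) := by
    have := h (8*Y+1) (by linarith)
    rw [pow_one] at this
    refine this.trans ?_
    gcongr
    have : ((8*Y+1:ℝ))^((1:ℝ)/4) ≤ ((2*u)^4)^((1:ℝ)/4) := by
      apply Real.rpow_le_rpow (by positivity) _ (by norm_num)
      rw [mul_pow, hu4]; linarith
    refine this.trans (le_of_eq ?_)
    rw [← Real.rpow_natCast, ← Real.rpow_mul (by positivity)]; norm_num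
  have h2 : Real.log (8*Y) ≤ C * (2*u) := by
    refine (Real.log_le_log (by positivity) (by linarith)).trans h1
  have h3 : √(8*Y) ≤ 3*u^2 := by
    rw [Real.sqrt_le_left (by positivity), ← hu4]; nlinarith [sq_nonneg (u^2)]
  have h4 : 2 * √(8*Y) * Real.log (8*Y) ≤ 2 * (3*u^2) * (C*(2*u)) := by
    gcongr
    all_goals first | positivity | (apply Real.log_nonneg; linarith)
  have h5 : C * (2*u) ≤ C*u^3 * 2 := by
    have : u ≤ u^3 := by nlinarith [sq_nonneg u, mul_nonneg hu0 hu0]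
    nlinarith
  have h6 : 100*C*u^3 ≤ u^4 := by
    have : 0 ≤ u^3 := by positivity
    nlinarith
  have : 0 ≤ C * u^3 := by positivity
  have h7 : 2 * (3*u^2) * (C*(2*u)) = 12 * (C * u^3) := by ring
  rw [hu4] at h6
  linarith

lemma M3 : ∃ Y0 : ℕ, 8 ≤ Y0 ∧ ∀ Y : ℕ, Y0 ≤ Y → (Y:ℝ) / Real.log Y ≤ (((Ico Y (8*Y)).filter Nat.Prime).card : ℝ) := by
  obtain ⟨Y0, h8, h⟩ := ev_M3
  refine ⟨Y0, h8, fun Y hY => ?_⟩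
  have hh := h Y hY
  have hY8 : (8:ℝ) ≤ Y := by exact_mod_cast (by omega : 8 ≤ Y)
  have hlog : 0 < Real.log Y := Real.log_pos (by linarith)
  have h1 := Chebyshev.theta_ge (8*Y)
  have h2 := Chebyshev.theta_le_log4_mul_x (x := (Y:ℝ)) (by positivity)
  have h4 : Real.log 4 = 2 * Real.log 2 := by
    rw [show (4:ℝ) = 2^2 by norm_num, Real.log_pow]; norm_num
  have h3 : Chebyshev.theta ((8*Y : ℕ):ℝ) ≤ Chebyshev.theta Y + (((Ico Y (8*Y)).filter Nat.Prime).card : ℝ) * Real.log (8*Y) := by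
    have hb : ∑ p ∈ (Ico Y (8*Y)).filter Nat.Prime, Real.log p ≤ (((Ico Y (8*Y)).filter Nat.Prime).card : ℝ) * Real.log (8*Y) := by
      rw [← nsmul_eq_mul]
      refine Finset.sum_le_card_nsmul _ _ _ fun p hp => ?_
      simp only [mem_filter, mem_Ico] at hp
      exact Real.log_le_log (by exact_mod_cast hp.2.pos) (by exact_mod_cast hp.1.2.le)
    refine le_trans ?_ (add_le_add_right hb _)
    unfold Chebyshev.theta
    rw [Nat.floor_natCast, Nat.floor_natCast, ← Finset.sum_union_inter]
    refine (Finset.sum_le_sum_of_subset_of_nonneg ?_ fun p hp _ => Real.log_natCast_nonneg p).trans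
      (le_add_of_nonneg_right (Finset.sum_nonneg fun p hp => Real.log_natCast_nonneg p))
    intro p hp
    simp only [mem_filter, mem_Ioc, mem_union, mem_Ico] at hp ⊢
    have : p ≠ 8*Y := by
      rintro rfl
      exact Nat.not_prime_mul (by norm_num) (by omega) hp.2
    rcases le_or_gt p Y with hpy | hpy
    · left; exact ⟨⟨hp.1.1, hpy⟩, hp.2⟩
    · right; exact ⟨⟨by omega, by omega⟩, hp.2⟩
  have h5 : Real.log (8*Y) ≤ 2 * Real.log Y := by
    rw [Real.log_mul (by norm_num) (by positivity)]
    have := Real.log_le_log (by norm_num) hY8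
    linarith
  rw [div_le_iff₀ hlog]
  push_cast at h1 h3
  have hc : (0:ℝ) ≤ (((Ico Y (8*Y)).filter Nat.Prime).card : ℝ) := by positivity
  have := Real.log_two_gt_d9
  have h6 := mul_le_mul_of_nonneg_left h5 hc
  have h7 : (Y:ℝ) * (2/3) ≤ Y * Real.log 2 := by gcongr; linarith
  rw [h4] at h2
  nlinarith
end SW
end

section
open Finset
namespace SW

/-- hypotheses on the modulus -/
def OKq (R : ℤ) (q : ℕ) : Prop := ∀ ℓ : ℕ, ℓ.Prime → ℓ ∣ q → 5 ≤ ℓ ∧ ¬ (ℓ : ℤ) ∣ R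

/-- density of good residues -/
noncomputable def al (R S : ℤ) (q : ℕ) [NeZero q] : ℝ := TT R S uni (1 : ZMod q)

lemma al_nonneg (R S : ℤ) (q : ℕ) [NeZero q] : 0 ≤ al R S q := TT_uni_nonneg R S _

lemma al_ge_inv (R S : ℤ) (q : ℕ) [NeZero q] (hq : OKq R q) : 1 / (2 * q : ℝ) ≤ al R S q := by
  refine le_trans ?_ (al_lower R S q hq)
  have h1 : q.primeFactors.card ≤ q := by
    have : q.primeFactors ⊆ Ioc 0 q := by
      intro p hp
      have hp1 := Nat.prime_of_mem_primeFactors hp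
      exact mem_Ioc.2 ⟨hp1.pos, Nat.le_of_dvd (NeZero.pos q) (Nat.dvd_of_mem_primeFactors hp)⟩
    simpa using Finset.card_le_card this
  have hq1 : (1:ℝ) ≤ q := by exact_mod_cast NeZero.pos q
  have h2 : (q.primeFactors.card : ℝ) ≤ q := by exact_mod_cast h1
  apply one_div_le_one_div_of_le
  · apply Real.sqrt_pos.2; positivity
  · rw [Real.sqrt_le_left (by positivity)]
    nlinarith

lemma uni_abs_le {A : Type*} [CommRing A] (w : A) : |uni w| ≤ 1 := by
  unfold uni; split_ifs <;> norm_num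
lemma uni_nonneg {A : Type*} [CommRing A] (w : A) : 0 ≤ uni w := by
  unfold uni; split_ifs <;> norm_num

lemma ev_pow (k : ℕ) (M : ℝ) : ∃ Y0 : ℕ, 8 ≤ Y0 ∧ ∀ Y : ℕ, Y0 ≤ Y → Real.log Y ^ k < Y ∧ M ≤ Real.log Y ∧ 1 ≤ Real.log Y := by
  obtain ⟨C, hC, h⟩ := log_pow_le k (1/2) (by norm_num)
  refine ⟨⌈C^2 + Real.exp M + 8⌉₊ + 8, by omega, fun Y hY => ?_⟩
  have hY1 : C^2 + Real.exp M + 8 ≤ (Y:ℝ) := by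
    refine (Nat.le_ceil _).trans ?_
    exact_mod_cast (by omega : ⌈C^2 + Real.exp M + 8⌉₊ ≤ Y)
  have he := Real.exp_pos M
  have hY8 : 8 < (Y:ℝ) := by nlinarith [sq_nonneg C]
  refine ⟨?_, ?_, ?_⟩
  · refine (h Y (by linarith)).trans_lt ?_
    rw [← Real.sqrt_eq_rpow]
    have h2 : C < √Y := Real.lt_sqrt_of_sq_lt (by linarith)
    have h3 : √(Y:ℝ) * √Y = Y := Real.mul_self_sqrt (by positivity)
    nlinarith
  · rw [Real.le_log_iff_exp_le (by positivity)]; nlinarith [sq_nonneg C]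
  · rw [Real.le_log_iff_exp_le (by positivity)]; linarith [Real.exp_one_lt_d9]

lemma good_block (R S : ℤ) (k : ℕ) : ∃ Y0 : ℕ, 8 ≤ Y0 ∧ ∀ Y : ℕ, Y0 ≤ Y → ∀ (q : ℕ) [NeZero q], OKq R q →
    (q:ℝ) ≤ Real.log Y ^ k → 
    al R S q / 2 * (Y / Real.log Y) ≤ ∑ p ∈ (Ico Y (8*Y)).filter Nat.Prime, uni ((R:ZMod q) * p + S) := by
  obtain ⟨C, hC, h⟩ := prime_eq (3*k+1)
  obtain ⟨Y1, hY1, h1⟩ := M3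
  obtain ⟨Y2, hY2, h2⟩ := ev_pow k (32*C)
  refine ⟨max Y1 Y2, by omega, fun Y hY q _ hOK hq => ?_⟩
  obtain ⟨h3, h4, h5⟩ := h2 Y (by omega)
  have h6 := h1 Y (by omega)
  have hqY : q < Y := by exact_mod_cast hq.trans_lt h3
  have h7 := h q (fun v => uni ((R:ZMod q) * v + S)) (fun v => uni_abs_le _) Y (8*Y) (by omega) (by omega) hqY
  have hα : (∑ u : (ZMod q)ˣ, uni ((R:ZMod q) * (u:ZMod q) + S)) / (Nat.totient q : ℝ) = al R S q := by
    unfold al TT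
    rw [ZMod.card_units_eq_totient]; simp
  rw [hα] at h7
  have h8 := (abs_le.1 h7).1
  have hα1 := al_ge_inv R S q hOK
  have hα0 := al_nonneg R S q
  have hq1 : (1:ℝ) ≤ q := by exact_mod_cast NeZero.pos q
  set l := Real.log Y
  have hl0 : 0 < l := by linarith
  have hY0 : (0:ℝ) < Y := by exact_mod_cast (by omega : 0 < Y)
  have h9 : C * q^2 * ((8*Y:ℕ):ℝ) / l^(3*k+1+1) ≤ al R S q / 2 * (Y / l) := by
    have : 1/(4*(q:ℝ)) * (Y/l) ≤ al R S q / 2 * (Y / l) := by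
      apply mul_le_mul_of_nonneg_right _ (by positivity)
      calc 1/(4*(q:ℝ)) = 1/(2*q)/2 := by field_simp; norm_num
        _ ≤ _ := by gcongr
    refine le_trans ?_ this
    rw [div_mul_div_comm, div_le_div_iff₀ (by positivity) (by positivity)]
    push_cast
    have e1 : (q:ℝ)^3 ≤ l^(3*k) := by
      calc (q:ℝ)^3 ≤ (l^k)^3 := by gcongr
        _ = _ := by rw [← pow_mul]; congr 1; ring
    calc C * q^2 * (8*Y) * (4*q*l) = (q:ℝ)^3 * (32 * C) * (Y*l) := by ring
      _ ≤ l^(3*k) * l * (Y*l) := by gcongr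
      _ = 1*Y*l^(3*k+1+1) := by ring
  have h10 : al R S q * (Y/l) ≤ al R S q * (((Ico Y (8*Y)).filter Nat.Prime).card : ℝ) := by gcongr
  linarith

lemma good_inv (R S : ℤ) (k : ℕ) : ∃ Y0 : ℕ, 8 ≤ Y0 ∧ ∀ i : ℕ, Y0 ≤ 8^i → ∀ (q : ℕ) [NeZero q], OKq R q →
    (q:ℝ) ≤ Real.log (8^i) ^ k → ∀ j, i ≤ j →
    al R S q / 40 * Real.log (j/i) ≤ ∑ p ∈ (Ico (8^i) (8^j)).filter Nat.Prime, uni ((R:ZMod q) * p + S) / p := by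
  obtain ⟨Y0, hY0, h⟩ := good_block R S k
  refine ⟨Y0, hY0, fun i hi q _ hOK hq j hj => ?_⟩
  have hi1 : 1 ≤ i := by
    by_contra hc
    have : i = 0 := by omega
    subst this; norm_num at hi; omega
  have hl8 : Real.log 8 ≤ 2.1 := by
    rw [show (8:ℝ) = 2^3 by norm_num, Real.log_pow]; have := Real.log_two_lt_d9; push_cast; linarith
  have hl80 : 0 < Real.log 8 := Real.log_pos (by norm_num)
  have hα0 := al_nonneg R S q
  induction j, hj using Nat.le_induction with
  | base => simp
  | succ j hj ih =>
    have hi0 : (0:ℝ) < i := by exact_mod_cast hi1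
    have hj0 : (0:ℝ) < j := by exact_mod_cast (by omega : 0 < j)
    have hsplit : (Ico (8^i) (8^(j+1))).filter Nat.Prime = (Ico (8^i) (8^j)).filter Nat.Prime ∪ (Ico (8^j) (8*8^j)).filter Nat.Prime := by
      rw [← Finset.filter_union, Finset.Ico_union_Ico_eq_Ico (Nat.pow_le_pow_right (by norm_num) hj) (by omega), pow_succ, mul_comm]
    rw [hsplit, Finset.sum_union]
    · have hmono : (8:ℕ)^i ≤ 8^j := Nat.pow_le_pow_right (by norm_num) hj
      have hb := h (8^j) (hi.trans hmono) q hOK (hq.trans (by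
        push_cast
        gcongr
        · apply Real.log_nonneg; exact_mod_cast Nat.one_le_pow _ _ (by norm_num)
        · norm_num))
      have hlow : al R S q / (40 * j) ≤ ∑ p ∈ (Ico (8^j) (8*8^j)).filter Nat.Prime, uni ((R:ZMod q) * p + S) / p := by
        calc al R S q / (40*j) ≤ al R S q / 2 * ((8^j:ℕ)/Real.log (8^j:ℕ)) / (8*8^j) := by
              push_cast
              rw [Real.log_pow]
              have : al R S q / 2 * ((8^j:ℝ)/(j * Real.log 8)) / (8*8^j) = al R S q / (16 * j * Real.log 8) := by
                field_simp; ring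
              rw [this]
              apply div_le_div_of_nonneg_left hα0 (by positivity)
              nlinarith
          _ ≤ (∑ p ∈ (Ico (8^j) (8*8^j)).filter Nat.Prime, uni ((R:ZMod q) * p + S)) / (8*8^j) := by
              gcongr
          _ ≤ _ := by
              rw [Finset.sum_div]
              refine Finset.sum_le_sum fun p hp => ?_
              simp only [mem_filter, mem_Ico] at hp
              have : (0:ℝ) < p := by exact_mod_cast hp.2.pos
              apply div_le_div_of_nonneg_left (uni_nonneg _) this
              exact_mod_cast hp.1.2.le
      have hlog : Real.log ((j+1:ℕ)/i) ≤ Real.log (j/i) + 1/j := by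
        have e : ((j+1:ℕ):ℝ)/i = (j/i) * (1 + 1/j) := by push_cast; field_simp
        rw [e, Real.log_mul (by positivity) (by positivity)]
        have := Real.log_le_sub_one_of_pos (show (0:ℝ) < 1 + 1/j by positivity)
        linarith
      have : al R S q / 40 * Real.log ((j+1:ℕ)/i) ≤ al R S q / 40 * (Real.log (j/i) + 1/j) := by gcongr
      have e2 : al R S q / (40 * j) = al R S q / 40 * (1/j) := by field_simp
      rw [e2] at hlow
      linarith
    · refine Finset.disjoint_filter_filter ?_
      rw [Finset.disjoint_left]
      intro a ha hb
      simp only [mem_Ico] at ha hb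
      omega
end SW
end

section
open Finset
namespace SW

/-- all prime factors at most z -/
def Smo (z m : ℕ) : Prop := ∀ p : ℕ, p.Prime → p ∣ m → p ≤ z

noncomputable def powHom (s : ℝ) : ℕ →* ℝ where
  toFun n := (n:ℝ)^s
  map_one' := by simp
  map_mul' a b := by push_cast; exact Real.mul_rpow (by positivity) (by positivity)

lemma euler_factor (σ : ℝ) (z p : ℕ) (hσ : σ = 1 / Real.log z) (hz4 : 4 ≤ Real.log z) (hp2 : 2 ≤ p) (hpz : p ≤ z) :
    (p:ℝ)^(σ-1) < 1 ∧ (1 - (p:ℝ)^(σ-1))⁻¹ ≤ Real.exp (7 * (1 / p)) := by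
  have hp0 : (0:ℝ) < p := by exact_mod_cast (by omega : 0 < p)
  have hp2' : (2:ℝ) ≤ p := by exact_mod_cast hp2
  have hσ4 : σ ≤ 1/4 := by rw [hσ]; apply one_div_le_one_div_of_le <;> linarith
  have hσ0 : 0 ≤ σ := by rw [hσ]; positivity
  set t := (p:ℝ)^(σ-1) with ht
  have ht0 : 0 < t := by positivity
  have h1 : t ≤ 3/5 := by
    calc t ≤ (2:ℝ)^(σ-1) := Real.rpow_le_rpow_of_nonpos (by norm_num) hp2' (by linarith)
      _ ≤ (2:ℝ)^(-(3/4):ℝ) := Real.rpow_le_rpow_of_exponent_le (by norm_num) (by linarith)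
      _ ≤ 3/5 := by
        rw [Real.rpow_neg (by norm_num)]
        rw [inv_le_comm₀ (by positivity) (by norm_num)]
        have : ((5/3:ℝ)^4)^((1:ℝ)/4) ≤ (8:ℝ)^((1:ℝ)/4) := Real.rpow_le_rpow (by norm_num) (by norm_num) (by norm_num)
        rw [← Real.rpow_natCast, ← Real.rpow_mul (by norm_num), show (8:ℝ) = 2^(3:ℝ) by norm_num, ← Real.rpow_mul (by norm_num)] at this
        norm_num at this ⊢
        exact this
  have h2 : t ≤ Real.exp 1 / p := by
    rw [ht, Real.rpow_sub hp0, Real.rpow_one]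
    gcongr
    calc (p:ℝ)^σ ≤ (z:ℝ)^σ := Real.rpow_le_rpow hp0.le (by exact_mod_cast hpz) hσ0
      _ = Real.exp 1 := by
        have hz0 : (0:ℝ) < z := by exact_mod_cast (by omega : 0 < z)
        rw [Real.rpow_def_of_pos hz0, hσ]
        congr 1
        field_simp
  refine ⟨by linarith, ?_⟩
  have h3 : (1-t)⁻¹ = t/(1-t) + 1 := by
    have : (1-t) ≠ 0 := by linarith
    field_simp; ring
  rw [h3]
  refine (Real.add_one_le_exp _).trans (Real.exp_le_exp.2 ?_)
  have h4 : t/(1-t) ≤ 5/2*t := by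
    rw [div_le_iff₀ (by linarith)]; nlinarith
  have h5 : Real.exp 1 / p ≤ 2.75 / p := by
    gcongr; linarith [Real.exp_one_lt_d9]
  have h6 : (2.75:ℝ)/p * (5/2) ≤ 7 * (1/p) := by
    rw [div_mul_eq_mul_div, mul_one_div]
    gcongr; norm_num
  linarith

lemma tail_smooth (z : ℕ) (hz4 : 4 ≤ Real.log z) (V : ℝ) (hV : 0 < V) (T : Finset ℕ)
    (hT : ∀ m ∈ T, V ≤ m ∧ Smo z m) :
    ∑ m ∈ T, (1:ℝ)/m ≤ Real.exp 98 * (Real.log z)^42 * V^(-(1/Real.log z)) := by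
  set σ := 1 / Real.log z with hσ
  have hσ4 : σ ≤ 1/4 := by rw [hσ]; apply one_div_le_one_div_of_le <;> linarith
  have hσ0 : 0 ≤ σ := by rw [hσ]; positivity
  have hz3 : 3 ≤ z := by
    by_contra hc
    have : (z:ℝ) ≤ 3 := by exact_mod_cast (by omega : z ≤ 3)
    have h1 := Real.log_le_sub_one_of_pos (show (0:ℝ) < z by
      by_contra h
      have : (z:ℝ) = 0 := le_antisymm (not_lt.1 h) (by positivity)
      rw [this] at hz4; norm_num at hz4)
    linarith
  have hE := (EulerProduct.summable_and_hasSum_smoothNumbers_prod_primesBelow_geometric (f := powHom (σ-1)) (by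
    intro p hp
    show ‖(p:ℝ)^(σ-1)‖ < 1
    rw [Real.norm_of_nonneg (by positivity)]
    apply Real.rpow_lt_one_of_one_lt_of_neg
    · exact_mod_cast hp.one_lt
    · linarith) (z+1)).2
  have hE2 : HasSum (Set.indicator (Nat.smoothNumbers (z+1)) (fun m : ℕ => (m:ℝ)^(σ-1))) (∏ p ∈ (z+1).primesBelow, (1 - (p:ℝ)^(σ-1))⁻¹) := by
    rw [← hasSum_subtype_iff_indicator]
    exact hE
  have hm : ∀ m ∈ T, (1:ℝ)/m ≤ V^(-σ) * Set.indicator (Nat.smoothNumbers (z+1)) (fun m : ℕ => (m:ℝ)^(σ-1)) m := by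
    intro m hm
    obtain ⟨h1, h3⟩ := hT m hm
    have hm0 : (0:ℝ) < m := by linarith
    have hmem : m ∈ Nat.smoothNumbers (z+1) := by
      rw [Nat.mem_smoothNumbers']
      intro p hp hpm
      have := h3 p hp hpm; omega
    rw [Set.indicator_of_mem hmem]
    have h4 : (m:ℝ)^(-σ) ≤ V^(-σ) := Real.rpow_le_rpow_of_nonpos hV h1 (by linarith)
    calc (1:ℝ)/m = (m:ℝ)^(-σ) * (m:ℝ)^(σ-1) := by
          rw [← Real.rpow_add hm0, show -σ + (σ-1) = -1 by ring, Real.rpow_neg_one, one_div]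
      _ ≤ _ := by gcongr
  have hprod : (∏ p ∈ (z+1).primesBelow, (1 - (p:ℝ)^(σ-1))⁻¹) ≤ Real.exp 98 * (Real.log z)^42 := by
    calc _ ≤ ∏ p ∈ (z+1).primesBelow, Real.exp (7 * (1/p)) := by
          refine Finset.prod_le_prod (fun p hp => ?_) fun p hp => ?_
          all_goals 
            have hp1 := Nat.prime_of_mem_primesBelow hp
            have hp2 := Nat.lt_of_mem_primesBelow hp
            have := euler_factor σ z p hσ hz4 hp1.two_le (by omega)
          · rw [inv_nonneg]; linarith
          · exact this.2
      _ = Real.exp (7 * ∑ p ∈ (z+1).primesBelow, (1:ℝ)/p) := by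
          rw [← Real.exp_sum, Finset.mul_sum]
      _ ≤ Real.exp (98 + 42 * Real.log (Real.log z)) := by
          apply Real.exp_le_exp.2
          have := mertens z hz3
          have e : (z+1).primesBelow = (Ioc 0 z).filter Nat.Prime := by
            ext p
            simp only [Nat.mem_primesBelow, mem_filter, mem_Ioc]
            constructor
            · rintro ⟨a, b⟩; exact ⟨⟨b.pos, by omega⟩, b⟩
            · rintro ⟨⟨_, a⟩, b⟩; exact ⟨by omega, b⟩
          rw [e]; linarith
      _ = _ := by
          rw [Real.exp_add, mul_comm (42:ℝ), Real.exp_mul, Real.exp_log (by linarith)]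
          norm_cast
  have hnn : ∀ m, 0 ≤ Set.indicator (Nat.smoothNumbers (z+1)) (fun m : ℕ => (m:ℝ)^(σ-1)) m := by
    intro m; apply Set.indicator_nonneg; intro x _; positivity
  calc _ ≤ ∑ m ∈ T, V^(-σ) * Set.indicator (Nat.smoothNumbers (z+1)) (fun m : ℕ => (m:ℝ)^(σ-1)) m := Finset.sum_le_sum hm
    _ = V^(-σ) * ∑ m ∈ T, Set.indicator (Nat.smoothNumbers (z+1)) (fun m : ℕ => (m:ℝ)^(σ-1)) m := by rw [Finset.mul_sum]
    _ ≤ V^(-σ) * (Real.exp 98 * (Real.log z)^42) := by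
      gcongr
      exact (sum_le_hasSum T (fun m _ => hnn m) hE2).trans hprod
    _ = _ := by ring
end SW
end

section
open Finset
namespace SW

noncomputable def QQ {A : Type*} [CommRing A] (PP : Finset ℕ) (F : ℕ → A) (X j : ℕ) : ℝ :=
  ∑ m ∈ (Ioc 0 X).filter (fun m => DD PP m ≤ j), uni (F m) / m

lemma QQ_nonneg {A : Type*} [CommRing A] (PP : Finset ℕ) (F : ℕ → A) (X j : ℕ) : 0 ≤ QQ PP F X j :=
  Finset.sum_nonneg fun m _ => div_nonneg (uni_nonneg _) (by positivity)

lemma geom_le (p X : ℕ) (hp : 2 ≤ p) : ∑ e ∈ Ioc 0 X, (1:ℝ)/p^e ≤ 2 / p := by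
  have hp' : (2:ℝ) ≤ p := by exact_mod_cast hp
  have h : ∀ X : ℕ, ∑ e ∈ Ioc 0 X, (1:ℝ)/p^e ≤ 2/p - 2/p^(X+1) := by
    intro X
    induction X with
    | zero => simp
    | succ n ih =>
      rw [← Finset.insert_Ioc_right_eq_Ioc_add_one (Nat.zero_le n), Finset.sum_insert (by simp)]
      have : (2:ℝ)/p^(n+1+1) ≤ 1/p^(n+1) := by
        rw [div_le_div_iff₀ (by positivity) (by positivity), pow_succ _ (n+1)]
        nlinarith [show (0:ℝ) < p^(n+1) by positivity]
      have e : (2:ℝ)/p^(n+1) = 1/p^(n+1) + 1/p^(n+1) := by ring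
      linarith [e]
  refine (h X).trans ?_
  have : (0:ℝ) ≤ 2/p^(X+1) := by positivity
  linarith

lemma DD_ordCompl (PP : Finset ℕ) (hPP : ∀ P ∈ PP, P.Prime) (m p : ℕ) (hm : 0 < m) (hp : p ∈ PP) (h : p ∣ m) :
    DD PP (m / p ^ m.factorization p) + 1 ≤ DD PP m := by
  unfold DD
  have : insert p (PP.filter (· ∣ m / p ^ m.factorization p)) ⊆ PP.filter (· ∣ m) := by
    intro r hr
    rw [mem_insert, mem_filter] at hr
    rw [mem_filter]
    rcases hr with rfl | ⟨h1, h2⟩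
    · exact ⟨hp, h⟩
    · exact ⟨h1, h2.trans (Nat.ordCompl_dvd m p)⟩
  have h2 := Finset.card_le_card this
  rwa [Finset.card_insert_of_notMem] at h2
  rw [mem_filter, not_and]
  intro _
  exact Nat.not_dvd_ordCompl (hPP p hp) (by omega)

lemma Qp_le {A : Type*} [CommRing A] (F : ℕ → A) (hF : ∀ m n : ℕ, Nat.Coprime m n → F (m * n) = F m * F n)
    (PP : Finset ℕ) (hPP : ∀ P ∈ PP, P.Prime) (X j p : ℕ) (hp : p ∈ PP) :
    ∑ m ∈ (Ioc 0 X).filter (fun m => DD PP m ≤ j + 1 ∧ p ∣ m), uni (F m) / m ≤ 2 / p * QQ PP F X j := by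
  have hpp := hPP p hp
  set s := (Ioc 0 X).filter (fun m => DD PP m ≤ j + 1 ∧ p ∣ m) with hs
  set t := (Ioc 0 X) ×ˢ ((Ioc 0 X).filter (fun m => DD PP m ≤ j)) with ht
  let i : ℕ → ℕ × ℕ := fun m => (m.factorization p, m / p ^ m.factorization p)
  let w : ℕ × ℕ → ℝ := fun x => (1 / p^x.1) * (uni (F x.2) / x.2)
  have hw0 : ∀ x, 0 ≤ w x := fun x => mul_nonneg (by positivity) (div_nonneg (uni_nonneg _) (by positivity))
  have hinj : Set.InjOn i s := by
    intro m hm m' hm' h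
    have e1 := Nat.ordProj_mul_ordCompl_eq_self m p
    have e2 := Nat.ordProj_mul_ordCompl_eq_self m' p
    have h1 : m.factorization p = m'.factorization p := congrArg Prod.fst h
    have h2 : m / p ^ m.factorization p = m' / p ^ m'.factorization p := congrArg Prod.snd h
    rw [← e1, ← e2, h2, h1]
  have hmap : ∀ m ∈ s, i m ∈ t := by
    intro m hm
    rw [hs, mem_filter, mem_Ioc] at hm
    obtain ⟨⟨hm0, hmX⟩, hD, hpm⟩ := hm
    rw [ht, mem_product, mem_filter, mem_Ioc, mem_Ioc]
    refine ⟨⟨?_, ?_⟩, ⟨⟨?_, ?_⟩, ?_⟩⟩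
    · exact hpp.factorization_pos_of_dvd (by omega) hpm
    · exact (Nat.factorization_lt p (by omega)).le.trans hmX
    · exact Nat.ordCompl_pos p (by omega)
    · exact (Nat.div_le_self _ _).trans hmX
    · have := DD_ordCompl PP hPP m p hm0 hp hpm
      show DD PP (m / p ^ m.factorization p) ≤ j
      omega
  have hle : ∀ m ∈ s, uni (F m) / m ≤ w (i m) := by
    intro m hm
    rw [hs, mem_filter, mem_Ioc] at hm
    obtain ⟨⟨hm0, hmX⟩, hD, hpm⟩ := hm
    have e1 := Nat.ordProj_mul_ordCompl_eq_self m p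
    by_cases hu : IsUnit (F m)
    · rw [uni_unit hu]
      have hc : Nat.Coprime (p ^ m.factorization p) (m / p ^ m.factorization p) :=
        (Nat.coprime_ordCompl hpp (by omega)).pow_left _
      have hFe := hF _ _ hc
      rw [e1] at hFe
      have hu2 : IsUnit (F (m / p ^ m.factorization p)) := by
        rw [hFe] at hu; exact isUnit_of_mul_isUnit_right hu
      show 1 / (m:ℝ) ≤ 1 / p^(m.factorization p) * (uni (F (m / p ^ m.factorization p)) / ((m / p ^ m.factorization p : ℕ):ℝ))
      rw [uni_unit hu2, div_mul_div_comm, one_mul]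
      apply le_of_eq
      congr 1
      exact_mod_cast e1.symm
    · rw [uni_nonunit hu, zero_div]; exact hw0 _
  calc ∑ m ∈ s, uni (F m) / m ≤ ∑ m ∈ s, w (i m) := Finset.sum_le_sum hle
    _ = ∑ x ∈ s.image i, w x := (Finset.sum_image hinj).symm
    _ ≤ ∑ x ∈ t, w x := by
      refine Finset.sum_le_sum_of_subset_of_nonneg ?_ fun x _ _ => hw0 x
      exact Finset.image_subset_iff.2 hmap
    _ = (∑ e ∈ Ioc 0 X, (1:ℝ)/p^e) * QQ PP F X j := by
      rw [ht, Finset.sum_product, Finset.sum_mul]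
      refine Finset.sum_congr rfl fun e _ => ?_
      unfold QQ
      rw [Finset.mul_sum]
    _ ≤ _ := by
      apply mul_le_mul_of_nonneg_right _ (QQ_nonneg _ _ _ _)
      exact geom_le p X hpp.two_le

lemma QQ_succ {A : Type*} [CommRing A] (F : ℕ → A) (hF : ∀ m n : ℕ, Nat.Coprime m n → F (m * n) = F m * F n)
    (PP : Finset ℕ) (hPP : ∀ P ∈ PP, P.Prime) (X j : ℕ) :
    QQ PP F X (j+1) ≤ QQ PP F X 0 + (2 * ∑ P ∈ PP, (1:ℝ)/P) * QQ PP F X j := by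
  have hw : ∀ m : ℕ, 0 ≤ uni (F m) / (m:ℝ) := fun m => div_nonneg (uni_nonneg _) (by positivity)
  have h1 : QQ PP F X (j+1) ≤ QQ PP F X 0 + ∑ P ∈ PP, ∑ m ∈ (Ioc 0 X).filter (fun m => DD PP m ≤ j + 1 ∧ P ∣ m), uni (F m) / m := by
    unfold QQ
    simp_rw [Finset.sum_filter]
    rw [Finset.sum_comm, ← Finset.sum_add_distrib]
    refine Finset.sum_le_sum fun m hm => ?_
    have h0 : ∀ P ∈ PP, (0:ℝ) ≤ if DD PP m ≤ j + 1 ∧ P ∣ m then uni (F m) / (m:ℝ) else 0 := by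
      intro P _; split_ifs; exacts [hw m, le_rfl]
    by_cases hD : DD PP m ≤ j+1
    · rw [if_pos hD]
      by_cases hD0 : DD PP m ≤ 0
      · rw [if_pos hD0]; exact le_add_of_nonneg_right (Finset.sum_nonneg h0)
      · rw [if_neg hD0, zero_add]
        have : 0 < (PP.filter (· ∣ m)).card := by unfold DD at hD0; omega
        obtain ⟨P, hP⟩ := Finset.card_pos.1 this
        rw [mem_filter] at hP
        refine le_trans ?_ (Finset.single_le_sum h0 hP.1)
        rw [if_pos ⟨hD, hP.2⟩]
    · rw [if_neg hD]
      refine add_nonneg ?_ (Finset.sum_nonneg h0)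
      split_ifs; exacts [hw m, le_rfl]
  refine h1.trans (add_le_add_right ?_ _)
  rw [mul_assoc, Finset.sum_mul, Finset.mul_sum]
  refine Finset.sum_le_sum fun P hP => ?_
  refine (Qp_le F hF PP hPP X j P hP).trans (le_of_eq ?_)
  ring

lemma QQ_le {A : Type*} [CommRing A] (F : ℕ → A) (hF : ∀ m n : ℕ, Nat.Coprime m n → F (m * n) = F m * F n)
    (PP : Finset ℕ) (hPP : ∀ P ∈ PP, P.Prime) (X : ℕ) (s : ℝ) (hs : 2 * ∑ P ∈ PP, (1:ℝ)/P ≤ s) (hs0 : 0 ≤ s) (j : ℕ) :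
    QQ PP F X j ≤ (1 + s)^j * QQ PP F X 0 := by
  induction j with
  | zero => simp
  | succ j ih =>
    have h0 := QQ_nonneg PP F X 0
    have hj := QQ_nonneg PP F X j
    refine (QQ_succ F hF PP hPP X j).trans ?_
    have h1 : (2 * ∑ P ∈ PP, (1:ℝ)/P) * QQ PP F X j ≤ s * ((1+s)^j * QQ PP F X 0) := by gcongr
    have h2 : 1 * QQ PP F X 0 ≤ (1+s)^j * QQ PP F X 0 := by
      apply mul_le_mul_of_nonneg_right _ h0
      apply one_le_pow₀; linarith
    rw [pow_succ]; nlinarith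
end SW
end

section
open Finset
namespace SW

lemma ind_nonneg {A : Type*} (a w : A) : 0 ≤ ind a w := by unfold ind; split_ifs <;> norm_num
lemma ind_le_one {A : Type*} (a w : A) : ind a w ≤ 1 := by unfold ind; split_ifs <;> norm_num

lemma inv_sq_sum (z X : ℕ) (hz : 1 ≤ z) : ∑ p ∈ (Ioc z X).filter Nat.Prime, (1:ℝ)/(p:ℝ)^2 ≤ 1 / z := by
  refine (Finset.sum_le_sum_of_subset_of_nonneg (Finset.filter_subset _ _) fun p _ _ => by positivity).trans ?_
  rcases le_or_gt z X with h | h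
  · have := sum_Ioc_inv_sq_le_sub (α := ℝ) (k := z) (n := X) (by omega) h
    simp only [one_div]
    refine this.trans ?_
    have : (0:ℝ) ≤ (X:ℝ)⁻¹ := by positivity
    linarith
  · rw [Finset.Ioc_eq_empty (by omega)]; simp

lemma DD_mono (PP : Finset ℕ) {m n : ℕ} (h : m ∣ n) : DD PP m ≤ DD PP n := by
  unfold DD
  apply Finset.card_le_card
  intro p hp
  rw [mem_filter] at hp ⊢
  exact ⟨hp.1, hp.2.trans h⟩

lemma sum_div_le (X p : ℕ) (hp : 0 < p) (k : ℕ → ℝ) (hk : ∀ m, 0 ≤ k m) :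
    ∑ n ∈ Ioc 0 X, (if p ∣ n then k (n / p) else 0) ≤ ∑ m ∈ Ioc 0 X, if p ≤ X / m then k m else 0 := by
  rw [← Finset.sum_filter, ← Finset.sum_filter, sum_mult X p hp]
  have : ∀ m ∈ Ioc 0 (X/p), k (m * p / p) = k m := fun m _ => by rw [Nat.mul_div_cancel m hp]
  rw [Finset.sum_congr rfl this]
  refine Finset.sum_le_sum_of_subset_of_nonneg ?_ fun m _ _ => hk _
  intro m hm
  rw [mem_Ioc] at hm
  rw [mem_filter, mem_Ioc]
  refine ⟨⟨hm.1, hm.2.trans (Nat.div_le_self _ _)⟩, ?_⟩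
  rw [Nat.le_div_iff_mul_le hm.1, mul_comm]
  exact (Nat.le_div_iff_mul_le hp).1 hm.2

open Classical in
lemma inconv_comb {A : Type*} [CommRing A] (R S : ℤ) (F : ℕ → A) (hF : ∀ m n : ℕ, Nat.Coprime m n → F (m * n) = F m * F n)
    (hFp : ∀ p : ℕ, p.Prime → F p = R * (p:A) + S) (a : A) (ha : IsUnit a) (PP : Finset ℕ)
    (z X j : ℕ) (hz : 1 ≤ z) (V τ κ : ℝ) (hV : 0 ≤ V) (hκ : 0 ≤ κ)
    (hτ : ∀ T : Finset ℕ, (∀ m ∈ T, V ≤ m ∧ Smo z m) → ∑ m ∈ T, (1:ℝ)/m ≤ τ)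
    (Hκ : ∀ w : A, IsUnit w → ∀ Z : ℕ, ∑ p ∈ (Ioc z Z).filter Nat.Prime, ind a (w * (R * (p:A) + S)) ≤ κ * Z) :
    ∑ n ∈ (Ioc 0 X).filter (fun n => DD PP n ≤ j), ind a (F n) ≤ V + X * τ + X / z + κ * X * QQ PP F X j := by
  let k1 : ℕ → ℝ := fun n => if (n:ℝ) < V then 1 else 0
  let k2 : ℕ → ℝ := fun n => if V ≤ n ∧ Smo z n then X * ((1:ℝ)/n) else 0
  let k4 : ℕ → ℕ → ℝ := fun p m => if DD PP m ≤ j then uni (F m) * ind a (F m * (R * (p:A) + S)) else 0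
  have hk4 : ∀ p m, 0 ≤ k4 p m := by
    intro p m; simp only [k4]; split_ifs
    · exact mul_nonneg (uni_nonneg _) (ind_nonneg _ _)
    · exact le_rfl
  have hk1 : ∀ n, 0 ≤ k1 n := fun n => by simp only [k1]; split_ifs <;> norm_num
  have hk2 : ∀ n, 0 ≤ k2 n := fun n => by simp only [k2]; split_ifs <;> positivity
  set Pz := (Ioc z X).filter Nat.Prime with hPz
  have hpt : ∀ n ∈ Ioc 0 X, (if DD PP n ≤ j then ind a (F n) else 0) ≤ 
      k1 n + k2 n + (∑ p ∈ Pz, if p^2 ∣ n then (1:ℝ) else 0) + ∑ p ∈ Pz, if p ∣ n then k4 p (n / p) else 0 := by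
    intro n hn
    rw [mem_Ioc] at hn
    have n3 : ∀ p ∈ Pz, (0:ℝ) ≤ if p^2 ∣ n then (1:ℝ) else 0 := fun p _ => by split_ifs <;> norm_num
    have n4 : ∀ p ∈ Pz, (0:ℝ) ≤ if p ∣ n then k4 p (n / p) else 0 := fun p _ => by
      split_ifs
      · exact hk4 _ _
      · exact le_rfl
    have s3 := Finset.sum_nonneg n3
    have s4 := Finset.sum_nonneg n4
    have a1 := hk1 n
    have a2 := hk2 n
    by_cases hD : DD PP n ≤ j
    swap
    · rw [if_neg hD]; linarith
    rw [if_pos hD]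
    by_cases hn1 : (n:ℝ) < V
    · have : k1 n = 1 := if_pos hn1
      linarith [ind_le_one a (F n)]
    by_cases hsm : Smo z n
    · have : k2 n = X * ((1:ℝ)/n) := if_pos ⟨not_lt.1 hn1, hsm⟩
      have hn0 : (0:ℝ) < n := by exact_mod_cast hn.1
      have : 1 ≤ k2 n := by
        rw [this, mul_one_div, le_div_iff₀ hn0, one_mul]; exact_mod_cast hn.2
      linarith [ind_le_one a (F n)]
    unfold Smo at hsm
    push Not at hsm
    obtain ⟨p, hp, hpn, hpz⟩ := hsm
    have hpX : p ≤ X := (Nat.le_of_dvd hn.1 hpn).trans hn.2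
    have hpPz : p ∈ Pz := by rw [hPz, mem_filter, mem_Ioc]; exact ⟨⟨hpz, hpX⟩, hp⟩
    by_cases hp2 : p^2 ∣ n
    · have := Finset.single_le_sum n3 hpPz
      rw [if_pos hp2] at this
      linarith [ind_le_one a (F n)]
    have h4 := Finset.single_le_sum n4 hpPz
    rw [if_pos hpn] at h4
    suffices ind a (F n) ≤ k4 p (n/p) by linarith
    obtain ⟨m, rfl⟩ := hpn
    rw [Nat.mul_div_cancel_left m hp.pos]
    have hcop : Nat.Coprime p m := by
      rw [hp.coprime_iff_not_dvd]
      rintro ⟨c, rfl⟩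
      exact hp2 ⟨c, by ring⟩
    have hFe := hF p m hcop
    rw [hFp p hp, mul_comm (R * (p:A) + S)] at hFe
    simp only [k4]
    rw [if_pos ((DD_mono PP (Dvd.intro_left p rfl)).trans hD), hFe]
    by_cases he : F m * (R * (p:A) + S) = a
    · have hu : IsUnit (F m) := isUnit_of_mul_isUnit_left (he ▸ ha)
      rw [uni_unit hu, one_mul]
    · rw [ind_apply, if_neg he]; simp
  rw [Finset.sum_filter]
  refine (Finset.sum_le_sum hpt).trans ?_
  rw [Finset.sum_add_distrib, Finset.sum_add_distrib, Finset.sum_add_distrib]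
  have b1 : ∑ n ∈ Ioc 0 X, k1 n ≤ V := by
    simp only [k1]
    rw [Finset.sum_boole]
    have : (Ioc 0 X).filter (fun n : ℕ => (n:ℝ) < V) ⊆ Ioc 0 ⌊V⌋₊ := by
      intro n hn
      rw [mem_filter, mem_Ioc] at hn
      rw [mem_Ioc]
      exact ⟨hn.1.1, Nat.le_floor hn.2.le⟩
    have h2 := Finset.card_le_card this
    rw [Nat.card_Ioc] at h2
    calc _ ≤ (⌊V⌋₊ : ℝ) := by exact_mod_cast h2
      _ ≤ V := Nat.floor_le hV
  have b2 : ∑ n ∈ Ioc 0 X, k2 n ≤ X * τ := by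
    simp only [k2]
    rw [← Finset.sum_filter, ← Finset.mul_sum]
    gcongr
    apply hτ
    intro m hm
    exact (mem_filter.1 hm).2
  have b3 : ∑ n ∈ Ioc 0 X, (∑ p ∈ Pz, if p^2 ∣ n then (1:ℝ) else 0) ≤ X / z := by
    rw [Finset.sum_comm]
    calc _ ≤ ∑ p ∈ Pz, X * ((1:ℝ)/(p:ℝ)^2) := by
          refine Finset.sum_le_sum fun p hp => ?_
          rw [Finset.sum_boole, Nat.Ioc_filter_dvd_card_eq_div]
          rw [mul_one_div]
          exact_mod_cast Nat.cast_div_le (α := ℝ)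
      _ ≤ _ := by
          rw [← Finset.mul_sum, div_eq_mul_one_div]
          gcongr
          exact inv_sq_sum z X hz
  have b4 : ∑ n ∈ Ioc 0 X, (∑ p ∈ Pz, if p ∣ n then k4 p (n / p) else 0) ≤ κ * X * QQ PP F X j := by
    rw [Finset.sum_comm]
    have e1 : ∀ p ∈ Pz, ∑ n ∈ Ioc 0 X, (if p ∣ n then k4 p (n / p) else 0) ≤ ∑ m ∈ Ioc 0 X, if p ≤ X / m then k4 p m else 0 := by
      intro p hp
      rw [hPz, mem_filter, mem_Ioc] at hp
      exact sum_div_le X p hp.2.pos (k4 p) (hk4 p)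
    refine (Finset.sum_le_sum e1).trans ?_
    rw [Finset.sum_comm]
    unfold QQ
    rw [Finset.sum_filter, Finset.mul_sum]
    refine Finset.sum_le_sum fun m hm => ?_
    rw [mem_Ioc] at hm
    simp only [k4]
    by_cases hD : DD PP m ≤ j
    swap
    · simp [hD]
    simp only [if_pos hD]
    by_cases hu : IsUnit (F m)
    swap
    · simp [uni_nonunit hu]
    rw [uni_unit hu, ← Finset.sum_filter]
    simp only [one_mul]
    have hsub : Pz.filter (fun p => p ≤ X / m) ⊆ (Ioc z (X/m)).filter Nat.Prime := by
      intro p hp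
      rw [mem_filter, hPz, mem_filter, mem_Ioc] at hp
      rw [mem_filter, mem_Ioc]
      exact ⟨⟨hp.1.1.1, hp.2⟩, hp.1.2⟩
    refine (Finset.sum_le_sum_of_subset_of_nonneg hsub fun p _ _ => ind_nonneg _ _).trans ?_
    refine (Hκ (F m) hu (X/m)).trans ?_
    rw [mul_assoc, mul_one_div]
    gcongr
    exact Nat.cast_div_le
  linarith
end SW
end

section
open Finset
namespace SW

lemma R_unit (R : ℤ) (q : ℕ) (hq : OKq R q) : IsUnit ((R : ℤ) : ZMod q) := by
  rw [ZMod.coe_int_isUnit_iff_isCoprime, Int.isCoprime_iff_gcd_eq_one]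
  show Nat.Coprime _ _
  rw [Int.natAbs_natCast]
  refine Nat.coprime_of_dvd fun p hp h1 h2 => ?_
  exact (hq p hp h1).2 (Int.natCast_dvd.2 h2)

lemma mean_ind_le (R S : ℤ) (q : ℕ) [NeZero q] (hq : OKq R q) (a w : ZMod q) (hw : IsUnit w) :
    ∑ u : (ZMod q)ˣ, ind a (w * ((R:ZMod q) * (u:ZMod q) + S)) ≤ 1 := by
  classical
  have hR := R_unit R q hq
  simp only [ind_apply]
  rw [Finset.sum_boole]
  norm_cast
  rw [Finset.card_le_one]
  intro u hu v hv
  rw [mem_filter] at hu hv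
  have h := hu.2.trans hv.2.symm
  have h1 := hw.mul_left_cancel h
  have h2 := hR.mul_left_cancel (add_right_cancel h1)
  exact Units.ext h2

lemma kap (R S : ℤ) (k : ℕ) : ∃ z0 : ℕ, 8 ≤ z0 ∧ ∀ z : ℕ, z0 ≤ z → ∀ (q : ℕ) [NeZero q], OKq R q →
    (q:ℝ) ≤ Real.log z ^ k → ∀ (a w : ZMod q), IsUnit w → ∀ Z : ℕ, 
    ∑ p ∈ (Ioc z Z).filter Nat.Prime, ind a (w * ((R:ZMod q) * (p : ZMod q) + S)) ≤ 4 / (Nat.totient q * Real.log z) * Z := by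
  obtain ⟨C, hC, h⟩ := prime_eq (3*k+1)
  obtain ⟨Y2, hY2, h2⟩ := ev_pow k C
  refine ⟨Y2, hY2, fun z hz q _ hOK hq a w hw Z => ?_⟩
  obtain ⟨h3, h4, h5⟩ := h2 z hz
  have hl0 : 0 < Real.log z := by linarith
  rcases le_or_gt Z z with hZ | hZ
  · rw [Finset.Ioc_eq_empty (by omega)]; simp; positivity
  have hqz : q < z := by exact_mod_cast hq.trans_lt h3
  have h7 := h q (fun v => ind a (w * ((R:ZMod q) * v + S))) (fun v => by
    rw [abs_of_nonneg (ind_nonneg _ _)]; exact ind_le_one _ _) (z+1) (Z+1) (by omega) (by omega) (by omega)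
  have e : Ico (z+1) (Z+1) = Ioc z Z := by ext p; simp only [mem_Ico, mem_Ioc]; omega
  rw [e] at h7
  have h8 := (abs_le.1 h7).2
  have hm := mean_ind_le R S q hOK a w hw
  have hc := card_primes_le z Z (by omega)
  have hq1 : (1:ℝ) ≤ q := by exact_mod_cast NeZero.pos q
  have hφ : (1:ℝ) ≤ Nat.totient q := by exact_mod_cast Nat.totient_pos.2 (NeZero.pos q)
  have hφq : (Nat.totient q : ℝ) ≤ q := by exact_mod_cast Nat.totient_le q
  have hZ1 : (1:ℝ) ≤ Z := by exact_mod_cast (by omega : 1 ≤ Z)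
  set l := Real.log z
  set φ : ℝ := (Nat.totient q : ℝ)
  have hll : l ≤ Real.log ((z+1:ℕ):ℝ) := Real.log_le_log (by exact_mod_cast (by omega : 0 < z)) (by push_cast; linarith)
  have e1 : C * q^2 * ((Z+1:ℕ):ℝ) / (Real.log ((z+1:ℕ):ℝ))^(3*k+1+1) ≤ 2 / (φ*l) * Z := by
    calc _ ≤ C * q^2 * (2*Z) / l^(3*k+1+1) := by
          gcongr
          push_cast; linarith
      _ ≤ 2/(φ*l)*Z := by
          rw [div_mul_eq_mul_div, div_le_div_iff₀ (by positivity) (by positivity)]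
          have e1 : (q:ℝ)^3 ≤ l^(3*k) := by
            calc (q:ℝ)^3 ≤ (l^k)^3 := by gcongr
              _ = _ := by rw [← pow_mul]; congr 1; ring
          calc C * q^2 * (2*Z) * (φ*l) ≤ C * q^2 * (2*Z) * (q*l) := by gcongr
            _ = (q:ℝ)^3 * C * (2*Z*l) := by ring
            _ ≤ l^(3*k) * l * (2*Z*l) := by gcongr
            _ = 2*Z*l^(3*k+1+1) := by ring
  have e2 : (∑ u : (ZMod q)ˣ, ind a (w * ((R:ZMod q) * (u:ZMod q) + S))) / φ * (((Ioc z Z).filter Nat.Prime).card : ℝ) ≤ 2/(φ*l)*Z := by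
    calc _ ≤ 1/φ * (2*Z/l) := by
          gcongr
          rw [le_div_iff₀ hl0]; exact hc
      _ = _ := by field_simp
  have e3 : 4/(φ*l)*Z = 2/(φ*l)*Z + 2/(φ*l)*Z := by ring
  rw [e3]
  linarith
end SW
end

section
open Finset
namespace SW

lemma mp_inj (t m p m' p' : ℕ) (hp : p.Prime) (hp' : p'.Prime) (hpt : t < p) (hm' : Smo t m') (h : m * p = m' * p') :
    m = m' ∧ p = p' := by
  have h1 : p ∣ m' * p' := ⟨m, by rw [← h]; ring⟩
  rcases hp.dvd_mul.1 h1 with h2 | h2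
  · have := hm' p hp h2; omega
  · have e := (Nat.prime_dvd_prime_iff_eq hp hp').1 h2
    subst e
    exact ⟨Nat.eq_of_mul_eq_mul_right hp.pos h, rfl⟩

lemma cop_of_smo {t m p : ℕ} (hp : p.Prime) (hpt : t < p) (hm : Smo t m) : Nat.Coprime m p := by
  rw [Nat.coprime_comm, hp.coprime_iff_not_dvd]
  intro h
  have := hm p hp h; omega

lemma step_low {A : Type*} [CommRing A] (F : ℕ → A) (hF : ∀ m n : ℕ, Nat.Coprime m n → F (m * n) = F m * F n)
    (t t' : ℕ) (htt : t ≤ t') (U U' : ℝ) (M I : Finset ℕ) (hM : ∀ m ∈ M, 0 < m ∧ (m:ℝ) ≤ U ∧ IsUnit (F m) ∧ Smo t m)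
    (hI : ∀ p ∈ I, p.Prime ∧ t < p ∧ p ≤ t' ∧ IsUnit (F p)) (hU : U * t' ≤ U') :
    ∃ M' : Finset ℕ, (∀ m ∈ M', 0 < m ∧ (m:ℝ) ≤ U' ∧ IsUnit (F m) ∧ Smo t' m) ∧ 
      ∑ m ∈ M', (1:ℝ)/m = (∑ m ∈ M, (1:ℝ)/m) * ∑ p ∈ I, (1:ℝ)/p := by
  refine ⟨(M ×ˢ I).image (fun x => x.1 * x.2), ?_, ?_⟩
  · intro n hn
    rw [mem_image] at hn
    obtain ⟨⟨m, p⟩, hx, rfl⟩ := hn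
    rw [mem_product] at hx
    obtain ⟨hm0, hmU, hmu, hms⟩ := hM m hx.1
    obtain ⟨hp, hpt, hpt', hpu⟩ := hI p hx.2
    refine ⟨Nat.mul_pos hm0 hp.pos, ?_, ?_, ?_⟩
    · push_cast
      refine le_trans ?_ hU
      have : (p:ℝ) ≤ t' := by exact_mod_cast hpt'
      have : (0:ℝ) ≤ U := le_trans (by positivity) hmU
      gcongr
    · show IsUnit (F (m * p))
      rw [hF m p (cop_of_smo hp hpt hms)]
      exact hmu.mul hpu
    · intro r hr hd
      rcases hr.dvd_mul.1 hd with h | h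
      · exact (hms r hr h).trans htt
      · rw [(Nat.prime_dvd_prime_iff_eq hr hp).1 h]; exact hpt'
  · rw [Finset.sum_image, Finset.sum_product, Finset.sum_mul]
    · refine Finset.sum_congr rfl fun m _ => ?_
      rw [Finset.mul_sum]
      refine Finset.sum_congr rfl fun p _ => ?_
      push_cast; rw [div_mul_div_comm, one_mul]
    · rintro ⟨m, p⟩ hx ⟨m', p'⟩ hx' h
      rw [mem_coe, mem_product] at hx hx'
      obtain ⟨e1, e2⟩ := mp_inj t m p m' p' (hI p hx.2).1 (hI p' hx'.2).1 (hI p hx.2).2.1 (hM m' hx'.1).2.2.2 h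
      rw [e1, e2]

lemma pow8_not_prime (s p : ℕ) (hp : p.Prime) (h : 8^s ≤ p) : 8^s < p := by
  refine lt_of_le_of_ne h ?_
  rintro rfl
  rcases Nat.eq_zero_or_pos s with rfl | hs
  · exact Nat.not_prime_one (by simpa using hp)
  · obtain ⟨r, rfl⟩ := Nat.exists_eq_succ_of_ne_zero hs.ne'
    rw [Nat.pow_succ] at hp
    have e : 8^r*8 = 8^r*2*4 := by ring
    rw [e] at hp
    have : 0 < 8^r := by positivity
    exact Nat.not_prime_mul (by omega) (by norm_num) hp

lemma iter_low {A : Type*} [CommRing A] (R S : ℤ) (F : ℕ → A) (hF : ∀ m n : ℕ, Nat.Coprime m n → F (m * n) = F m * F n)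
    (hFp : ∀ p : ℕ, p.Prime → F p = R * (p:A) + S) (a b h : ℕ) (hb : 1 ≤ b) (g V : ℝ) (hg0 : 0 ≤ g) (hV : 0 ≤ V)
    (hG : ∀ i < h, g ≤ ∑ p ∈ (Ico (8^(a*b^i)) (8^(a*b^(i+1)))).filter Nat.Prime, uni ((R:A) * p + S) / p)
    (M : Finset ℕ) (hM : ∀ m ∈ M, 0 < m ∧ (m:ℝ) ≤ V ∧ IsUnit (F m) ∧ Smo (8^a) m) :
    ∀ i ≤ h, ∃ M' : Finset ℕ, (∀ m ∈ M', 0 < m ∧ (m:ℝ) ≤ V * 8^(i*(a*b^h)) ∧ IsUnit (F m) ∧ Smo (8^(a*b^i)) m) ∧ 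
      (∑ m ∈ M, (1:ℝ)/m) * g^i ≤ ∑ m ∈ M', (1:ℝ)/m := by
  classical
  intro i
  induction i with
  | zero => intro _; exact ⟨M, by simpa using hM, by simp⟩
  | succ i ih =>
    intro hi
    obtain ⟨M1, h1, h2⟩ := ih (by omega)
    have hab : a*b^i ≤ a*b^(i+1) := Nat.mul_le_mul_left _ (Nat.pow_le_pow_right hb (by omega))
    have hab2 : a*b^(i+1) ≤ a*b^h := Nat.mul_le_mul_left _ (Nat.pow_le_pow_right hb hi)
    obtain ⟨M2, h3, h4⟩ := step_low F hF (8^(a*b^i)) (8^(a*b^(i+1))) (Nat.pow_le_pow_right (by norm_num) hab)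
      (V * 8^(i*(a*b^h))) (V * 8^((i+1)*(a*b^h))) M1 
      ((Ico (8^(a*b^i)) (8^(a*b^(i+1)))).filter (fun p => p.Prime ∧ IsUnit (F p))) h1 (by
        intro p hp
        rw [mem_filter, mem_Ico] at hp
        exact ⟨hp.2.1, pow8_not_prime _ _ hp.2.1 hp.1.1, hp.1.2.le, hp.2.2⟩) (by
        push_cast
        rw [mul_assoc, ← pow_add]
        gcongr
        · norm_num
        · rw [add_mul, one_mul]; gcongr)
    refine ⟨M2, h3, ?_⟩
    rw [h4, pow_succ, ← mul_assoc]
    have hg := hG i (by omega)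
    have e : ∑ p ∈ (Ico (8^(a*b^i)) (8^(a*b^(i+1)))).filter Nat.Prime, uni ((R:A) * p + S) / (p:ℝ) = 
        ∑ p ∈ (Ico (8^(a*b^i)) (8^(a*b^(i+1)))).filter (fun p => p.Prime ∧ IsUnit (F p)), (1:ℝ)/p := by
      rw [← Finset.filter_filter, Finset.sum_filter (fun p => IsUnit (F p))]
      refine Finset.sum_congr rfl fun p hp => ?_
      rw [← hFp p (mem_filter.1 hp).2, uni_apply]
      split_ifs <;> simp
    rw [e] at hg
    have : 0 ≤ ∑ m ∈ M1, (1:ℝ)/m := Finset.sum_nonneg fun _ _ => by positivity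
    gcongr

lemma lower_comb {A : Type*} [CommRing A] (R S : ℤ) (F : ℕ → A) (hF : ∀ m n : ℕ, Nat.Coprime m n → F (m * n) = F m * F n)
    (hFp : ∀ p : ℕ, p.Prime → F p = R * (p:A) + S) (t X Y1 : ℕ) (β : ℝ) (hβ : 0 ≤ β) (ht : t < Y1) 
    (HB : ∀ Y : ℕ, Y1 ≤ Y → Y ≤ X → β * Y ≤ ∑ p ∈ (Ico Y (8*Y)).filter Nat.Prime, uni ((R:A) * p + S))
    (U : ℝ) (M : Finset ℕ) (hM : ∀ m ∈ M, 0 < m ∧ (m:ℝ) ≤ U ∧ IsUnit (F m) ∧ Smo t m) (hU : U * (16 * Y1) ≤ X) :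
    β * X / 16 * ∑ m ∈ M, (1:ℝ)/m ≤ ∑ n ∈ Ioc 0 X, uni (F n) := by
  classical
  let Im : ℕ → Finset ℕ := fun m => (Ico (X/(8*m)) (8*(X/(8*m)))).filter (fun p => p.Prime ∧ IsUnit (F p))
  have hY : ∀ m ∈ M, Y1 ≤ X/(8*m) ∧ X/(8*m) ≤ X ∧ (X:ℝ)/(16*m) ≤ ((X/(8*m) : ℕ):ℝ) := by
    intro m hm
    obtain ⟨hm0, hmU, _, _⟩ := hM m hm
    have hm0' : (0:ℝ) < m := by exact_mod_cast hm0
    have h1 : m * (16*Y1) ≤ X := by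
      have : (m:ℝ) * (16*Y1) ≤ X := le_trans (by gcongr) hU
      exact_mod_cast this
    have h2 : 2 * Y1 ≤ X/(8*m) := by
      rw [Nat.le_div_iff_mul_le (by omega)]; linarith [h1]
    refine ⟨by omega, Nat.div_le_self _ _, ?_⟩
    have h3 : X < (X/(8*m) + 1) * (8*m) := by rw [mul_comm]; exact Nat.lt_mul_div_succ X (by omega)
    have h4 : (X:ℝ) < ((X/(8*m) : ℕ) + 1) * (8*m) := by exact_mod_cast h3
    have h5 : (1:ℝ) ≤ ((X/(8*m) : ℕ):ℝ) := by exact_mod_cast (by omega : 1 ≤ X/(8*m))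
    rw [div_le_iff₀ (by positivity)]
    nlinarith
  have hp : ∀ m ∈ M, ∀ p ∈ Im m, p.Prime ∧ t < p ∧ IsUnit (F p) ∧ m * p ≤ X := by
    intro m hm p hp
    obtain ⟨h1, h2, _⟩ := hY m hm
    simp only [Im, mem_filter, mem_Ico] at hp
    refine ⟨hp.2.1, by omega, hp.2.2, ?_⟩
    calc m * p ≤ m * (8 * (X/(8*m))) := Nat.mul_le_mul_left _ hp.1.2.le
      _ = (8*m) * (X/(8*m)) := by ring
      _ ≤ X := Nat.mul_div_le _ _
  calc β * X / 16 * ∑ m ∈ M, (1:ℝ)/m = ∑ m ∈ M, β * (X/(16*m)) := by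
        rw [Finset.mul_sum]
        refine Finset.sum_congr rfl fun m hm => ?_
        have hm0' : (0:ℝ) < m := by exact_mod_cast (hM m hm).1
        field_simp
    _ ≤ ∑ m ∈ M, ((Im m).card : ℝ) := by
        refine Finset.sum_le_sum fun m hm => ?_
        obtain ⟨h1, h2, h3⟩ := hY m hm
        calc β * (X/(16*m)) ≤ β * ((X/(8*m) : ℕ):ℝ) := by gcongr
          _ ≤ _ := HB _ h1 h2
          _ = _ := by
            simp only [Im]
            rw [← Finset.filter_filter, Finset.card_filter (fun p => IsUnit (F p))]
            push_cast
            refine Finset.sum_congr rfl fun p hp => ?_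
            rw [← hFp p (mem_filter.1 hp).2, uni_apply]
    _ = (((M.sigma Im).image (fun x => x.1 * x.2)).card : ℝ) := by
        rw [Finset.card_image_of_injOn, Finset.card_sigma]
        · push_cast; rfl
        · rintro ⟨m, p⟩ hx ⟨m', p'⟩ hx' h
          rw [mem_coe, mem_sigma] at hx hx'
          simp only at hx hx' h
          have q1 := hp m hx.1 p hx.2
          have q2 := hp m' hx'.1 p' hx'.2
          obtain ⟨e1, e2⟩ := mp_inj t m p m' p' q1.1 q2.1 q1.2.1 (hM m' hx'.1).2.2.2 h
          subst e1 e2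
          rfl
    _ = ∑ n ∈ (M.sigma Im).image (fun x => x.1 * x.2), uni (F n) := by
        rw [Finset.card_eq_sum_ones]
        push_cast
        refine Finset.sum_congr rfl fun n hn => ?_
        rw [mem_image] at hn
        obtain ⟨⟨m, p⟩, hx, rfl⟩ := hn
        rw [mem_sigma] at hx
        have q1 := hp m hx.1 p hx.2
        have q3 := hM m hx.1
        show (1:ℝ) = uni (F (m * p))
        rw [hF m p (cop_of_smo q1.1 q1.2.1 q3.2.2.2), uni_unit (q3.2.2.1.mul q1.2.2.1)]
    _ ≤ _ := by
        refine Finset.sum_le_sum_of_subset_of_nonneg ?_ fun n _ _ => uni_nonneg _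
        intro n hn
        rw [mem_image] at hn
        obtain ⟨⟨m, p⟩, hx, rfl⟩ := hn
        rw [mem_sigma] at hx
        have q1 := hp m hx.1 p hx.2
        have q3 := hM m hx.1
        rw [mem_Ioc]
        exact ⟨Nat.mul_pos q3.1 q1.1.pos, q1.2.2.2⟩
end SW
end

section
open Finset Filter
namespace SW

lemma evF1 (n : ℕ) (M : ℝ) : ∀ᶠ l : ℝ in atTop, M * l^n ≤ Real.exp (√l) := by
  have h1 : ∀ᶠ s : ℝ in atTop, |M| * s^(2*n) ≤ Real.exp s := by
    have := (Real.isLittleO_pow_exp_atTop (n := 2*n)).bound (c := 1/(|M|+1)) (by positivity)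
    filter_upwards [this, eventually_ge_atTop 0] with s hs h0
    rw [Real.norm_of_nonneg (by positivity), Real.norm_of_nonneg (by positivity)] at hs
    have : (|M|+1) * s^(2*n) ≤ Real.exp s := by
      rw [div_mul_eq_mul_div, one_mul, le_div_iff₀ (by positivity)] at hs; linarith
    have h2 : 0 ≤ s^(2*n) := by positivity
    nlinarith
  have h2 := Real.tendsto_sqrt_atTop.eventually h1
  filter_upwards [h2, eventually_ge_atTop 0] with l hl h0
  rw [pow_mul, Real.sq_sqrt h0] at hl
  refine le_trans ?_ hl
  gcongr
  exact le_abs_self M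

lemma evF2 (c : ℝ) : ∀ᶠ l : ℝ in atTop, c * l^((3:ℝ)/4) + 6 ≤ 3/4 * l := by
  have h1 : ∀ᶠ l : ℝ in atTop, 2 * |c| ≤ l^((1:ℝ)/4) := (tendsto_rpow_atTop (by norm_num)).eventually_ge_atTop _
  filter_upwards [h1, eventually_ge_atTop 24] with l h h24
  have e : l = l^((3:ℝ)/4) * l^((1:ℝ)/4) := by
    rw [← Real.rpow_add (by linarith)]; norm_num
  have h0 : 0 ≤ l^((3:ℝ)/4) := by positivity
  have h3 : c * l^((3:ℝ)/4) ≤ |c| * l^((3:ℝ)/4) := by gcongr; exact le_abs_self c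
  have h4 : 2 * (|c| * l^((3:ℝ)/4)) ≤ l := by nlinarith
  linarith

lemma evF3 (c : ℝ) : ∀ᶠ l : ℝ in atTop, c * (√l * Real.log l) ≤ l := by
  have h1 := (Real.isLittleO_log_id_atTop.comp_tendsto Real.tendsto_sqrt_atTop).bound (c := 1/(2*(|c|+1))) (by positivity)
  filter_upwards [h1, eventually_ge_atTop 1] with l h hl
  simp only [Function.comp, id] at h
  have hs1 : 1 ≤ √l := Real.one_le_sqrt.2 hl
  rw [Real.norm_of_nonneg (Real.log_nonneg hs1), Real.norm_of_nonneg (by positivity), Real.log_sqrt (by linarith), div_mul_eq_mul_div, one_mul, le_div_iff₀ (by positivity)] at h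
  have h2 : √l * √l = l := Real.mul_self_sqrt (by linarith)
  have h3 : c * (√l * Real.log l) ≤ (|c|+1) * (√l * Real.log l) := by
    have := Real.log_nonneg hl
    gcongr; linarith [le_abs_self c]
  have h4 : Real.log l * (|c|+1) ≤ √l := by linarith
  nlinarith

lemma floor_half {t : ℝ} (ht : 1 ≤ t) : t / 2 ≤ (⌊t⌋₊ : ℝ) := by
  have h1 := Nat.lt_floor_add_one t
  have h2 : (1:ℝ) ≤ (⌊t⌋₊ : ℝ) := by exact_mod_cast (Nat.one_le_floor_iff t).2 ht
  linarith

lemma log8 : 2 ≤ Real.log 8 ∧ Real.log 8 ≤ 2.1 := by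
  rw [show (8:ℝ) = 2^3 by norm_num, Real.log_pow]
  have h1 := Real.log_two_lt_d9
  have h2 := Real.log_two_gt_d9
  push_cast; constructor <;> linarith

lemma pow8_exp (n : ℕ) : (8:ℝ)^n = Real.exp (n * Real.log 8) := by
  rw [mul_comm, Real.exp_mul, Real.exp_log (by norm_num), Real.rpow_natCast]

lemma params (M D : ℝ) (hD : 1 ≤ D) (n h : ℕ) (hh : 1 ≤ h) : ∀ᶠ l : ℝ in atTop, 
    ∃ a b z : ℕ, 16 ≤ l ∧ M ≤ l ∧ 1 ≤ Real.log l ∧ M ≤ Real.log l ∧ √l ≤ Real.log ((8:ℝ)^a) ∧ M * l^n ≤ (8:ℝ)^a ∧ 1 ≤ b ∧ 1 ≤ a ∧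
      Real.log l / (8*h) ≤ Real.log b ∧ Real.exp (l/4) * 8^(h*(a*b^h)) * (16 * 8^(a*b^h+1)) ≤ Real.exp l ∧
      8^a ≤ z ∧ l/(2*D*Real.log l) ≤ Real.log z ∧ Real.log z ≤ l/(D*Real.log l) ∧ M * l^n * Real.exp (l/4) ≤ Real.exp l := by
  have hh0 : (0:ℝ) < h := by exact_mod_cast hh
  have h5 : ∀ᶠ l : ℝ in atTop, 2 ≤ l^((1:ℝ)/(8*h)) := (tendsto_rpow_atTop (by positivity)).eventually_ge_atTop _
  filter_upwards [evF1 n M, evF2 ((h+1)*2.1), evF3 (5*D), h5, eventually_ge_atTop 16, eventually_ge_atTop M, Real.tendsto_log_atTop.eventually_ge_atTop 1, Real.tendsto_log_atTop.eventually_ge_atTop M] with l f1 f2 f3 f5 h16 hM h1 hMl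
  obtain ⟨l8a, l8b⟩ := log8
  have hs4 : 4 ≤ √l := Real.le_sqrt_of_sq_le (by linarith)
  have hsl : √l * √l = l := Real.mul_self_sqrt (by linarith)
  have ha1 := floor_half (t := √l) (by linarith)
  have ha2 : (⌊√l⌋₊:ℝ) ≤ √l := Nat.floor_le (by positivity)
  set a := ⌊√l⌋₊ with ha
  have hu1 : (1:ℝ) ≤ l^((1:ℝ)/(4*h)) := Real.one_le_rpow (by linarith) (by positivity)
  have hb1 := floor_half hu1
  have hb2 : (⌊l^((1:ℝ)/(4*h))⌋₊:ℝ) ≤ l^((1:ℝ)/(4*h)) := Nat.floor_le (by positivity)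
  have hb3 : 1 ≤ ⌊l^((1:ℝ)/(4*h))⌋₊ := (Nat.one_le_floor_iff _).2 hu1
  set b := ⌊l^((1:ℝ)/(4*h))⌋₊ with hb
  set t := l/(D*Real.log l) with ht
  have hDl : 0 < D * Real.log l := by positivity
  have ht1 : 5 * √l ≤ t := by
    rw [ht, le_div_iff₀ hDl]; linarith
  have hz1 := floor_half (t := Real.exp t) (Real.one_le_exp (by linarith))
  have hz2 : (⌊Real.exp t⌋₊:ℝ) ≤ Real.exp t := Nat.floor_le (by positivity)
  set z := ⌊Real.exp t⌋₊ with hz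
  have hz3 : Real.exp (t-1) ≤ z := by
    refine le_trans ?_ hz1
    rw [Real.exp_sub]
    gcongr; linarith [Real.exp_one_gt_d9]
  have hz0 : (0:ℝ) < z := lt_of_lt_of_le (Real.exp_pos _) hz3
  have hlz : t - 1 ≤ Real.log z := (Real.le_log_iff_exp_le hz0).2 hz3
  have hloga : √l ≤ Real.log ((8:ℝ)^a) := by
    rw [Real.log_pow]; nlinarith
  have hab : (a:ℝ) * (b:ℝ)^h ≤ l^((3:ℝ)/4) := by
    calc (a:ℝ) * (b:ℝ)^h ≤ √l * (l^((1:ℝ)/(4*h)))^h := by gcongr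
      _ = l^((3:ℝ)/4) := by
        rw [Real.sqrt_eq_rpow, ← Real.rpow_natCast, ← Real.rpow_mul (by linarith), ← Real.rpow_add (by linarith)]
        congr 1
        field_simp; norm_num
  refine ⟨a, b, z, h16, hM, h1, hMl, hloga, ?_, hb3, (Nat.one_le_floor_iff _).2 (by linarith), ?_, ?_, ?_, ?_, ?_, ?_⟩
  · refine f1.trans ?_
    rw [← Real.le_log_iff_exp_le (by positivity)]; exact hloga
  · have : l^((1:ℝ)/(8*h)) ≤ b := by
      refine le_trans ?_ hb1
      have e : l^((1:ℝ)/(4*h)) = l^((1:ℝ)/(8*h)) * l^((1:ℝ)/(8*h)) := by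
        rw [← Real.rpow_add (by linarith)]; congr 1; field_simp; norm_num
      rw [e]; nlinarith
    calc Real.log l / (8*h) = Real.log (l^((1:ℝ)/(8*h))) := by rw [Real.log_rpow (by linarith)]; ring
      _ ≤ _ := Real.log_le_log (by positivity) this
  · rw [pow8_exp, pow8_exp]
    have e16 : (16:ℝ) ≤ Real.exp 3 := by
      have : Real.exp 3 = Real.exp 1 ^ 3 := by rw [← Real.exp_nat_mul]; norm_num
      rw [this]
      have h1 : (2.7:ℝ)^3 ≤ Real.exp 1 ^ 3 := by gcongr; linarith [Real.exp_one_gt_d9]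
      norm_num at h1; linarith
    calc _ ≤ Real.exp (l/4) * Real.exp (((h*(a*b^h):ℕ):ℝ) * Real.log 8) * (Real.exp 3 * Real.exp (((a*b^h+1:ℕ):ℝ) * Real.log 8)) := by gcongr
      _ = Real.exp (l/4 + (h+1) * Real.log 8 * (a*b^h) + (3 + Real.log 8)) := by
        rw [← Real.exp_add, ← Real.exp_add, ← Real.exp_add]; congr 1; push_cast; ring
      _ ≤ Real.exp l := by
        apply Real.exp_le_exp.2
        have : (h+1) * Real.log 8 * (a*b^h) ≤ ((h:ℝ)+1) * 2.1 * l^((3:ℝ)/4) := by gcongr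
        linarith
  · have : ((8^a:ℕ):ℝ) ≤ z := by
      push_cast
      refine le_trans ?_ hz3
      rw [pow8_exp]
      apply Real.exp_le_exp.2
      nlinarith
    exact_mod_cast this
  · refine le_trans ?_ hlz
    have : l/(2*D*Real.log l) = t/2 := by rw [ht]; field_simp
    linarith
  · rw [Real.log_le_iff_le_exp hz0]; exact hz2
  · calc M * l^n * Real.exp (l/4) ≤ Real.exp (√l) * Real.exp (l/4) := by gcongr
      _ ≤ _ := by
        rw [← Real.exp_add]; apply Real.exp_le_exp.2; nlinarith
end SW
end

section
open Finset Filter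
namespace SW

lemma al_sq (R S : ℤ) (k : ℕ) : ∃ c : ℝ, 0 < c ∧ ∀ l : ℝ, 1 ≤ l → 1 ≤ Real.log l → ∀ (q : ℕ) [NeZero q], OKq R q →
    (q:ℝ) ≤ l^k → c ≤ al R S q ^ 2 * Real.log l := by
  obtain ⟨C, hC, h⟩ := omega_bound 1 one_pos
  have hl2 := Real.log_two_gt_d9
  set A : ℝ := (|Real.log C| + k) * 2 + 1 with hA
  have hA0 : 0 < A := by positivity
  refine ⟨1/A, by positivity, ?_⟩
  intro l h1 hl q _ hq hqk
  have h2 := h q (NeZero.ne q)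
  have hq0 : (0:ℝ) < q := by exact_mod_cast Nat.pos_of_ne_zero (NeZero.ne q)
  rw [Real.rpow_one] at h2
  have h3 := Real.log_le_log (by positivity) h2
  rw [Real.log_pow, Real.log_mul hC.ne' hq0.ne'] at h3
  have h4 : Real.log q ≤ k * Real.log l := by
    rw [← Real.log_pow]; exact Real.log_le_log hq0 hqk
  have h5 := al_lower R S q hq
  set w : ℝ := (q.primeFactors.card : ℝ) with hw
  have hw0 : 0 ≤ w := by positivity
  have h6 : w + 1 ≤ A * Real.log l := by
    have : Real.log C ≤ |Real.log C| * Real.log l := by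
      nlinarith [le_abs_self (Real.log C), abs_nonneg (Real.log C)]
    nlinarith
  have h7 : 1/(w+1) ≤ al R S q ^ 2 := by
    have : (1/√(w+1))^2 ≤ al R S q ^2 := by
      unfold al; gcongr
    rwa [div_pow, one_pow, Real.sq_sqrt (by positivity)] at this
  calc 1/A = 1/(A * Real.log l) * Real.log l := by field_simp
    _ ≤ 1/(w+1) * Real.log l := by gcongr
    _ ≤ _ := by gcongr

lemma tau_bound (n : ℕ) (D l : ℝ) (hD : D = 4*(43+n)) (h16 : 16 ≤ l) (hM : Real.exp 98 ≤ l) (hl : 1 ≤ Real.log l) (z : ℕ)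
    (hz1 : √l ≤ Real.log z) (hz2 : Real.log z ≤ l/(D*Real.log l)) (T : Finset ℕ)
    (hT : ∀ m ∈ T, Real.exp (l/4) ≤ m ∧ Smo z m) : ∑ m ∈ T, (1:ℝ)/m ≤ 1/l^n := by
  have hs4 : 4 ≤ √l := Real.le_sqrt_of_sq_le (by linarith)
  have hD1 : 1 ≤ D := by rw [hD]; have : (0:ℝ) ≤ n := by positivity
                         linarith
  have hDl : 1 ≤ D * Real.log l := by nlinarith
  have hz0 : 0 < Real.log z := by linarith
  refine (tail_smooth z (by linarith) _ (Real.exp_pos _) T hT).trans ?_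
  have hzl : Real.log z ≤ l := hz2.trans (div_le_self (by linarith) hDl)
  have e1 : Real.exp (l/4) ^ (-(1/Real.log z)) ≤ 1 / l^(43+n) := by
    rw [← Real.exp_mul]
    have : (1:ℝ) / l^(43+n) = Real.exp (-((43+n) * Real.log l)) := by
      rw [Real.exp_neg, one_div, mul_comm, Real.exp_mul, Real.exp_log (by linarith), ← Real.rpow_natCast]; push_cast; rfl
    rw [this]
    apply Real.exp_le_exp.2
    have : D * Real.log l * Real.log z ≤ l := by
      rw [le_div_iff₀ (by linarith)] at hz2; linarith
    have h2 : (43+n) * Real.log l ≤ l/4 * (1/Real.log z) := by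
      rw [mul_one_div, le_div_iff₀ hz0]
      rw [hD] at this; linarith
    linarith
  calc _ ≤ l * l^42 * (1/l^(43+n)) := by gcongr
    _ = _ := by rw [pow_add]; field_simp

lemma lower_main (R S : ℤ) (k J : ℕ) : ∃ c M : ℝ, 0 < c ∧ ∀ (X a b : ℕ) (l : ℝ), l = Real.log X → 0 < X → 16 ≤ l →
    1 ≤ Real.log l → √l ≤ Real.log ((8:ℝ)^a) → M ≤ (8:ℝ)^a → 1 ≤ b → 1 ≤ a →
    Real.log l / (8*(2*J+5 : ℕ)) ≤ Real.log b → Real.exp (l/4) * 8^((2*J+5)*(a*b^(2*J+5))) * (16 * 8^(a*b^(2*J+5)+1)) ≤ Real.exp l →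
    ∀ (q : ℕ) [NeZero q], OKq R q → (q:ℝ) ≤ l^k → ∀ (F : ℕ → ZMod q) (_ : ∀ m n : ℕ, m.Coprime n → F (m*n) = F m * F n)
    (_ : ∀ p : ℕ, p.Prime → F p = (R:ZMod q)*p+S) (MM : Finset ℕ),
    (∀ m ∈ MM, 0 < m ∧ (m:ℝ) ≤ Real.exp (l/4) ∧ IsUnit (F m) ∧ Smo (8^a) m) →
    c * (X/l * Real.log l^(J+2) * ∑ m ∈ MM, (1:ℝ)/m) ≤ ∑ n ∈ Ioc 0 X, uni (F n) := by
  obtain ⟨c1, hc1, H1⟩ := al_sq R S k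
  obtain ⟨Y0, hY0, HI⟩ := good_inv R S (2*k)
  obtain ⟨Y0', hY0', HB⟩ := good_block R S (2*k)
  set h := 2*J+5 with hh
  have hh0 : (0:ℝ) < h := by rw [hh]; positivity
  refine ⟨1/32 * (1/(320*h))^h * c1^(J+3), max Y0 Y0', by positivity, ?_⟩
  intro X a b l hl hX h16 hlog ha hMa hb ha1 hlb hU q _ hq hqk F hF hFp MM hMM
  have hqa : (q:ℝ) ≤ Real.log ((8:ℝ)^a)^(2*k) := by
    refine hqk.trans ?_
    calc l^k = (√l)^(2*k) := by rw [pow_mul, Real.sq_sqrt (by linarith)]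
      _ ≤ _ := by gcongr
  have hs0 : 0 ≤ √l := by positivity
  have hla : 0 ≤ Real.log ((8:ℝ)^a) := by linarith
  have hai : ∀ i, (8:ℝ)^a ≤ 8^(a*b^i) := fun i => by
    apply pow_le_pow_right₀ (by norm_num)
    exact Nat.le_mul_of_pos_right _ (by positivity)
  have hYa : (Y0:ℝ) ≤ 8^a := (le_max_left _ _).trans hMa
  have hYa' : (Y0':ℝ) ≤ 8^a := (le_max_right _ _).trans hMa
  have hal := al_nonneg R S q
  set g : ℝ := al R S q / 40 * (Real.log l / (8*h)) with hg
  have hg0 : 0 ≤ g := by positivity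
  have hG : ∀ i < h, g ≤ ∑ p ∈ (Ico (8^(a*b^i)) (8^(a*b^(i+1)))).filter Nat.Prime, uni ((R:ZMod q)*p+S)/(p:ℝ) := by
    intro i _
    have := HI (a*b^i) (by exact_mod_cast hYa.trans (hai i)) q hq (hqa.trans (pow_le_pow_left₀ hla (Real.log_le_log (by positivity) (hai i)) _)) (a*b^(i+1)) (by gcongr; omega)
    refine le_trans ?_ this
    have e : (((a*b^(i+1):ℕ):ℝ)/((a*b^i:ℕ):ℝ)) = b := by
      have : (0:ℝ) < a := by exact_mod_cast ha1
      have : (0:ℝ) < b := by exact_mod_cast hb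
      push_cast; rw [pow_succ]; field_simp
    rw [e, hg]; gcongr
  obtain ⟨M', hM', hs⟩ := iter_low R S F hF hFp a b h hb g (Real.exp (l/4)) hg0 (by positivity) hG MM hMM h le_rfl
  have hlc := lower_comb R S F hF hFp (8^(a*b^h)) X (8^(a*b^h+1)) (al R S q / (2*l)) (by positivity)
    (Nat.pow_lt_pow_right (by norm_num) (by omega)) ?_ _ M' hM' ?_
  · refine le_trans ?_ hlc
    have h1 := H1 l (by linarith) hlog q hq hqk
    set α := al R S q
    set Λ := Real.log l
    set Q := ∑ m ∈ MM, (1:ℝ)/m with hQ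
    have hQ0 : 0 ≤ Q := by rw [hQ]; positivity
    calc _ = 1/32 * (1/(320*h))^h * (c1^(J+3) * Λ^(J+2)) * (X/l*Q) := by ring
      _ ≤ 1/32 * (1/(320*h))^h * ((α^2*Λ)^(J+3) * Λ^(J+2)) * (X/l*Q) := by gcongr
      _ = α/(2*l)*X/16 * (Q * g^h) := by
        rw [hg]
        have : (α^2*Λ)^(J+3) * Λ^(J+2) = α * (α * Λ)^h := by rw [hh]; ring
        rw [this]
        have e2 : α/40*(Λ/(8*h)) = 1/(320*h) * (α*Λ) := by field_simp; ring
        rw [e2, mul_pow]; ring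
      _ ≤ _ := by gcongr
  · intro Y hY1 hYX
    have hYa2 : (8:ℝ)^a ≤ Y := by
      have h1 : ((8^(a*b^h+1):ℕ):ℝ) ≤ Y := by exact_mod_cast hY1
      push_cast at h1
      refine ((hai h).trans ?_).trans h1
      apply pow_le_pow_right₀ (by norm_num); omega
    have hY0 : (0:ℝ) < Y := lt_of_lt_of_le (by positivity) hYa2
    have hlY : 0 < Real.log Y := Real.log_pos (lt_of_lt_of_le (one_lt_pow₀ (by norm_num) (by omega)) hYa2)
    have := HB Y (by exact_mod_cast hYa'.trans hYa2) q hq (hqa.trans (by gcongr))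
    refine le_trans ?_ this
    have hYl : Real.log Y ≤ l := by rw [hl]; gcongr
    calc al R S q / (2*l) * Y = al R S q/2 * (Y/l) := by ring
      _ ≤ _ := by gcongr
  · push_cast
    refine hU.trans ?_
    rw [hl, Real.exp_log (by exact_mod_cast hX)]
end SW
end

section
open Finset Filter
namespace SW

lemma smo_of_DD {y X m : ℕ} (hm : m ∈ Ioc 0 X) (h : DD ((Ioc y X).filter Nat.Prime) m ≤ 0) : Smo y m := by
  intro p hp hpm
  by_contra hcon
  push Not at hcon
  rw [mem_Ioc] at hm
  have h1 : p ≤ X := (Nat.le_of_dvd hm.1 hpm).trans hm.2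
  unfold DD at h
  rw [Nat.le_zero, card_eq_zero] at h
  have : p ∈ filter (fun x => x ∣ m) ((Ioc y X).filter Nat.Prime) := by
    simp only [mem_filter, mem_Ioc]; exact ⟨⟨⟨hcon, h1⟩, hp⟩, hpm⟩
  rw [h] at this; simp at this

open Classical in
lemma QQ_zero_le {q : ℕ} [NeZero q] (F : ℕ → ZMod q) (y z X : ℕ) (hyz : y ≤ z) (V τ : ℝ)
    (hτ : ∀ T : Finset ℕ, (∀ m ∈ T, V ≤ m ∧ Smo z m) → ∑ m ∈ T, (1:ℝ)/m ≤ τ) (MM : Finset ℕ)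
    (hMM : ∀ m, m ∈ MM ↔ 0 < m ∧ (m:ℝ) ≤ V ∧ IsUnit (F m) ∧ Smo y m) :
    QQ ((Ioc y X).filter Nat.Prime) F X 0 ≤ ∑ m ∈ MM, (1:ℝ)/m + τ := by
  set PP := (Ioc y X).filter Nat.Prime with hPP
  set T := (Ioc 0 X).filter (fun m : ℕ => V ≤ (m:ℝ) ∧ Smo z m) with hT
  have h1 : QQ PP F X 0 ≤ ∑ m ∈ (Ioc 0 X).filter (fun m => DD PP m ≤ 0 ∧ IsUnit (F m)), (1:ℝ)/m := by
    unfold QQ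
    rw [← filter_filter]
    rw [sum_filter (fun m => IsUnit (F m))]
    apply sum_le_sum
    intro m _
    rw [uni_apply]
    split_ifs <;> simp
  refine h1.trans ?_
  calc _ ≤ ∑ m ∈ MM ∪ T, (1:ℝ)/m := by
        apply sum_le_sum_of_subset_of_nonneg
        · intro m hm
          rw [mem_filter] at hm
          have hs := smo_of_DD hm.1 hm.2.1
          rw [mem_union]
          by_cases hv : (m:ℝ) ≤ V
          · left; rw [hMM]; exact ⟨(mem_Ioc.1 hm.1).1, hv, hm.2.2, hs⟩
          · right; rw [hT, mem_filter]
            exact ⟨hm.1, by linarith, fun p hp hpm => (hs p hp hpm).trans hyz⟩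
        · intros; positivity
    _ ≤ ∑ m ∈ MM, (1:ℝ)/m + ∑ m ∈ T, (1:ℝ)/m := by
        rw [← sum_union_inter]
        have : 0 ≤ ∑ m ∈ MM ∩ T, (1:ℝ)/m := by positivity
        linarith
    _ ≤ _ := by
        gcongr
        apply hτ
        intro m hm
        rw [hT, mem_filter] at hm; exact hm.2

lemma inconv_main (R S : ℤ) (k j n : ℕ) (D : ℝ) (hD : D = 4*(43+n)) : ∃ C M : ℝ, 0 < C ∧ ∀ (X a z : ℕ) (l : ℝ), l = Real.log X → 0 < X → 16 ≤ l →
    M ≤ l → 1 ≤ Real.log l → √l ≤ Real.log ((8:ℝ)^a) → M * l^n ≤ (8:ℝ)^a → 8^a ≤ z →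
    l/(2*D*Real.log l) ≤ Real.log z → Real.log z ≤ l/(D*Real.log l) → M * l^n * Real.exp (l/4) ≤ Real.exp l →
    ∀ (q : ℕ) [NeZero q], OKq R q → (q:ℝ) ≤ l^k → ∀ (F : ℕ → ZMod q) (_ : ∀ m n : ℕ, m.Coprime n → F (m*n) = F m * F n)
    (_ : ∀ p : ℕ, p.Prime → F p = (R:ZMod q)*p+S) (_ : F 1 = 1) (MM : Finset ℕ),
    (∀ m, m ∈ MM ↔ 0 < m ∧ (m:ℝ) ≤ Real.exp (l/4) ∧ IsUnit (F m) ∧ Smo (8^a) m) → ∀ w : ZMod q, IsUnit w → 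
    1 ≤ ∑ m ∈ MM, (1:ℝ)/m ∧
    ∑ n ∈ (Ioc 0 X).filter (fun n => DD ((Ioc (8^a) X).filter Nat.Prime) n ≤ j), ind w (F n) ≤ 
      3 * (X/l^n) + C * (X/l * Real.log l^(j+1) * ∑ m ∈ MM, (1:ℝ)/m)/(Nat.totient q) := by
  obtain ⟨z0, hz0, HK⟩ := kap R S (2*k)
  have hD0 : 0 < D := by rw [hD]; positivity
  refine ⟨16*D*41^j, max (z0:ℝ) (Real.exp 98), by positivity, ?_⟩
  intro X a z l hl hX h16 hMl hlog ha hMa haz hz1 hz2 hV q _ hq hqk F hF hFp hF1 MM hMM w hw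
  have hM1 : (1:ℝ) ≤ max (z0:ℝ) (Real.exp 98) := le_max_of_le_right (Real.one_le_exp (by norm_num))
  set M := max (z0:ℝ) (Real.exp 98) with hM
  have hl1 : (1:ℝ) ≤ l^n := one_le_pow₀ (by linarith)
  have hX0 : (0:ℝ) < X := by exact_mod_cast hX
  have hXe : Real.exp l = X := by rw [hl, Real.exp_log hX0]
  have h8z : (8:ℝ)^a ≤ z := by exact_mod_cast haz
  have hzM : M * l^n ≤ z := hMa.trans h8z
  have hzz0 : (z0:ℝ) ≤ z := by
    have : (z0:ℝ) ≤ M := le_max_left _ _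
    nlinarith
  have hzpos : (0:ℝ) < z := by nlinarith
  have hlz : √l ≤ Real.log z := ha.trans (Real.log_le_log (by positivity) h8z)
  have hsq : 0 ≤ √l := by positivity
  have hlz0 : 0 < Real.log z := lt_of_lt_of_le (Real.sqrt_pos.2 (by linarith)) hlz
  have hqz : (q:ℝ) ≤ Real.log z^(2*k) := by
    refine hqk.trans ?_
    calc l^k = (√l)^(2*k) := by rw [pow_mul, Real.sq_sqrt (by linarith)]
      _ ≤ _ := by gcongr
  have hτ : ∀ T : Finset ℕ, (∀ m ∈ T, Real.exp (l/4) ≤ m ∧ Smo z m) → ∑ m ∈ T, (1:ℝ)/m ≤ 1/l^n := fun T hT =>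
    tau_bound n D l hD h16 ((le_max_right _ _).trans hMl) hlog z hlz hz2 T hT
  have hφ : (0:ℝ) < (Nat.totient q : ℝ) := by exact_mod_cast Nat.totient_pos.2 (Nat.pos_of_ne_zero (NeZero.ne q))
  have hI := inconv_comb R S F hF hFp w hw ((Ioc (8^a) X).filter Nat.Prime) z X j (Nat.succ_le_of_lt (by exact_mod_cast hzpos)) (Real.exp (l/4)) (1/l^n)
    (4/(Nat.totient q * Real.log z)) (by positivity) (by positivity) hτ (fun u hu Z => HK z (by exact_mod_cast hzz0) q hq hqz w u hu Z)
  have hQ0 := QQ_zero_le F (8^a) z X haz (Real.exp (l/4)) (1/l^n) hτ MM hMM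
  have hQ1 : 1 ≤ ∑ m ∈ MM, (1:ℝ)/m := by
    have h1 : 1 ∈ MM := by
      rw [hMM]
      refine ⟨one_pos, ?_, by rw [hF1]; exact isUnit_one, ?_⟩
      · push_cast; exact Real.one_le_exp (by linarith)
      · intro p hp h1; exact absurd (Nat.dvd_one.1 h1) hp.one_lt.ne'
    calc (1:ℝ) = 1/((1:ℕ):ℝ) := by norm_num
      _ ≤ _ := single_le_sum (f := fun m : ℕ => (1:ℝ)/m) (fun m _ => by positivity) h1
  refine ⟨hQ1, hI.trans ?_⟩
  set Q := ∑ m ∈ MM, (1:ℝ)/m with hQ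
  have hX3 : 3 ≤ X := by
    have : (3:ℝ) ≤ X := by rw [← hXe]; linarith [Real.add_one_le_exp l]
    exact_mod_cast this
  have hmer := mertens X hX3
  rw [← hl] at hmer
  set Λ := Real.log l with hΛ
  have hPPs : ∑ P ∈ (Ioc (8^a) X).filter Nat.Prime, (1:ℝ)/P ≤ 14 + 6 * Λ := by
    refine le_trans ?_ hmer
    apply sum_le_sum_of_subset_of_nonneg
    · apply filter_subset_filter
      exact Ioc_subset_Ioc_left (by positivity)
    · intros; positivity
  have hQj := QQ_le F hF ((Ioc (8^a) X).filter Nat.Prime) (fun P hP => (mem_filter.1 hP).2) X (28+12*Λ) (by linarith) (by positivity) j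
  have hQj2 : QQ ((Ioc (8^a) X).filter Nat.Prime) F X j ≤ (41*Λ)^j * (2*Q) := by
    refine hQj.trans ?_
    have : 1/l^n ≤ 1 := by rw [div_le_one (by positivity)]; exact hl1
    gcongr
    · exact QQ_nonneg _ _ _ _
    · linarith
    · linarith
  have b1 : Real.exp (l/4) ≤ X/l^n := by
    rw [le_div_iff₀ (by positivity), ← hXe]
    refine le_trans ?_ hV
    rw [mul_comm]; gcongr
    nlinarith
  have b2 : (X:ℝ)/z ≤ X/l^n := by
    gcongr; nlinarith
  have b3 : 4/(Nat.totient q * Real.log z) * X * QQ ((Ioc (8^a) X).filter Nat.Prime) F X j ≤ 16*D*41^j * (X/l * Λ^(j+1) * Q)/(Nat.totient q) := by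
    have : 4/(Nat.totient q * Real.log z) ≤ 8*D*Λ/(Nat.totient q*l) := by
      calc 4/(Nat.totient q * Real.log z) ≤ 4/(Nat.totient q * (l/(2*D*Λ))) := by gcongr
        _ = _ := by field_simp; norm_num
    calc _ ≤ 8*D*Λ/(Nat.totient q*l) * X * ((41*Λ)^j * (2*Q)) := by
          gcongr
          exact QQ_nonneg _ _ _ _
      _ = _ := by rw [mul_pow]; field_simp; ring
  have b4 : (X:ℝ) * (1/l^n) = X/l^n := by ring
  linarith
end SW
end

section
open Finset Filter
namespace SW

lemma HP_main (B' : ℕ) (hB' : 1 ≤ B') : ∃ C : ℝ, 0 < C ∧ ∀ (a X : ℕ) (l : ℝ), 16 ≤ l → √l ≤ Real.log ((8:ℝ)^a) → 1 ≤ a →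
    ∀ (q : ℕ) [NeZero q], (q:ℝ) ≤ 8^a → ∀ G : ZMod q → ℝ, (∀ v, |G v| ≤ 1) → ∀ Z : ℕ,
    |∑ P ∈ ((Ioc (8^a) X).filter Nat.Prime) with P ≤ Z, (G P - (∑ u : (ZMod q)ˣ, G u)/(Fintype.card (ZMod q)ˣ))| ≤ 
      (C * q^2/l^B') * Z := by
  obtain ⟨C, hC, H⟩ := prime_eq (2*B'-1)
  refine ⟨2*C, by positivity, ?_⟩
  intro a X l h16 ha ha1 q _ hqa G hG Z
  have h8 : 8 ≤ 8^a := by calc 8 = 8^1 := by norm_num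
                            _ ≤ 8^a := Nat.pow_le_pow_right (by norm_num) ha1
  have e : ((Ioc (8^a) X).filter Nat.Prime).filter (fun P => P ≤ Z) = (Ico (8^a+1) (min X Z + 1)).filter Nat.Prime := by
    ext p; simp only [mem_filter, mem_Ioc, mem_Ico]
    constructor
    · rintro ⟨⟨h1, h2⟩, h3⟩; exact ⟨by omega, h2⟩
    · rintro ⟨h1, h2⟩; exact ⟨⟨by omega, h2⟩, by omega⟩
  rw [e]
  by_cases hc : 8^a ≤ min X Z
  · have := H q G hG (8^a+1) (min X Z + 1) (by omega) (by omega) (by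
      have : q ≤ 8^a := by exact_mod_cast hqa
      omega)
    rw [sum_sub_distrib, sum_const, nsmul_eq_mul, ZMod.card_units_eq_totient, mul_comm]
    rw [mul_comm] at this
    rw [mul_comm]
    rw [mul_comm] at this
    refine le_trans (le_of_eq (by congr 2; ring)) (this.trans ?_)
    have hlog : l^B' ≤ Real.log ((8^a+1:ℕ):ℝ)^(2*B'-1+1) := by
      rw [show 2*B'-1+1 = 2*B' by omega, pow_mul]
      have : √l ≤ Real.log ((8^a+1:ℕ):ℝ) := by
        refine ha.trans (Real.log_le_log (by positivity) ?_)
        push_cast; linarith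
      have h2 : l ≤ Real.log ((8^a+1:ℕ):ℝ)^2 := by
        have : √l^2 ≤ Real.log ((8^a+1:ℕ):ℝ)^2 := by gcongr
        rwa [Real.sq_sqrt (by linarith)] at this
      gcongr
    have hZ : ((min X Z + 1 : ℕ):ℝ) ≤ 2 * Z := by
      have : min X Z + 1 ≤ 2 * Z := by omega
      exact_mod_cast this
    calc _ ≤ C * q^2 * (2*Z) / l^B' := by gcongr
      _ = _ := by ring
  · rw [Ico_eq_empty (by omega)]
    simp only [filter_empty, sum_empty, abs_zero]
    positivity

lemma conv_main (R S : ℤ) (k J n : ℕ) : ∃ M : ℝ, ∀ (X a : ℕ) (l : ℝ), l = Real.log X → 0 < X → 16 ≤ l →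
    M ≤ l → √l ≤ Real.log ((8:ℝ)^a) → M * l^(n+J+2+k) ≤ (8:ℝ)^a → 1 ≤ a →
    ∀ (q : ℕ) [NeZero q], (q:ℝ) ≤ l^k → ∀ (F : ℕ → ZMod q) (_ : ∀ m n : ℕ, m.Coprime n → F (m*n) = F m * F n)
    (_ : ∀ p : ℕ, p.Prime → F p = (R:ZMod q)*p+S) (h h' : ZMod q → ℝ), (∀ w, |h w| ≤ 1) → (∀ w, |h' w| ≤ 1) → ∀ κ : ℝ, 0 ≤ κ →
    (∀ w, |(TT R S)^[J] h w| ≤ κ * (TT R S)^[J] h' w) →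
    |∑ m ∈ (Ioc 0 X).filter (fun m => J ≤ DD ((Ioc (8^a) X).filter Nat.Prime) m), h (F m)| ≤ 
      κ * ∑ m ∈ (Ioc 0 X).filter (fun m => J ≤ DD ((Ioc (8^a) X).filter Nat.Prime) m), h' (F m) + (1+κ) * (X/l^n) := by
  obtain ⟨C, hC, H⟩ := HP_main (2*k+J+2+n) (by omega)
  refine ⟨J*2^(J+1)*(2+C) + 1, ?_⟩
  intro X a l hl hX h16 hMl ha hMa ha1 q _ hqk F hF hFp h h' hh hh' κ hκ hT
  set M : ℝ := J*2^(J+1)*(2+C) + 1 with hM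
  have hM1 : 1 ≤ M := by rw [hM]; have : 0 ≤ J*2^(J+1)*(2+C) := by positivity
                         linarith
  have hl1 : 1 ≤ l := by linarith
  have h8l : l^(n+J+2+k) ≤ (8:ℝ)^a := by
    refine le_trans ?_ hMa
    have : 0 ≤ l^(n+J+2+k) := by positivity
    nlinarith
  have hq8 : (q:ℝ) ≤ 8^a := by
    refine (hqk.trans ?_).trans h8l
    exact pow_le_pow_right₀ hl1 (by omega)
  have hX0 : (0:ℝ) < X := by exact_mod_cast hX
  have harm : ∑ m ∈ Ioc 0 X, (1:ℝ)/m ≤ 1 + l := by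
    have := harmonic_le_one_add_log X
    rw [hl]; refine le_trans (le_of_eq ?_) this
    rw [harmonic_eq_sum_Icc]; push_cast
    rw [show Ioc 0 X = Icc 1 X from rfl]
    apply sum_congr rfl; intros; rw [one_div]
  have hPs : ∑ P ∈ (Ioc (8^a) X).filter Nat.Prime, (1:ℝ)/P ≤ 1 + l := by
    refine le_trans ?_ harm
    apply sum_le_sum_of_subset_of_nonneg
    · refine (filter_subset _ _).trans ?_
      exact Ioc_subset_Ioc_left (by positivity)
    · intros; positivity
  have hsq := inv_sq_sum (8^a) X (Nat.one_le_pow _ _ (by norm_num))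
  have := conv_final R S F hF ((Ioc (8^a) X).filter Nat.Prime) (fun P hP => (mem_filter.1 hP).2) (fun P hP => hFp P (mem_filter.1 hP).2)
    _ (1+l) (C * q^2/l^(2*k+J+2+n)) hsq (by linarith) (by positivity) hPs (fun G hG Z => H a X l h16 ha ha1 q hq8 G hG Z) J X harm h h' hh hh' κ hκ hT
  refine this.trans ?_
  gcongr
  have e1 : (1:ℝ)/((8^a:ℕ):ℝ) ≤ 1/l^(n+J+2) := by
    push_cast
    gcongr
    refine le_trans ?_ h8l
    exact pow_le_pow_right₀ hl1 (by omega)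
  have e2 : C * q^2/l^(2*k+J+2+n) ≤ C/l^(n+J+2) := by
    calc C * q^2/l^(2*k+J+2+n) ≤ C * (l^k)^2/l^(2*k+J+2+n) := by gcongr
      _ = _ := by
        rw [show 2*k+J+2+n = k*2 + (n+J+2) by omega, pow_add, ← pow_mul]
        field_simp
  calc _ ≤ J * X * (2*l)^(J+1) * (2*(1/l^(n+J+2)) + C/l^(n+J+2)) := by
        gcongr; linarith
    _ = (J*2^(J+1)*(2+C)) * (X/l^n) / l := by
        rw [mul_pow, show n+J+2 = n + ((J+1)+1) by omega]
        field_simp; ring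
    _ ≤ l * (X/l^n)/l := by gcongr; linarith
    _ = _ := by field_simp
end SW
end

section
open Finset Filter
namespace SW

lemma core_num (c ε C l Λ X Q N φ : ℝ) (J k n : ℕ) (hn : n = k+2) (hε : 0 < ε) (hc : 0 < c) (hC : 0 < C) (hl1 : 1 ≤ l) (hlog1 : 1 ≤ Λ)
    (hX : 0 < X) (hQ1 : 1 ≤ Q) (hφ1 : 1 ≤ φ) (hφl : φ ≤ l^k)
    (hlow : c * (X/l * Λ^(J+2) * Q) ≤ N) (hM4 : 8*C/(c*ε) ≤ Λ) (hM5 : 4*(7+ε)/(c*ε) ≤ l) 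
    (Cw Cv U Iw Iv : ℝ) (hcon : |Cw - Cv| ≤ ε/4/φ * U + (1 + ε/4/φ) * (X/l^n)) (hU : U ≤ N)
    (hIw0 : 0 ≤ Iw) (hIv0 : 0 ≤ Iv) (hIw : Iw ≤ 3 * (X/l^n) + C * (X/l * Λ^J * Q)/φ) (hIv : Iv ≤ 3 * (X/l^n) + C * (X/l * Λ^J * Q)/φ) :
    |Cw + Iw - (Cv + Iv)| ≤ ε/φ*N := by
  have hW0 : 0 ≤ X/l * Λ^J * Q := by positivity
  have n1 : C * (X/l * Λ^J * Q) / φ ≤ ε/8 * (N/φ) := by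
    have h1 : c * (X/l * Λ^J * Q) * Λ^2 ≤ N := by
      refine le_trans (le_of_eq ?_) hlow; ring
    have h2 : 8*C/(c*ε) ≤ Λ^2 := hM4.trans (le_self_pow₀ hlog1 (by norm_num))
    have h3 : 8*C/(c*ε) * (c * (X/l * Λ^J * Q)) ≤ N := by
      refine le_trans ?_ h1
      rw [mul_comm]; gcongr
    have h4 : C * (X/l * Λ^J * Q) = ε/8 * (8*C/(c*ε) * (c * (X/l * Λ^J * Q))) := by
      generalize X/l * Λ^J * Q = W
      field_simp
    rw [h4, mul_div_assoc]; gcongr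
  have n2 : (7+ε) * (X/l^n) ≤ ε/4 * (N/φ) := by
    have h1 : c * (X/l) ≤ N := by
      refine le_trans ?_ hlow
      have : 1 ≤ Λ^(J+2) := one_le_pow₀ hlog1
      have h2 : 1 ≤ Λ^(J+2) * Q := by nlinarith
      have h3 : 0 ≤ X/l := by positivity
      rw [mul_assoc (X/l)]
      gcongr
      nlinarith
    have hN : 0 ≤ N := le_trans (by positivity) h1
    have h2 : c * (X/l) / l^k ≤ N/φ := by
      gcongr
    calc (7+ε) * (X/l^n) = ε/4 * (4*(7+ε)/(c*ε) / l * (c * (X/l)/l^k)) := by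
          rw [hn, pow_add]; field_simp
      _ ≤ ε/4 * (1 * (c * (X/l)/l^k)) := by
          gcongr
          rw [div_le_one (by linarith)]; exact hM5
      _ ≤ _ := by rw [one_mul]; gcongr
  have n3 : ε/4/φ * U ≤ ε/4 * (N/φ) := by
    calc _ ≤ ε/4/φ * N := by gcongr
      _ = _ := by ring
  have n4 : (1 + ε/4/φ) * (X/l^n) ≤ (1+ε) * (X/l^n) := by
    gcongr
    have : ε/4/φ ≤ ε/4 := div_le_self (by positivity) hφ1
    linarith
  have n5 : ε/φ*N = ε * (N/φ) := by ring
  have h0 : 0 ≤ X/l^n := by positivity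
  have hcon2 := abs_le.1 hcon
  have e1 : (7+ε) * (X/l^n) = 6 * (X/l^n) + (1+ε) * (X/l^n) := by ring
  have hNφ : 0 ≤ N/φ := by
    have : 0 ≤ ε/8 * (N/φ) := le_trans (by positivity) n1
    by_contra hcc
    nlinarith
  rw [n5, abs_le]
  generalize N/φ = T at *
  generalize X/l^n = E at *
  have : 0 ≤ ε*T := by positivity
  constructor <;> linarith [hcon2.1, hcon2.2]

open Classical in
lemma core (R S : ℤ) (k : ℕ) (ε : ℝ) (hε : 0 < ε) : ∃ X0 : ℕ, ∀ X : ℕ, X0 ≤ X → ∀ (q : ℕ) [NeZero q], OKq R q →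
    (q:ℝ) ≤ Real.log X^k → ∀ (F : ℕ → ZMod q) (_ : ∀ m n : ℕ, m.Coprime n → F (m*n) = F m * F n)
    (_ : ∀ p : ℕ, p.Prime → F p = (R:ZMod q)*p+S) (_ : F 1 = 1) (w v : ZMod q), IsUnit w → IsUnit v → 
    |∑ n ∈ Ioc 0 X, ind w (F n) - ∑ n ∈ Ioc 0 X, ind v (F n)| ≤ ε / (Nat.totient q) * ∑ n ∈ Ioc 0 X, uni (F n) := by
  obtain ⟨J, hJ1, HJ⟩ := mix_final R S (ε/4) (by positivity)
  set n := k+2 with hn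
  set D : ℝ := 4*(43+n) with hD
  have hD1 : 1 ≤ D := by rw [hD]; have : (0:ℝ) ≤ n := by positivity
                         linarith
  obtain ⟨c, M1, hc, HL⟩ := lower_main R S k J
  obtain ⟨C, M2, hC, HI⟩ := inconv_main R S k (J-1) n D hD
  obtain ⟨M3, HC⟩ := conv_main R S k J n
  set M4 := 8*C/(c*ε) with hM4
  set M5 := 4*(7+ε)/(c*ε) with hM5
  set M : ℝ := |M1| + |M2| + |M3| + |M4| + |M5| with hM
  have a1 := le_abs_self M1
  have a2 := le_abs_self M2
  have a3 := le_abs_self M3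
  have a4 := le_abs_self M4
  have a5 := le_abs_self M5
  have b1 := abs_nonneg M1
  have b2 := abs_nonneg M2
  have b3 := abs_nonneg M3
  have b4 := abs_nonneg M4
  have b5 := abs_nonneg M5
  have hpar := params M D hD1 (n+J+2+k) (2*J+5) (by omega)
  have hpar2 := (Real.tendsto_log_atTop.comp (tendsto_natCast_atTop_atTop (R := ℝ))).eventually hpar
  obtain ⟨X0, hX0⟩ := eventually_atTop.1 hpar2
  refine ⟨max X0 1, ?_⟩
  intro X hX q _ hq hqk F hF hFp hF1 w v hw hv
  have hXpos : 0 < X := by omega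
  have hXr : (0:ℝ) < X := by exact_mod_cast hXpos
  have hXX := hX0 X (le_trans (le_max_left _ _) hX)
  simp only [Function.comp_apply] at hXX
  obtain ⟨l, hl⟩ : ∃ l, l = Real.log (X:ℝ) := ⟨_, rfl⟩
  rw [← hl] at hXX hqk
  obtain ⟨a, b, z, h16, hMl, hlog1, hMlog, ha, hMa, hb1, ha1, hlb, hU, haz, hz1, hz2, hMX⟩ := hXX
  have hl1 : 1 ≤ l := by linarith
  have hM0 : 0 ≤ M := by rw [hM]; positivity
  have hpw : l^n ≤ l^(n+J+2+k) := pow_le_pow_right₀ hl1 (by omega)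
  have hpw0 : 1 ≤ l^(n+J+2+k) := one_le_pow₀ hl1
  have hn0 : 0 ≤ l^n := by positivity
  set MM := (Ioc 0 X).filter (fun m : ℕ => (m:ℝ) ≤ Real.exp (l/4) ∧ IsUnit (F m) ∧ Smo (8^a) m) with hMM
  have hmem : ∀ m, m ∈ MM ↔ 0 < m ∧ (m:ℝ) ≤ Real.exp (l/4) ∧ IsUnit (F m) ∧ Smo (8^a) m := by
    intro m
    rw [hMM, mem_filter, mem_Ioc]
    constructor
    · rintro ⟨⟨h1, _⟩, h⟩; exact ⟨h1, h⟩
    · rintro ⟨h1, h⟩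
      refine ⟨⟨h1, ?_⟩, h⟩
      have : (m:ℝ) ≤ X := by
        refine h.1.trans ?_
        rw [← Real.exp_log hXr, ← hl]
        apply Real.exp_le_exp.2; linarith
      exact_mod_cast this
  have hlow := HL X a b l hl hXpos h16 hlog1 ha (by nlinarith) hb1 ha1 hlb hU q hq hqk F hF hFp MM (fun m hm => (hmem m).1 hm)
  have hM2a : M2 * l^n ≤ M * l^(n+J+2+k) := by
    have : M2 * l^n ≤ M * l^n := by gcongr; linarith
    refine this.trans (by gcongr)
  have hinc : ∀ w : ZMod q, IsUnit w → _ := fun w hw => HI X a z l hl hXpos h16 (by linarith) hlog1 ha (hM2a.trans hMa) haz hz1 hz2 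
    (le_trans (by gcongr) hMX) q hq hqk F hF hFp hF1 MM hmem w hw
  have hcon := HC X a l hl hXpos h16 (by linarith) ha (le_trans (by gcongr; linarith) hMa) ha1 q hqk F hF hFp 
    (fun x => ind w x - ind v x) uni (fun x => by
      have h1 := ind_nonneg w x
      have h2 := ind_nonneg v x
      have h3 := ind_le_one w x
      have h4 := ind_le_one v x
      rw [abs_le]; constructor <;> linarith) uni_abs_le (ε/4/(Nat.totient q)) (by positivity) (fun x => HJ q hq w v x hw hv)
  set PP := (Ioc (8^a) X).filter Nat.Prime with hPP
  obtain ⟨hQ1, hIw⟩ := hinc w hw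
  obtain ⟨_, hIv⟩ := hinc v hv
  rw [show J - 1 + 1 = J by omega] at hIw hIv
  set Q := ∑ m ∈ MM, (1:ℝ)/m with hQ
  set Λ := Real.log l with hΛ
  set N := ∑ n ∈ Ioc 0 X, uni (F n) with hN
  set φ : ℝ := (Nat.totient q : ℝ) with hφ
  have hφ1 : 1 ≤ φ := by
    rw [hφ]; exact_mod_cast Nat.totient_pos.2 (Nat.pos_of_ne_zero (NeZero.ne q))
  have hφl : φ ≤ l^k := by
    refine le_trans ?_ hqk
    rw [hφ]; exact_mod_cast Nat.totient_le q
  have hsplit : ∀ g : ℕ → ℝ, ∑ n ∈ Ioc 0 X, g n = ∑ n ∈ (Ioc 0 X).filter (fun n => J ≤ DD PP n), g n 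
      + ∑ n ∈ (Ioc 0 X).filter (fun n => DD PP n ≤ J-1), g n := by
    intro g
    rw [← sum_filter_add_sum_filter_not (Ioc 0 X) (fun n => J ≤ DD PP n)]
    congr 2
    apply filter_congr
    intro x _; omega
  have hNc : ∑ n ∈ (Ioc 0 X).filter (fun n => J ≤ DD PP n), uni (F n) ≤ N := by
    apply sum_le_sum_of_subset_of_nonneg (filter_subset _ _)
    intros; exact uni_nonneg _
  have hIw0 : 0 ≤ ∑ n ∈ (Ioc 0 X).filter (fun n => DD PP n ≤ J-1), ind w (F n) := sum_nonneg (fun _ _ => ind_nonneg _ _)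
  have hIv0 : 0 ≤ ∑ n ∈ (Ioc 0 X).filter (fun n => DD PP n ≤ J-1), ind v (F n) := sum_nonneg (fun _ _ => ind_nonneg _ _)
  rw [hsplit (fun n => ind w (F n)), hsplit (fun n => ind v (F n))]
  rw [sum_sub_distrib] at hcon
  exact core_num c ε C l Λ X Q N φ J k n hn hε hc hC hl1 hlog1 hXr hQ1 hφ1 hφl hlow (by linarith) (by linarith) _ _ _ _ _ hcon hNc hIw0 hIv0 hIw hIv
end SW
end

section
open Finset Filter
namespace SW

open Classical in
lemma cnt_eq (x : ℝ) (hx : 0 ≤ x) (P : ℕ → Prop) : (cnt x P : ℝ) = ∑ n ∈ Ioc 0 ⌊x⌋₊, (if P n then (1:ℝ) else 0) := by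
  unfold cnt
  have : {n : ℕ | 0 < n ∧ (n : ℝ) ≤ x ∧ P n} = ((Ioc 0 ⌊x⌋₊).filter P : Finset ℕ) := by
    ext n
    simp only [Set.mem_setOf_eq, coe_filter, mem_Ioc]
    rw [Nat.le_floor_iff hx, and_assoc]
  rw [this, Set.ncard_coe_finset, sum_boole]

lemma gcd_unit (q : ℕ) (m : ℤ) : Int.gcd m q = 1 ↔ IsUnit (m : ZMod q) := by
  rw [ZMod.coe_int_isUnit_iff_isCoprime, Int.isCoprime_iff_gcd_eq_one, Int.gcd_comm]

lemma uni_sum {q : ℕ} [NeZero q] (w : ZMod q) : uni w = ∑ u : (ZMod q)ˣ, ind (u : ZMod q) w := by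
  classical
  rw [uni_apply]
  simp only [ind_apply]
  split_ifs with h
  · obtain ⟨u, rfl⟩ := h
    rw [sum_eq_single u]
    · simp
    · intro v _ hv
      rw [if_neg]
      intro h; exact hv (Units.ext h.symm)
    · simp
  · rw [sum_eq_zero]
    intro u _
    rw [if_neg]
    rintro rfl
    exact h u.isUnit

lemma OKq_of_gcd (R : ℤ) (q : ℕ) (h : Int.gcd (q:ℤ) (6*R) = 1) : OKq R q := by
  intro ℓ hℓ hd
  have key : ∀ m : ℤ, (ℓ:ℤ) ∣ 6 * R → False := by
    intro _ h2
    have h3 : ℓ ∣ Int.gcd (q:ℤ) (6*R) := by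
      apply Int.dvd_gcd _ h2 
      exact_mod_cast hd
    rw [h] at h3
    exact hℓ.one_lt.ne' (Nat.dvd_one.1 h3)
  refine ⟨?_, fun h1 => key 0 (Dvd.dvd.mul_left h1 6)⟩
  by_contra hc
  push Not at hc
  have h2 := hℓ.two_le
  interval_cases ℓ
  · exact key 0 (Dvd.dvd.mul_right (by norm_num) R)
  · exact key 0 (Dvd.dvd.mul_right (by norm_num) R)
  · revert hℓ; norm_num

lemma qk (K : ℝ) (hK : 0 < K) : ∃ k : ℕ, ∃ x1 : ℝ, ∀ x, x1 ≤ x → Real.log x ^ K ≤ Real.log (⌊x⌋₊:ℝ)^k := by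
  refine ⟨2*⌈K⌉₊, Real.exp 3, ?_⟩
  intro x hx
  have hx3 : 3 ≤ Real.log x := (Real.le_log_iff_exp_le (lt_of_lt_of_le (Real.exp_pos _) hx)).2 hx
  have hx4 : 4 ≤ x := by linarith [Real.add_one_le_exp (3:ℝ)]
  have h1 := floor_half (t := x) (by linarith)
  have h2 : Real.log x - Real.log 2 ≤ Real.log (⌊x⌋₊:ℝ) := by
    rw [← Real.log_div (by linarith) (by norm_num)]
    exact Real.log_le_log (by linarith) h1
  have h3 := Real.log_two_lt_d9
  calc Real.log x ^ K ≤ Real.log x ^ ((⌈K⌉₊:ℕ):ℝ) := Real.rpow_le_rpow_of_exponent_le (by linarith) (Nat.le_ceil K)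
    _ = Real.log x ^ ⌈K⌉₊ := Real.rpow_natCast _ _
    _ ≤ (Real.log (⌊x⌋₊:ℝ)^2)^⌈K⌉₊ := by
      gcongr; nlinarith
    _ = _ := by rw [← pow_mul]
end SW
end

open SW in
/-- **Theorem 1.2 (linear case).** Let `f` be an integer-valued multiplicative function with
`f(p) = R p + S` for all primes `p`, `R ≠ 0`. Fix `K > 0`. Then `f` is asymptotically weakly
uniformly distributed modulo `q`, uniformly for `q ≤ (log x)^K` with `gcd(q, 6R) = 1`. -/
theorem stmt0 (f : ℕ → ℤ) (R S : ℤ) (hR : R ≠ 0)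
    (hf1 : f 1 = 1)
    (hfm : ∀ m n : ℕ, Nat.Coprime m n → f (m * n) = f m * f n)
    (hfp : ∀ p : ℕ, p.Prime → f p = R * p + S)
    (K : ℝ) (hK : 0 < K) :
    ∀ ε : ℝ, 0 < ε → ∃ x₀ : ℝ, ∀ x : ℝ, x₀ ≤ x →
      ∀ q : ℕ, 0 < q → (q : ℝ) ≤ Real.log x ^ K → Int.gcd (q : ℤ) (6 * R) = 1 →
        ∀ a : ℤ, Int.gcd a (q : ℤ) = 1 →
          |(cnt x (fun n => f n ≡ a [ZMOD (q : ℤ)]) : ℝ)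
              - (1 / (Nat.totient q : ℝ)) * (cnt x (fun n => Int.gcd (f n) (q : ℤ) = 1) : ℝ)|
            ≤ (ε / (Nat.totient q : ℝ)) * (cnt x (fun n => Int.gcd (f n) (q : ℤ) = 1) : ℝ) := by
  intro ε hε
  obtain ⟨k, x1, hk⟩ := qk K hK
  obtain ⟨X0, hX0⟩ := core R S k ε hε
  refine ⟨max (max x1 X0) 0, ?_⟩
  intro x hx q hq0 hq hg a ha
  have hx0 : 0 ≤ x := (le_max_right _ _).trans hx
  have hxx : max x1 X0 ≤ x := (le_max_left _ _).trans hx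
  have hX : X0 ≤ ⌊x⌋₊ := Nat.le_floor ((le_max_right _ _).trans hxx)
  have hqk := hq.trans (hk x ((le_max_left _ _).trans hxx))
  haveI : NeZero q := ⟨hq0.ne'⟩
  have hau := (gcd_unit q a).1 ha
  have H := fun v : (ZMod q)ˣ => hX0 ⌊x⌋₊ hX q (OKq_of_gcd R q hg) hqk (fun n => (f n : ZMod q)) 
    (fun m n h => by rw [hfm m n h]; push_cast; rfl) (fun p hp => by rw [hfp p hp]; push_cast; rfl)
    (by rw [hf1]; simp) a v hau v.isUnit
  classical
  have e1 : (cnt x (fun n => f n ≡ a [ZMOD (q : ℤ)]) : ℝ) = ∑ n ∈ Finset.Ioc 0 ⌊x⌋₊, ind (a : ZMod q) (f n : ZMod q) := by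
    rw [cnt_eq x hx0]
    apply Finset.sum_congr rfl
    intro n _
    rw [ind_apply]
    simp only [ZMod.intCast_eq_intCast_iff]
    split_ifs <;> rfl
  have e2 : (cnt x (fun n => Int.gcd (f n) (q : ℤ) = 1) : ℝ) = ∑ n ∈ Finset.Ioc 0 ⌊x⌋₊, uni (f n : ZMod q) := by
    rw [cnt_eq x hx0]
    apply Finset.sum_congr rfl
    intro n _
    rw [uni_apply]
    simp only [gcd_unit]
  rw [e1, e2]
  set N := ∑ n ∈ Finset.Ioc 0 ⌊x⌋₊, uni (f n : ZMod q) with hN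
  set Na := ∑ n ∈ Finset.Ioc 0 ⌊x⌋₊, ind (a : ZMod q) (f n : ZMod q) with hNa
  have hNs : N = ∑ u : (ZMod q)ˣ, ∑ n ∈ Finset.Ioc 0 ⌊x⌋₊, ind (u : ZMod q) (f n : ZMod q) := by
    rw [Finset.sum_comm, hN]
    apply Finset.sum_congr rfl
    intro n _; exact uni_sum _
  have hφ : (0:ℝ) < (Nat.totient q : ℝ) := by exact_mod_cast Nat.totient_pos.2 hq0
  have hcard : (Fintype.card (ZMod q)ˣ : ℝ) = (Nat.totient q : ℝ) := by rw [ZMod.card_units_eq_totient]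
  have hd : Na - 1/(Nat.totient q : ℝ) * N = 1/(Nat.totient q : ℝ) * ∑ u : (ZMod q)ˣ, (Na - ∑ n ∈ Finset.Ioc 0 ⌊x⌋₊, ind (u : ZMod q) (f n : ZMod q)) := by
    rw [Finset.sum_sub_distrib, ← hNs, Finset.sum_const, nsmul_eq_mul, Finset.card_univ, hcard]
    field_simp
  rw [hd, abs_mul, abs_of_pos (by positivity)]
  calc _ ≤ 1/(Nat.totient q : ℝ) * ∑ u : (ZMod q)ˣ, (ε / (Nat.totient q : ℝ) * N) := by
        gcongr
        refine (Finset.abs_sum_le_sum_abs _ _).trans ?_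
        exact Finset.sum_le_sum (fun u _ => H u)
    _ = _ := by
        rw [Finset.sum_const, nsmul_eq_mul, Finset.card_univ, hcard]
        field_simp
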